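/- Let 2 ≤ n ≤ 5, let Ω ⊆ ℝⁿ be an open set, and let f : Ω → ℝ be a smooth function whose Hessian matrix H(x) = (∂²f/∂xᵢ∂xⱼ(x)) is positive definite at every x ∈ Ω. Assume the affine Kähler scalar curvature S = −(1/2) Σᵢⱼ H^{ij} ∂ᵢ∂ⱼ(log det H) vanishes identically on Ω, and assume the Calabi metric g = Σ fᵢⱼ dxᵢ dxⱼ on Ω is complete. Then f is a quadratic polynomial: there exist a symmetric positive definite n×n real matrix A, a vector b ∈ ℝⁿ, and c ∈ ℝ such that f(x) = (1/2)⟨Ax, x⟩ + ⟨b, x⟩ + c for all x ∈ Ω. -/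

import Mathlib

open Matrix

/-- Partial derivative `∂u/∂xᵢ` of a function `u : ℝⁿ → ℝ`. -/
noncomputable def pder (n : ℕ) (i : Fin n) (u : (Fin n → ℝ) → ℝ) (x : Fin n → ℝ) : ℝ :=
  fderiv ℝ u x (Pi.single i 1)

/-- Hessian matrix `H(x) = (∂²f/∂xᵢ∂xⱼ(x))`. -/
noncomputable def Hess (n : ℕ) (f : (Fin n → ℝ) → ℝ) (x : Fin n → ℝ) :
    Matrix (Fin n) (Fin n) ℝ :=
  Matrix.of fun i j => pder n i (pder n j f) x

/-- `ρ = (det H)^(−1/(n+2))`. -/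
noncomputable def rho (n : ℕ) (f : (Fin n → ℝ) → ℝ) (x : Fin n → ℝ) : ℝ :=
  (Hess n f x).det ^ (-(1 : ℝ) / ((n : ℝ) + 2))

/-- `⟨∇u, ∇v⟩_g = Σᵢⱼ H^{ij} ∂ᵢu ∂ⱼv` with respect to the Calabi metric of `f`. -/
noncomputable def gradInner (n : ℕ) (f u v : (Fin n → ℝ) → ℝ) (x : Fin n → ℝ) : ℝ :=
  ∑ i, ∑ j, (Hess n f x)⁻¹ i j * pder n i u x * pder n j v x

/-- `Φ = ‖∇ρ‖²_g / ρ²`. -/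
noncomputable def Phi (n : ℕ) (f : (Fin n → ℝ) → ℝ) (x : Fin n → ℝ) : ℝ :=
  gradInner n f (rho n f) (rho n f) x / (rho n f x) ^ 2

/-- Laplace–Beltrami operator of the Calabi metric:
`Δ_g u = (det H)^{−1/2} Σᵢ ∂ᵢ( (det H)^{1/2} Σⱼ H^{ij} ∂ⱼu )`. -/
noncomputable def lapBel (n : ℕ) (f u : (Fin n → ℝ) → ℝ) (x : Fin n → ℝ) : ℝ :=
  (Hess n f x).det ^ (-(1 : ℝ) / 2) *
    ∑ i, pder n i (fun y => (Hess n f y).det ^ ((1 : ℝ) / 2) *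
      ∑ j, (Hess n f y)⁻¹ i j * pder n j u y) x

/-- Completeness of the Calabi metric `g = Σ fᵢⱼ dxᵢ dxⱼ` on `Ω`: every C¹ curve
`γ : [0,1) → Ω` eventually leaving every compact subset of `Ω` has infinite length. -/
def CalabiComplete (n : ℕ) (Ω : Set (Fin n → ℝ)) (f : (Fin n → ℝ) → ℝ) : Prop :=
  ∀ γ : ℝ → (Fin n → ℝ), ContDiffOn ℝ 1 γ (Set.Ico (0 : ℝ) 1) →
    (∀ t ∈ Set.Ico (0 : ℝ) 1, γ t ∈ Ω) →
    (∀ K : Set (Fin n → ℝ), K ⊆ Ω → IsCompact K →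
      ∃ t₀, t₀ < 1 ∧ ∀ t, t₀ < t → t < 1 → γ t ∉ K) →
    ∫⁻ t in Set.Ioo (0 : ℝ) 1,
      ENNReal.ofReal (Real.sqrt ((Hess n f (γ t)).mulVec (deriv γ t) ⬝ᵥ deriv γ t)) = ⊤

/-- `f` coincides on `Ω` with a quadratic polynomial with symmetric positive definite
quadratic part. -/
def IsQuadraticOn (n : ℕ) (Ω : Set (Fin n → ℝ)) (f : (Fin n → ℝ) → ℝ) : Prop :=
  ∃ A : Matrix (Fin n) (Fin n) ℝ, A.IsSymm ∧ A.PosDef ∧ ∃ b : Fin n → ℝ, ∃ c : ℝ,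
    ∀ x ∈ Ω, f x = (1 / 2) * (A.mulVec x ⬝ᵥ x) + b ⬝ᵥ x + c


open Set Filter Topology

noncomputable def dd {n : ℕ} (v : Fin n → ℝ) (u : (Fin n → ℝ) → ℝ) (x : Fin n → ℝ) : ℝ :=
  fderiv ℝ u x v

def Sm {n : ℕ} (Ω : Set (Fin n → ℝ)) (u : (Fin n → ℝ) → ℝ) : Prop :=
  ContDiffOn ℝ (⊤ : ℕ∞) u Ω

section dcalc
variable {n : ℕ} {Ω : Set (Fin n → ℝ)} {u w : (Fin n → ℝ) → ℝ} {x v v' : Fin n → ℝ}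

theorem Sm.cda (hΩ : IsOpen Ω) (hu : Sm Ω u) (hx : x ∈ Ω) : ContDiffAt ℝ (⊤ : ℕ∞) u x :=
  ContDiffOn.contDiffAt hu (hΩ.mem_nhds hx)

theorem Sm.da (hΩ : IsOpen Ω) (hu : Sm Ω u) (hx : x ∈ Ω) : DifferentiableAt ℝ u x :=
  (hu.cda hΩ hx).differentiableAt (by simp)

theorem Sm.dd (hΩ : IsOpen Ω) (hu : Sm Ω u) : Sm Ω (dd v u) := by
  have h : ContDiffOn ℝ (⊤ : ℕ∞) (fderiv ℝ u) Ω :=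
    ContDiffOn.fderiv_of_isOpen hu hΩ (by simp)
  exact h.clm_apply contDiffOn_const

theorem Sm.add (hu : Sm Ω u) (hw : Sm Ω w) : Sm Ω (fun y => u y + w y) := ContDiffOn.add hu hw
theorem Sm.sub (hu : Sm Ω u) (hw : Sm Ω w) : Sm Ω (fun y => u y - w y) := ContDiffOn.sub hu hw
theorem Sm.mul (hu : Sm Ω u) (hw : Sm Ω w) : Sm Ω (fun y => u y * w y) := ContDiffOn.mul hu hw
theorem Sm.neg (hu : Sm Ω u) : Sm Ω (fun y => - u y) := ContDiffOn.neg hu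
theorem Sm.const (c : ℝ) : Sm Ω (fun _ => c) := contDiffOn_const
theorem Sm.sum {ι : Type*} {s : Finset ι} {U : ι → (Fin n → ℝ) → ℝ} (h : ∀ i ∈ s, Sm Ω (U i)) :
    Sm Ω (fun y => ∑ i ∈ s, U i y) := ContDiffOn.sum h
theorem Sm.prod {ι : Type*} {s : Finset ι} {U : ι → (Fin n → ℝ) → ℝ} (h : ∀ i ∈ s, Sm Ω (U i)) :
    Sm Ω (fun y => ∏ i ∈ s, U i y) := contDiffOn_prod h
theorem Sm.inv (hu : Sm Ω u) (h : ∀ y ∈ Ω, u y ≠ 0) : Sm Ω (fun y => (u y)⁻¹) := ContDiffOn.inv hu h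
theorem Sm.log (hu : Sm Ω u) (h : ∀ y ∈ Ω, u y ≠ 0) : Sm Ω (fun y => Real.log (u y)) :=
  ContDiffOn.log hu h
theorem Sm.coord (i : Fin n) : Sm Ω (fun y => y i) :=
  (contDiff_apply ℝ ℝ i).contDiffOn
theorem Sm.congr (hu : Sm Ω u) (h : ∀ y ∈ Ω, w y = u y) : Sm Ω w := ContDiffOn.congr hu h

theorem dd_add (hΩ : IsOpen Ω) (hx : x ∈ Ω) (hu : Sm Ω u) (hw : Sm Ω w) :
    dd v (fun y => u y + w y) x = dd v u x + dd v w x := by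
  unfold dd; rw [fderiv_fun_add (hu.da hΩ hx) (hw.da hΩ hx)]; rfl
theorem dd_sub (hΩ : IsOpen Ω) (hx : x ∈ Ω) (hu : Sm Ω u) (hw : Sm Ω w) :
    dd v (fun y => u y - w y) x = dd v u x - dd v w x := by
  unfold dd; rw [fderiv_fun_sub (hu.da hΩ hx) (hw.da hΩ hx)]; rfl
theorem dd_neg : dd v (fun y => - u y) x = - dd v u x := by
  unfold dd; rw [fderiv_fun_neg]; rfl
theorem dd_mul (hΩ : IsOpen Ω) (hx : x ∈ Ω) (hu : Sm Ω u) (hw : Sm Ω w) :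
    dd v (fun y => u y * w y) x = dd v u x * w x + u x * dd v w x := by
  unfold dd; rw [fderiv_fun_mul (hu.da hΩ hx) (hw.da hΩ hx)]; simp; ring
theorem dd_const (c : ℝ) : dd v (fun _ => c) x = 0 := by
  unfold dd; simp
theorem dd_cmul (hΩ : IsOpen Ω) (hx : x ∈ Ω) (hu : Sm Ω u) (c : ℝ) :
    dd v (fun y => c * u y) x = c * dd v u x := by
  rw [dd_mul hΩ hx (Sm.const c) hu, dd_const]; ring
theorem dd_sum (hΩ : IsOpen Ω) (hx : x ∈ Ω) {ι : Type*} {s : Finset ι}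
    {U : ι → (Fin n → ℝ) → ℝ} (h : ∀ i ∈ s, Sm Ω (U i)) :
    dd v (fun y => ∑ i ∈ s, U i y) x = ∑ i ∈ s, dd v (U i) x := by
  unfold dd; rw [fderiv_fun_sum (fun i hi => (h i hi).da hΩ hx)]; simp
theorem dd_log (hΩ : IsOpen Ω) (hx : x ∈ Ω) (hu : Sm Ω u) (h : u x ≠ 0) :
    dd v (fun y => Real.log (u y)) x = (u x)⁻¹ * dd v u x := by
  unfold dd; rw [fderiv.log (hu.da hΩ hx) h]; simp
theorem dd_coord (i : Fin n) : dd v (fun y => y i) x = v i := by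
  unfold dd
  have : (fun y : Fin n → ℝ => y i) = (ContinuousLinearMap.proj (R := ℝ) (φ := fun _ : Fin n => ℝ) i) := rfl
  rw [this, ContinuousLinearMap.fderiv]; rfl
theorem dd_congr (hΩ : IsOpen Ω) (hx : x ∈ Ω) (h : ∀ y ∈ Ω, u y = w y) :
    dd v u x = dd v w x := by
  unfold dd
  rw [Filter.EventuallyEq.fderiv_eq (f := w) (by filter_upwards [hΩ.mem_nhds hx] with y hy using h y hy)]

theorem dd_dir_sum (c : Fin n → ℝ) (e : Fin n → Fin n → ℝ) :
    dd (∑ a, c a • e a) u x = ∑ a, c a * dd (e a) u x := by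
  unfold dd; simp [map_sum]
theorem dd_smul (c : ℝ) : dd (c • v) u x = c * dd v u x := by
  unfold dd; simp

theorem dd_comm (hΩ : IsOpen Ω) (hx : x ∈ Ω) (hu : Sm Ω u) :
    dd v (dd v' u) x = dd v' (dd v u) x := by
  have hs := (hu.cda hΩ hx).isSymmSndFDerivAt (by simp; exact WithTop.coe_le_coe.2 (le_top : (2:ℕ∞) ≤ ⊤))
  have hd : DifferentiableAt ℝ (fderiv ℝ u) x := by
    have h : ContDiffOn ℝ (⊤ : ℕ∞) (fderiv ℝ u) Ω :=
      ContDiffOn.fderiv_of_isOpen hu hΩ (by simp)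
    exact (h.contDiffAt (hΩ.mem_nhds hx)).differentiableAt (by simp)
  have key : ∀ a b, dd a (dd b u) x = fderiv ℝ (fderiv ℝ u) x a b := by
    intro a b
    unfold dd
    rw [fderiv_clm_apply hd (differentiableAt_const b)]
    simp
  rw [key, key]
  exact hs v v'

theorem dd_line (hΩ : IsOpen Ω) (hu : Sm Ω u) {t : ℝ} (hx : x + t • v ∈ Ω) :
    HasDerivAt (fun r : ℝ => u (x + r • v)) (dd v u (x + t • v)) t := by
  have h1 : HasFDerivAt u (fderiv ℝ u (x + t • v)) (x + t • v) := (hu.da hΩ hx).hasFDerivAt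
  have h2 : HasDerivAt (fun r : ℝ => x + r • v) v t := by
    simpa using ((hasDerivAt_id t).smul_const v).const_add x
  exact h1.comp_hasDerivAt t h2

/-- second derivative test -/
theorem dd_max (hΩ : IsOpen Ω) (hu : Sm Ω u) (hx : x ∈ Ω) (hmax : IsLocalMax u x) :
    dd v u x = 0 ∧ dd v (dd v u) x ≤ 0 := by
  refine ⟨by unfold dd; rw [hmax.fderiv_eq_zero]; rfl, ?_⟩
  by_contra hpos
  push Not at hpos
  have hc : Continuous (fun r : ℝ => x + r • v) := by fun_prop
  have hx0 : x + (0:ℝ) • v = x := by simp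
  set g : ℝ → ℝ := fun r => dd v u (x + r • v)
  have hev : ∀ᶠ r in 𝓝 (0:ℝ), x + r • v ∈ Ω :=
    hc.continuousAt.preimage_mem_nhds (by rw [hx0]; exact hΩ.mem_nhds hx)
  have hg' : HasDerivAt g (dd v (dd v u) x) 0 := by
    have := dd_line (x := x) (v := v) (t := 0) hΩ (hu.dd (v := v) hΩ) (by rw [hx0]; exact hx)
    rwa [hx0] at this
  have hg0 : g 0 = 0 := by
    show dd v u (x + (0:ℝ) • v) = 0
    rw [hx0]; unfold dd; rw [hmax.fderiv_eq_zero]; rfl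
  -- g > 0 on small (0,δ)
  have hgpos : ∀ᶠ r in 𝓝[>] (0:ℝ), 0 < g r := by
    have h1 := (hasDerivAt_iff_tendsto_slope.1 hg').eventually (lt_mem_nhds hpos)
    have h2 : 𝓝[>] (0:ℝ) ≤ 𝓝[≠] 0 := nhdsWithin_mono _ (fun r hr => ne_of_gt hr)
    filter_upwards [h2 h1, self_mem_nhdsWithin] with r hr hr0
    have hr0 : (0:ℝ) < r := hr0
    rw [slope_def_field, hg0] at hr
    simp only [sub_zero] at hr
    by_contra hc
    push Not at hc
    exact absurd hr (not_lt.2 (div_nonpos_of_nonpos_of_nonneg hc hr0.le))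
  have hmax' : ∀ᶠ r in 𝓝 (0:ℝ), u (x + r • v) ≤ u x := by
    have : Tendsto (fun r : ℝ => x + r • v) (𝓝 0) (𝓝 x) := by
      have := hc.tendsto 0; rwa [hx0] at this
    exact this.eventually hmax
  obtain ⟨δ, hδ, hball⟩ := Metric.eventually_nhds_iff.1 (hev.and hmax')
  obtain ⟨δ', hδ', hIoo⟩ := (mem_nhdsGT_iff_exists_Ioo_subset).1 hgpos
  have hδ'0 : (0:ℝ) < δ' := hδ'
  set r := min (δ / 2) (δ' / 2)
  have hr0 : 0 < r := lt_min (by linarith) (by linarith)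
  have hrδ : r < δ := lt_of_le_of_lt (min_le_left _ _) (by linarith)
  have hrδ' : r < δ' := lt_of_le_of_lt (min_le_right _ _) (by linarith)
  have hin : ∀ s ∈ Icc 0 r, dist s 0 < δ := by
    intro s hs; rw [Real.dist_eq, sub_zero, abs_of_nonneg hs.1]; linarith [hs.2]
  have hcont : ContinuousOn (fun s : ℝ => u (x + s • v)) (Icc 0 r) := by
    intro s hs
    exact (dd_line hΩ hu (hball (hin s hs)).1).continuousAt.continuousWithinAt
  have hmono : StrictMonoOn (fun s : ℝ => u (x + s • v)) (Icc 0 r) := by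
    refine strictMonoOn_of_deriv_pos (convex_Icc 0 r) hcont ?_
    intro s hs
    rw [interior_Icc] at hs
    rw [(dd_line hΩ hu (hball (hin s ⟨hs.1.le, hs.2.le⟩)).1).deriv]
    exact hIoo ⟨hs.1, hs.2.trans hrδ'⟩
  have := hmono (left_mem_Icc.2 hr0.le) (right_mem_Icc.2 hr0.le) hr0
  simp only [zero_smul, add_zero] at this
  exact absurd this (not_lt.2 (hball (hin r (right_mem_Icc.2 hr0.le))).2)

end dcalc

noncomputable def DM {n : ℕ} (v : Fin n → ℝ) (M : (Fin n → ℝ) → Matrix (Fin n) (Fin n) ℝ)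
    (x : Fin n → ℝ) : Matrix (Fin n) (Fin n) ℝ :=
  Matrix.of fun i j => dd v (fun y => M y i j) x

def SmM {n : ℕ} (Ω : Set (Fin n → ℝ)) (M : (Fin n → ℝ) → Matrix (Fin n) (Fin n) ℝ) : Prop :=
  ∀ i j, Sm Ω (fun y => M y i j)

section mcalc
variable {n : ℕ} {Ω : Set (Fin n → ℝ)} {M N : (Fin n → ℝ) → Matrix (Fin n) (Fin n) ℝ}
  {x v v' : Fin n → ℝ}

theorem SmM.mul (hM : SmM Ω M) (hN : SmM Ω N) : SmM Ω (fun y => M y * N y) := fun i j => by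
  simp only [Matrix.mul_apply]
  exact Sm.sum fun k _ => (hM i k).mul (hN k j)
theorem SmM.sub (hM : SmM Ω M) (hN : SmM Ω N) : SmM Ω (fun y => M y - N y) :=
  fun i j => (hM i j).sub (hN i j)
theorem SmM.add (hM : SmM Ω M) (hN : SmM Ω N) : SmM Ω (fun y => M y + N y) :=
  fun i j => (hM i j).add (hN i j)
theorem SmM.neg (hM : SmM Ω M) : SmM Ω (fun y => - M y) :=
  fun i j => (hM i j).neg
theorem SmM.DM (hΩ : IsOpen Ω) (hM : SmM Ω M) : SmM Ω (DM v M) :=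
  fun i j => (hM i j).dd hΩ
theorem SmM.trace (hM : SmM Ω M) : Sm Ω (fun y => (M y).trace) := by
  unfold Matrix.trace
  exact Sm.sum fun i _ => hM i i
theorem SmM.det (hM : SmM Ω M) : Sm Ω (fun y => (M y).det) := by
  simp only [Matrix.det_apply']
  exact Sm.sum fun σ _ => (Sm.const _).mul (Sm.prod fun i _ => hM _ _)
theorem SmM.adj (hM : SmM Ω M) : SmM Ω (fun y => (M y).adjugate) := fun i j => by
  simp only [Matrix.adjugate_apply]
  refine SmM.det (M := fun y => (M y).updateRow j (Pi.single i 1)) fun a b => ?_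
  simp only [Matrix.updateRow_apply]
  split_ifs
  · exact Sm.const _
  · exact hM a b
theorem SmM.inv (hM : SmM Ω M) (h : ∀ y ∈ Ω, (M y).det ≠ 0) : SmM Ω (fun y => (M y)⁻¹) :=
  fun i j => by
  simp only [Matrix.inv_def, Ring.inverse_eq_inv', Matrix.smul_apply, smul_eq_mul]
  exact (hM.det.inv h).mul (hM.adj i j)
theorem SmM.congr (hM : SmM Ω M) (h : ∀ y ∈ Ω, N y = M y) : SmM Ω N :=
  fun i j => (hM i j).congr fun y hy => by rw [h y hy]

theorem DM_mul (hΩ : IsOpen Ω) (hx : x ∈ Ω) (hM : SmM Ω M) (hN : SmM Ω N) :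
    DM v (fun y => M y * N y) x = DM v M x * N x + M x * DM v N x := by
  ext i j
  simp only [DM, Matrix.of_apply, Matrix.add_apply, Matrix.mul_apply]
  rw [dd_sum hΩ hx fun k _ => (hM i k).mul (hN k j), ← Finset.sum_add_distrib]
  exact Finset.sum_congr rfl fun k _ => dd_mul hΩ hx (hM i k) (hN k j)
theorem DM_sub (hΩ : IsOpen Ω) (hx : x ∈ Ω) (hM : SmM Ω M) (hN : SmM Ω N) :
    DM v (fun y => M y - N y) x = DM v M x - DM v N x := by
  ext i j; exact dd_sub hΩ hx (hM i j) (hN i j)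
theorem DM_neg : DM v (fun y => - M y) x = - DM v M x := by
  ext i j; exact dd_neg
theorem DM_congr (hΩ : IsOpen Ω) (hx : x ∈ Ω) (h : ∀ y ∈ Ω, M y = N y) :
    DM v M x = DM v N x := by
  ext i j; exact dd_congr hΩ hx fun y hy => by rw [h y hy]
theorem DM_const (C : Matrix (Fin n) (Fin n) ℝ) : DM v (fun _ => C) x = 0 := by
  ext i j; exact dd_const _
theorem DM_comm (hΩ : IsOpen Ω) (hx : x ∈ Ω) (hM : SmM Ω M) :
    DM v (DM v' M) x = DM v' (DM v M) x := by
  ext i j; exact dd_comm hΩ hx (hM i j)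
theorem dd_trace (hΩ : IsOpen Ω) (hx : x ∈ Ω) (hM : SmM Ω M) :
    dd v (fun y => (M y).trace) x = (DM v M x).trace := by
  unfold Matrix.trace
  exact dd_sum hΩ hx fun i _ => hM i i

theorem DM_inv (hΩ : IsOpen Ω) (hx : x ∈ Ω) (hM : SmM Ω M) (h : ∀ y ∈ Ω, (M y).det ≠ 0) :
    DM v (fun y => (M y)⁻¹) x = - ((M x)⁻¹ * DM v M x * (M x)⁻¹) := by
  have h1 : DM v (fun y => M y * (M y)⁻¹) x = 0 := by
    rw [DM_congr (N := fun _ => 1) hΩ hx fun y hy =>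
      Matrix.mul_nonsing_inv _ (isUnit_iff_ne_zero.2 (h y hy)), DM_const]
  rw [DM_mul hΩ hx hM (hM.inv h)] at h1
  have h2 : M x * DM v (fun y => (M y)⁻¹) x = - (DM v M x * (M x)⁻¹) :=
    eq_neg_of_add_eq_zero_right h1
  have h3 := congrArg (fun Z => (M x)⁻¹ * Z) h2
  simp only [← Matrix.mul_assoc, Matrix.nonsing_inv_mul _ (isUnit_iff_ne_zero.2 (h x hx)),
    Matrix.one_mul, Matrix.mul_neg] at h3
  exact h3

theorem dd_det (hΩ : IsOpen Ω) (hx : x ∈ Ω) (hM : SmM Ω M) :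
    dd v (fun y => (M y).det) x = ((M x).adjugate * DM v M x).trace := by
  have h1 : dd v (fun y => (M y).det) x =
      ∑ i, ((M x).updateCol i (fun a => DM v M x a i)).det := by
    simp only [Matrix.det_apply']
    rw [dd_sum hΩ hx fun σ _ => (Sm.const _).mul (Sm.prod fun i _ => hM _ _), Finset.sum_comm]
    refine Finset.sum_congr rfl fun σ _ => ?_
    rw [dd_cmul hΩ hx (Sm.prod fun i _ => hM _ _), ← Finset.mul_sum]
    congr 1
    unfold dd
    rw [fderiv_finsetProd (fun i _ => (hM (σ i) i).da hΩ hx)]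
    rw [ContinuousLinearMap.sum_apply]
    refine Finset.sum_congr rfl fun i _ => ?_
    rw [← Finset.mul_prod_erase _ _ (Finset.mem_univ i)]
    simp only [ContinuousLinearMap.smul_apply, smul_eq_mul, Matrix.updateCol_self]
    rw [mul_comm]
    congr 1
    refine Finset.prod_congr rfl fun j hj => ?_
    rw [Matrix.updateCol_ne (Finset.ne_of_mem_erase hj)]
  rw [h1]
  unfold Matrix.trace
  refine Finset.sum_congr rfl fun i _ => ?_
  rw [← Matrix.cramer_apply, Matrix.cramer_eq_adjugate_mulVec]
  rfl

theorem dd_logdet (hΩ : IsOpen Ω) (hx : x ∈ Ω) (hM : SmM Ω M) (h : (M x).det ≠ 0) :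
    dd v (fun y => Real.log (M y).det) x = ((M x)⁻¹ * DM v M x).trace := by
  rw [dd_log hΩ hx hM.det h, dd_det hΩ hx hM, Matrix.inv_def, Ring.inverse_eq_inv',
    Matrix.smul_mul, Matrix.trace_smul, smul_eq_mul]
end mcalc

def fr {n : ℕ} (A : Matrix (Fin n) (Fin n) ℝ) (i : Fin n) : Fin n → ℝ := fun a => A a i

noncomputable def Gm {n : ℕ} (A : Matrix (Fin n) (Fin n) ℝ) (f : (Fin n → ℝ) → ℝ)
    (y : Fin n → ℝ) : Matrix (Fin n) (Fin n) ℝ :=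
  Matrix.of fun i j => dd (fr A i) (dd (fr A j) f) y

noncomputable def XX {n : ℕ} (A : Matrix (Fin n) (Fin n) ℝ) (f : (Fin n → ℝ) → ℝ)
    (i : Fin n) (y : Fin n → ℝ) : Matrix (Fin n) (Fin n) ℝ :=
  (Gm A f y)⁻¹ * DM (fr A i) (Gm A f) y

noncomputable def RR {n : ℕ} (A : Matrix (Fin n) (Fin n) ℝ) (f : (Fin n → ℝ) → ℝ)
    (y : Fin n → ℝ) : Matrix (Fin n) (Fin n) ℝ :=
  Matrix.of fun i j => (XX A f i y * XX A f j y).trace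

noncomputable def JJ {n : ℕ} (A : Matrix (Fin n) (Fin n) ℝ) (f : (Fin n → ℝ) → ℝ)
    (y : Fin n → ℝ) : ℝ := ((Gm A f y)⁻¹ * RR A f y).trace

noncomputable def NN {n : ℕ} (A : Matrix (Fin n) (Fin n) ℝ) (f F : (Fin n → ℝ) → ℝ)
    (y : Fin n → ℝ) : ℝ := ((Gm A f y)⁻¹ * Gm A F y * ((Gm A f y)⁻¹ * Gm A F y)).trace

noncomputable def VV {n : ℕ} (A : Matrix (Fin n) (Fin n) ℝ) (F : (Fin n → ℝ) → ℝ)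
    (y : Fin n → ℝ) : Matrix (Fin n) (Fin n) ℝ :=
  Matrix.of fun i j => dd (fr A i) F y * dd (fr A j) F y

noncomputable def PP {n : ℕ} (A : Matrix (Fin n) (Fin n) ℝ) (f F : (Fin n → ℝ) → ℝ)
    (y : Fin n → ℝ) : ℝ := ((Gm A f y)⁻¹ * VV A F y).trace

noncomputable def LL {n : ℕ} (A : Matrix (Fin n) (Fin n) ℝ) (f u : (Fin n → ℝ) → ℝ)
    (y : Fin n → ℝ) : ℝ := ((Gm A f y)⁻¹ * Gm A u y).trace

section frames
variable {n : ℕ} {Ω : Set (Fin n → ℝ)} {A : Matrix (Fin n) (Fin n) ℝ} {f F u : (Fin n → ℝ) → ℝ}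
  {x y v : Fin n → ℝ}

theorem fr_eq (A : Matrix (Fin n) (Fin n) ℝ) (i : Fin n) :
    fr A i = ∑ a, A a i • fr 1 a := by
  ext b
  simp [fr, Matrix.one_apply]

theorem fr_one (i : Fin n) : fr (1 : Matrix (Fin n) (Fin n) ℝ) i = Pi.single i 1 := by
  ext b
  simp [fr, Matrix.one_apply, Pi.single_apply]

theorem dd_fr (A : Matrix (Fin n) (Fin n) ℝ) (i : Fin n) :
    dd (fr A i) u y = ∑ a, A a i * dd (fr 1 a) u y := by
  rw [fr_eq, dd_dir_sum]

theorem DM_fr (A : Matrix (Fin n) (Fin n) ℝ) (i : Fin n)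
    {M : (Fin n → ℝ) → Matrix (Fin n) (Fin n) ℝ} :
    DM (fr A i) M y = ∑ a, A a i • DM (fr 1 a) M y := by
  ext k l
  simp only [DM, Matrix.of_apply, Matrix.sum_apply, Matrix.smul_apply, smul_eq_mul]
  rw [dd_fr]

theorem Hess_eq : Hess n f = Gm 1 f := by
  ext y i j
  simp only [Hess, Gm, Matrix.of_apply, fr_one]
  rfl

theorem Gm_fr (hΩ : IsOpen Ω) (hf : Sm Ω f) (hy : y ∈ Ω) :
    Gm A f y = Aᵀ * Gm 1 f y * A := by
  ext i j
  simp only [Gm, Matrix.of_apply, Matrix.mul_apply, Matrix.transpose_apply]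
  have : dd (fr A i) (dd (fr A j) f) y = dd (fr A i) (fun y => ∑ a, A a j * dd (fr 1 a) f y) y := by
    congr 1; ext z; exact dd_fr _ _
  rw [this, dd_sum hΩ hy fun a _ => (Sm.const _).mul (hf.dd hΩ)]
  refine Finset.sum_congr rfl fun a _ => ?_
  rw [dd_cmul hΩ hy (hf.dd hΩ), dd_fr, mul_comm]

theorem SmM_Gm (hΩ : IsOpen Ω) (hf : Sm Ω f) : SmM Ω (Gm A f) :=
  fun _ _ => (hf.dd hΩ).dd hΩ

theorem Gm_symm (hΩ : IsOpen Ω) (hf : Sm Ω f) (hy : y ∈ Ω) : (Gm A f y)ᵀ = Gm A f y := by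
  ext i j; exact dd_comm hΩ hy hf

theorem det_Gm (hΩ : IsOpen Ω) (hf : Sm Ω f) (hy : y ∈ Ω) (hA : A.det ≠ 0)
    (h1 : (Gm 1 f y).det ≠ 0) : (Gm A f y).det ≠ 0 := by
  rw [Gm_fr hΩ hf hy, Matrix.det_mul, Matrix.det_mul, Matrix.det_transpose]
  exact mul_ne_zero (mul_ne_zero hA h1) hA

theorem inv_conj {G : Matrix (Fin n) (Fin n) ℝ} (hA : A.det ≠ 0) (R : Matrix (Fin n) (Fin n) ℝ) :
    (Aᵀ * G * A)⁻¹ * (Aᵀ * R * A) = A⁻¹ * (G⁻¹ * R) * A := by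
  have h1 : IsUnit Aᵀ.det := by rw [Matrix.det_transpose]; exact isUnit_iff_ne_zero.2 hA
  rw [Matrix.mul_inv_rev, Matrix.mul_inv_rev]
  calc _ = A⁻¹ * G⁻¹ * ((Aᵀ)⁻¹ * Aᵀ) * R * A := by simp only [Matrix.mul_assoc]
    _ = _ := by rw [Matrix.nonsing_inv_mul _ h1]; simp only [Matrix.mul_assoc, Matrix.one_mul, Matrix.mul_one]

theorem mconj_mul {X Y : Matrix (Fin n) (Fin n) ℝ} (hA : A.det ≠ 0) :
    (A⁻¹ * X * A) * (A⁻¹ * Y * A) = A⁻¹ * (X * Y) * A := by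
  calc _ = A⁻¹ * X * (A * A⁻¹) * Y * A := by simp only [Matrix.mul_assoc]
    _ = _ := by
      rw [Matrix.mul_nonsing_inv _ (isUnit_iff_ne_zero.2 hA)]
      simp only [Matrix.mul_assoc, Matrix.one_mul, Matrix.mul_one]

theorem conj_trace {X : Matrix (Fin n) (Fin n) ℝ} (hA : A.det ≠ 0) :
    (A⁻¹ * X * A).trace = X.trace := by
  rw [Matrix.trace_mul_comm, ← Matrix.mul_assoc,
    Matrix.mul_nonsing_inv _ (isUnit_iff_ne_zero.2 hA), Matrix.one_mul]

theorem LL_fr (hΩ : IsOpen Ω) (hf : Sm Ω f) (hu : Sm Ω u) (hy : y ∈ Ω) (hA : A.det ≠ 0) :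
    LL A f u y = LL 1 f u y := by
  unfold LL
  rw [Gm_fr hΩ hf hy, Gm_fr hΩ hu hy, inv_conj hA, conj_trace hA]

theorem NN_fr (hΩ : IsOpen Ω) (hf : Sm Ω f) (hu : Sm Ω u) (hy : y ∈ Ω) (hA : A.det ≠ 0) :
    NN A f u y = NN 1 f u y := by
  unfold NN
  rw [Gm_fr hΩ hf hy, Gm_fr hΩ hu hy, inv_conj hA, mconj_mul hA, conj_trace hA]

theorem VV_fr : VV A u y = Aᵀ * VV 1 u y * A := by
  ext i j
  simp only [VV, Matrix.of_apply, Matrix.mul_apply, Matrix.transpose_apply]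
  rw [dd_fr A i, dd_fr A j, Finset.sum_mul_sum, Finset.sum_comm]
  refine Finset.sum_congr rfl fun a _ => ?_
  rw [Finset.sum_mul]
  refine Finset.sum_congr rfl fun b _ => ?_
  ring

theorem PP_fr (hΩ : IsOpen Ω) (hf : Sm Ω f) (hy : y ∈ Ω) (hA : A.det ≠ 0) :
    PP A f u y = PP 1 f u y := by
  unfold PP
  rw [Gm_fr hΩ hf hy, VV_fr, inv_conj hA, conj_trace hA]

theorem DMGm_fr (hΩ : IsOpen Ω) (hf : Sm Ω f) (hy : y ∈ Ω) :
    DM v (Gm A f) y = Aᵀ * DM v (Gm 1 f) y * A := by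
  have hc : ∀ C : Matrix (Fin n) (Fin n) ℝ, SmM Ω (fun _ => C) := fun C i j => Sm.const _
  rw [DM_congr hΩ hy fun z hz => Gm_fr (A := A) hΩ hf hz,
    DM_mul (M := fun y => Aᵀ * Gm 1 f y) hΩ hy ((hc _).mul (SmM_Gm hΩ hf)) (hc A), DM_mul (M := fun y => Aᵀ) hΩ hy (hc _) (SmM_Gm hΩ hf)]
  simp [DM_const]

theorem XX_fr (hΩ : IsOpen Ω) (hf : Sm Ω f) (hy : y ∈ Ω) (hA : A.det ≠ 0) (i : Fin n) :
    XX A f i y = A⁻¹ * (∑ a, A a i • XX 1 f a y) * A := by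
  unfold XX
  rw [DMGm_fr hΩ hf hy, Gm_fr hΩ hf hy, inv_conj hA, DM_fr]
  simp only [Matrix.mul_sum, Matrix.mul_smul]

theorem RR_fr (hΩ : IsOpen Ω) (hf : Sm Ω f) (hy : y ∈ Ω) (hA : A.det ≠ 0) :
    RR A f y = Aᵀ * RR 1 f y * A := by
  ext i j
  simp only [RR, Matrix.of_apply]
  rw [XX_fr hΩ hf hy hA, XX_fr hΩ hf hy hA, mconj_mul hA, conj_trace hA]
  simp only [Matrix.sum_mul, Matrix.mul_sum, Matrix.trace_sum, Matrix.smul_mul, Matrix.mul_smul,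
    Matrix.trace_smul, Matrix.mul_apply, Matrix.of_apply, Matrix.transpose_apply, smul_eq_mul,
    Finset.sum_mul]
  rw [Finset.sum_comm]
  refine Finset.sum_congr rfl fun a _ => Finset.sum_congr rfl fun b _ => ?_
  ring

theorem JJ_fr (hΩ : IsOpen Ω) (hf : Sm Ω f) (hy : y ∈ Ω) (hA : A.det ≠ 0) :
    JJ A f y = JJ 1 f y := by
  unfold JJ
  rw [Gm_fr hΩ hf hy, RR_fr hΩ hf hy hA, inv_conj hA, conj_trace hA]

end frames

open scoped MatrixOrder Matrix.Norms.L2Operator in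
theorem exists_frame {n : ℕ} {H : Matrix (Fin n) (Fin n) ℝ} (hH : H.PosDef) :
    ∃ A : Matrix (Fin n) (Fin n) ℝ, A.det ≠ 0 ∧ Aᵀ * H * A = 1 := by
  obtain ⟨B, hB⟩ : ∃ B : Matrix (Fin n) (Fin n) ℝ, H = Bᵀ * B := by
    obtain ⟨B, hB⟩ := CStarAlgebra.nonneg_iff_eq_star_mul_self.mp hH.posSemidef.nonneg
    exact ⟨B, by rw [hB, Matrix.star_eq_conjTranspose, Matrix.conjTranspose_eq_transpose_of_trivial]⟩
  have hd : B.det ≠ 0 := by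
    intro h
    have := hH.det_pos
    rw [hB, Matrix.det_mul, h, mul_zero] at this
    exact lt_irrefl _ this
  refine ⟨B⁻¹, ?_, ?_⟩
  · rw [Matrix.det_nonsing_inv, Ring.inverse_eq_inv']
    exact inv_ne_zero hd
  · have hu : IsUnit B.det := isUnit_iff_ne_zero.2 hd
    calc _ = (B * B⁻¹)ᵀ * (B * B⁻¹) := by
          rw [hB, Matrix.transpose_mul]; simp only [Matrix.mul_assoc]
      _ = 1 := by rw [Matrix.mul_nonsing_inv _ hu]; simp

structure PD (n : ℕ) where
  T : Fin n → Matrix (Fin n) (Fin n) ℝ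
  S : Fin n → Fin n → Matrix (Fin n) (Fin n) ℝ
  U : Fin n → Fin n → Fin n → Matrix (Fin n) (Fin n) ℝ
  B : Matrix (Fin n) (Fin n) ℝ
  C : Fin n → Matrix (Fin n) (Fin n) ℝ
  E : Fin n → Fin n → Matrix (Fin n) (Fin n) ℝ
  v : Fin n → ℝ
  T1 : ∀ i j k, T i j k = T j i k
  T2 : ∀ i j k, T i j k = T i k j
  S1 : ∀ i j, S i j = S j i
  S2 : ∀ i j k l, S i j k l = S i k j l
  S3 : ∀ i j k l, S i j k l = S i j l k
  U2 : ∀ i j k, U i j k = U i k j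
  U3 : ∀ i j k a b, U i j k a b = U i j a k b
  U1 : ∀ i j k, U i j k = U j i k
  U4 : ∀ i j k a b, U i j k a b = U i j k b a
  B1 : ∀ i j, B i j = B j i
  C1 : ∀ i j k, C i j k = C j i k
  C2 : ∀ i j k, C i j k = C i k j
  E1 : ∀ i j, E i j = E j i
  E2 : ∀ i j k l, E i j k l = E i k j l
  E3 : ∀ i j k l, E i j k l = E i j l k
  hv : ∀ i, v i = (T i).trace
  hB : ∀ i j, B i j = (S i j - T i * T j).trace
  hC : ∀ m l k, C m l k = ((T m * T l + T l * T m - S m l) * T k - T l * S m k - T m * S l k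
    + U m l k).trace
  e0 : B.trace = 0
  e1 : ∀ i, (C i - T i * B).trace = 0
  e2 : ∀ i j, ((T i * T j + T j * T i - S i j) * B - T i * C j - T j * C i + E i j).trace = 0

section secondcalc
variable {n : ℕ} {Ω : Set (Fin n → ℝ)} {M N : (Fin n → ℝ) → Matrix (Fin n) (Fin n) ℝ}
  {x y v v' : Fin n → ℝ} {A : Matrix (Fin n) (Fin n) ℝ} {f F u w : (Fin n → ℝ) → ℝ}

theorem SmM_const (C : Matrix (Fin n) (Fin n) ℝ) : SmM Ω (fun _ => C) := fun _ _ => Sm.const _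

theorem DM_add (hΩ : IsOpen Ω) (hx : x ∈ Ω) (hM : SmM Ω M) (hN : SmM Ω N) :
    DM v (fun y => M y + N y) x = DM v M x + DM v N x := by
  ext i j; exact dd_add hΩ hx (hM i j) (hN i j)

theorem DM2_mul (hΩ : IsOpen Ω) (hx : x ∈ Ω) (hM : SmM Ω M) (hN : SmM Ω N) :
    DM v (DM v' (fun y => M y * N y)) x = DM v (DM v' M) x * N x + DM v' M x * DM v N x
      + DM v M x * DM v' N x + M x * DM v (DM v' N) x := by
  rw [DM_congr hΩ hx (fun z hz => DM_mul hΩ hz hM hN),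
    DM_add hΩ hx ((hM.DM hΩ).mul hN) (hM.mul (hN.DM hΩ)),
    DM_mul hΩ hx (hM.DM hΩ) hN, DM_mul hΩ hx hM (hN.DM hΩ)]
  abel

theorem dd2_trace (hΩ : IsOpen Ω) (hx : x ∈ Ω) (hM : SmM Ω M) :
    dd v (dd v' (fun y => (M y).trace)) x = (DM v (DM v' M) x).trace := by
  rw [dd_congr hΩ hx (fun z hz => dd_trace hΩ hz hM), dd_trace hΩ hx (hM.DM hΩ)]

theorem dd2_congr (hΩ : IsOpen Ω) (hx : x ∈ Ω) (h : ∀ z ∈ Ω, u z = w z) :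
    dd v (dd v' u) x = dd v (dd v' w) x :=
  dd_congr hΩ hx fun _ hz => dd_congr hΩ hz h

theorem dd2_mul (hΩ : IsOpen Ω) (hx : x ∈ Ω) (hu : Sm Ω u) (hw : Sm Ω w) :
    dd v (dd v' (fun y => u y * w y)) x = dd v (dd v' u) x * w x + dd v' u x * dd v w x
      + dd v u x * dd v' w x + u x * dd v (dd v' w) x := by
  rw [dd_congr hΩ hx (fun z hz => dd_mul hΩ hz hu hw),
    dd_add hΩ hx ((hu.dd hΩ).mul hw) (hu.mul (hw.dd hΩ)),
    dd_mul hΩ hx (hu.dd hΩ) hw, dd_mul hΩ hx hu (hw.dd hΩ)]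
  ring

theorem DM_inv1 (hΩ : IsOpen Ω) (hy : y ∈ Ω) (hM : SmM Ω M) (hd : ∀ z ∈ Ω, (M z).det ≠ 0)
    (h1 : M y = 1) : DM v (fun z => (M z)⁻¹) y = - DM v M y := by
  rw [DM_inv hΩ hy hM hd, h1]; simp

theorem DM2_inv1 (hΩ : IsOpen Ω) (hy : y ∈ Ω) (hM : SmM Ω M) (hd : ∀ z ∈ Ω, (M z).det ≠ 0)
    (h1 : M y = 1) : DM v (DM v' (fun z => (M z)⁻¹)) y =
    DM v M y * DM v' M y + DM v' M y * DM v M y - DM v (DM v' M) y := by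
  have hP := hM.inv hd
  rw [DM_congr hΩ hy (fun z hz => DM_inv hΩ hz hM hd), DM_neg,
    DM_mul (M := fun y => (M y)⁻¹ * DM v' M y) hΩ hy (hP.mul (hM.DM hΩ)) hP,
    DM_mul hΩ hy hP (hM.DM hΩ), DM_inv1 hΩ hy hM hd h1, h1]
  simp only [inv_one, Matrix.one_mul, Matrix.mul_one, Matrix.neg_mul, Matrix.mul_neg]
  abel

end secondcalc

section mk
variable {n : ℕ} {Ω : Set (Fin n → ℝ)} {y : Fin n → ℝ} {A : Matrix (Fin n) (Fin n) ℝ}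
  {f F : (Fin n → ℝ) → ℝ}

theorem XX_D1 (hΩ : IsOpen Ω) (hy : y ∈ Ω) (hf : Sm Ω f) (hd : ∀ z ∈ Ω, (Gm A f z).det ≠ 0)
    (h1 : Gm A f y = 1) (m k : Fin n) :
    DM (fr A m) (XX A f k) y = DM (fr A m) (DM (fr A k) (Gm A f)) y
      - DM (fr A m) (Gm A f) y * DM (fr A k) (Gm A f) y := by
  have hG : SmM Ω (Gm A f) := SmM_Gm hΩ hf
  unfold XX
  rw [DM_mul hΩ hy (hG.inv hd) (hG.DM hΩ), DM_inv1 hΩ hy hG hd h1, h1]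
  simp only [inv_one, Matrix.one_mul, Matrix.neg_mul]
  abel

theorem XX_D2 (hΩ : IsOpen Ω) (hy : y ∈ Ω) (hf : Sm Ω f) (hd : ∀ z ∈ Ω, (Gm A f z).det ≠ 0)
    (h1 : Gm A f y = 1) (m l k : Fin n) :
    DM (fr A m) (DM (fr A l) (XX A f k)) y =
      (DM (fr A m) (Gm A f) y * DM (fr A l) (Gm A f) y + DM (fr A l) (Gm A f) y *
        DM (fr A m) (Gm A f) y - DM (fr A m) (DM (fr A l) (Gm A f)) y) * DM (fr A k) (Gm A f) y
      - DM (fr A l) (Gm A f) y * DM (fr A m) (DM (fr A k) (Gm A f)) y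
      - DM (fr A m) (Gm A f) y * DM (fr A l) (DM (fr A k) (Gm A f)) y
      + DM (fr A m) (DM (fr A l) (DM (fr A k) (Gm A f))) y := by
  have hG : SmM Ω (Gm A f) := SmM_Gm hΩ hf
  unfold XX
  rw [DM2_mul hΩ hy (hG.inv hd) (hG.DM hΩ), DM2_inv1 hΩ hy hG hd h1, DM_inv1 hΩ hy hG hd h1,
    DM_inv1 hΩ hy hG hd h1, h1]
  simp only [inv_one, Matrix.one_mul, Matrix.neg_mul]
  abel

theorem SmM_XX (hΩ : IsOpen Ω) (hf : Sm Ω f) (hd : ∀ z ∈ Ω, (Gm A f z).det ≠ 0) (k : Fin n) :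
    SmM Ω (XX A f k) :=
  ((SmM_Gm hΩ hf).inv hd).mul ((SmM_Gm hΩ hf).DM hΩ)

theorem DMDM_symm2 (hΩ : IsOpen Ω) (hy : y ∈ Ω) (hf : Sm Ω f) (m i : Fin n) :
    DM (fr A m) (DM (fr A i) (Gm A f)) y = DM (fr A i) (DM (fr A m) (Gm A f)) y :=
  DM_comm hΩ hy (SmM_Gm hΩ hf)

noncomputable def mkPD (hΩ : IsOpen Ω) (hy : y ∈ Ω) (hf : Sm Ω f) (hF : Sm Ω F)
    (hd : ∀ z ∈ Ω, (Gm A f z).det ≠ 0)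
    (h1 : Gm A f y = 1) (hFv : ∀ k, ∀ z ∈ Ω, dd (fr A k) F z = (XX A f k z).trace)
    (hL : ∀ z ∈ Ω, LL A f F z = 0) : PD n where
  T := fun i => DM (fr A i) (Gm A f) y
  S := fun i j => DM (fr A i) (DM (fr A j) (Gm A f)) y
  U := fun i j k => DM (fr A i) (DM (fr A j) (DM (fr A k) (Gm A f))) y
  B := Gm A F y
  C := fun i => DM (fr A i) (Gm A F) y
  E := fun i j => DM (fr A i) (DM (fr A j) (Gm A F)) y
  v := fun i => dd (fr A i) F y
  T1 := fun i j k => dd_comm hΩ hy (hf.dd hΩ)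
  T2 := fun i j k => dd_congr hΩ hy fun z hz => dd_comm hΩ hz hf
  S1 := fun i j => DM_comm hΩ hy (SmM_Gm hΩ hf)
  S2 := fun i j k l => dd_congr hΩ hy fun z hz => dd_comm hΩ hz (hf.dd hΩ)
  S3 := fun i j k l => dd2_congr hΩ hy fun z hz => dd_comm hΩ hz hf
  U2 := fun i j k => DM_congr hΩ hy fun z hz => DM_comm hΩ hz (SmM_Gm hΩ hf)
  U3 := fun i j k a b => dd2_congr hΩ hy fun z hz => dd_comm hΩ hz (hf.dd hΩ)
  U1 := fun i j k => DM_comm hΩ hy ((SmM_Gm hΩ hf).DM hΩ)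
  U4 := fun i j k a b => dd2_congr hΩ hy fun z hz => dd_congr hΩ hz fun z hz => dd_comm hΩ hz hf
  B1 := fun i j => dd_comm hΩ hy hF
  C1 := fun i j k => dd_comm hΩ hy (hF.dd hΩ)
  C2 := fun i j k => dd_congr hΩ hy fun z hz => dd_comm hΩ hz hF
  E1 := fun i j => DM_comm hΩ hy (SmM_Gm hΩ hF)
  E2 := fun i j k l => dd_congr hΩ hy fun z hz => dd_comm hΩ hz (hF.dd hΩ)
  E3 := fun i j k l => dd2_congr hΩ hy fun z hz => dd_comm hΩ hz hF
  hv := fun i => by rw [hFv i y hy, XX, h1]; simp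
  hB := fun i j => by
    rw [← XX_D1 hΩ hy hf hd h1, ← dd_trace hΩ hy (SmM_XX hΩ hf hd j)]
    exact dd_congr hΩ hy (hFv j)
  hC := fun m l k => by
    rw [← XX_D2 hΩ hy hf hd h1, ← dd2_trace hΩ hy (SmM_XX hΩ hf hd k)]
    exact dd2_congr hΩ hy (hFv k)
  e0 := by have := hL y hy; rw [LL, h1] at this; simpa using this
  e1 := fun i => by
    have hG : SmM Ω (Gm A f) := SmM_Gm hΩ hf
    have h2 : dd (fr A i) (LL A f F) y = 0 := by
      rw [dd_congr (w := fun _ => 0) hΩ hy hL]; exact dd_const _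
    unfold LL at h2
    rw [dd_trace hΩ hy ((hG.inv hd).mul (SmM_Gm hΩ hF)), DM_mul hΩ hy (hG.inv hd) (SmM_Gm hΩ hF),
      DM_inv1 hΩ hy hG hd h1, h1] at h2
    rw [← h2]; congr 1
    simp only [inv_one, Matrix.one_mul, Matrix.neg_mul]
    abel
  e2 := fun i j => by
    have hG : SmM Ω (Gm A f) := SmM_Gm hΩ hf
    have h2 : dd (fr A i) (dd (fr A j) (LL A f F)) y = 0 := by
      rw [dd2_congr (w := fun _ => 0) hΩ hy hL]
      have : dd (fr A j) (fun _ => (0:ℝ)) = fun _ => 0 := by ext z; exact dd_const _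
      rw [this]; exact dd_const _
    unfold LL at h2
    rw [dd2_trace hΩ hy ((hG.inv hd).mul (SmM_Gm hΩ hF)), DM2_mul hΩ hy (hG.inv hd) (SmM_Gm hΩ hF),
      DM2_inv1 hΩ hy hG hd h1, DM_inv1 hΩ hy hG hd h1, DM_inv1 hΩ hy hG hd h1, h1] at h2
    rw [← h2]; congr 1
    simp only [inv_one, Matrix.one_mul, Matrix.neg_mul]
    abel

end mk

namespace PD
variable {n : ℕ} (d : PD n)
def R : Matrix (Fin n) (Fin n) ℝ := Matrix.of fun i j => (d.T i * d.T j).trace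
def X1 (m i : Fin n) : Matrix (Fin n) (Fin n) ℝ := d.S m i - d.T m * d.T i
def X2 (m i : Fin n) : Matrix (Fin n) (Fin n) ℝ :=
  (d.T m * d.T m + d.T m * d.T m - d.S m m) * d.T i - d.T m * d.S m i - d.T m * d.S m i + d.U m m i
def R1 (m : Fin n) : Matrix (Fin n) (Fin n) ℝ := Matrix.of fun i j =>
  (d.X1 m i * d.T j + d.T i * d.X1 m j).trace
def R2 (m : Fin n) : Matrix (Fin n) (Fin n) ℝ := Matrix.of fun i j =>
  (d.X2 m i * d.T j + d.X1 m i * d.X1 m j + d.X1 m i * d.X1 m j + d.T i * d.X2 m j).trace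
def J2 (m : Fin n) : ℝ := ((d.T m * d.T m + d.T m * d.T m - d.S m m) * d.R
  - d.T m * d.R1 m - d.T m * d.R1 m + d.R2 m).trace
def Y1 (m : Fin n) : Matrix (Fin n) (Fin n) ℝ := d.C m - d.T m * d.B
def Y2 (m : Fin n) : Matrix (Fin n) (Fin n) ℝ :=
  (d.T m * d.T m + d.T m * d.T m - d.S m m) * d.B - d.T m * d.C m - d.T m * d.C m + d.E m m
def N2 (m : Fin n) : ℝ := (d.Y2 m * d.B + d.Y1 m * d.Y1 m + d.Y1 m * d.Y1 m + d.B * d.Y2 m).trace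
def W0 : Matrix (Fin n) (Fin n) ℝ := Matrix.of fun i j => d.v i * d.v j
def W1 (m : Fin n) : Matrix (Fin n) (Fin n) ℝ := Matrix.of fun i j =>
  d.B m i * d.v j + d.v i * d.B m j
def W2 (m : Fin n) : Matrix (Fin n) (Fin n) ℝ := Matrix.of fun i j =>
  d.C m m i * d.v j + d.B m i * d.B m j + d.B m i * d.B m j + d.v i * d.C m m j
def P1 (m : Fin n) : ℝ := (d.W1 m - d.T m * d.W0).trace
def P2 (m : Fin n) : ℝ := ((d.T m * d.T m + d.T m * d.T m - d.S m m) * d.W0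
  - d.T m * d.W1 m - d.T m * d.W1 m + d.W2 m).trace
end PD

section mk2
variable {n : ℕ} {Ω : Set (Fin n → ℝ)} {y : Fin n → ℝ} {A : Matrix (Fin n) (Fin n) ℝ}
  {f F : (Fin n → ℝ) → ℝ}

theorem mkPD_spec (hΩ : IsOpen Ω) (hy : y ∈ Ω) (hf : Sm Ω f) (hF : Sm Ω F)
    (hd : ∀ z ∈ Ω, (Gm A f z).det ≠ 0)
    (h1 : Gm A f y = 1) (hFv : ∀ k, ∀ z ∈ Ω, dd (fr A k) F z = (XX A f k z).trace)
    (hL : ∀ z ∈ Ω, LL A f F z = 0) (d : PD n) (hdd : d = mkPD hΩ hy hf hF hd h1 hFv hL) :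
    (∀ i, dd (fr A i) F y = d.v i) ∧
    JJ A f y = d.R.trace ∧ NN A f F y = (d.B * d.B).trace ∧ PP A f F y = d.W0.trace ∧
    (∀ m, dd (fr A m) (PP A f F) y = d.P1 m) ∧
    (∀ m, dd (fr A m) (dd (fr A m) (JJ A f)) y = d.J2 m) ∧
    (∀ m, dd (fr A m) (dd (fr A m) (NN A f F)) y = d.N2 m) ∧
    (∀ m, dd (fr A m) (dd (fr A m) (PP A f F)) y = d.P2 m) := by
  have hG : SmM Ω (Gm A f) := SmM_Gm hΩ hf
  have hGF : SmM Ω (Gm A F) := SmM_Gm hΩ hF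
  have hX := SmM_XX hΩ hf hd
  have hXy : ∀ i, XX A f i y = d.T i := by
    intro i; rw [XX, h1, hdd]; simp [mkPD]
  have hX1 : ∀ m i, DM (fr A m) (XX A f i) y = d.X1 m i := by
    intro m i; rw [XX_D1 hΩ hy hf hd h1, hdd]; rfl
  have hX2 : ∀ m i, DM (fr A m) (DM (fr A m) (XX A f i)) y = d.X2 m i := by
    intro m i; rw [XX_D2 hΩ hy hf hd h1, hdd]; rfl
  have hRs : SmM Ω (RR A f) := fun i j => ((hX i).mul (hX j)).trace
  have hRy : RR A f y = d.R := by
    ext i j; simp only [RR, PD.R, Matrix.of_apply, hXy]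
  have hR1 : ∀ m, DM (fr A m) (RR A f) y = d.R1 m := by
    intro m; ext i j
    have : DM (fr A m) (RR A f) y i j = dd (fr A m) (fun z => (XX A f i z * XX A f j z).trace) y := rfl
    rw [this, dd_trace hΩ hy ((hX i).mul (hX j)), DM_mul hΩ hy (hX i) (hX j)]
    simp only [hX1, hXy]; rfl
  have hR2 : ∀ m, DM (fr A m) (DM (fr A m) (RR A f)) y = d.R2 m := by
    intro m; ext i j
    have : DM (fr A m) (DM (fr A m) (RR A f)) y i j =
      dd (fr A m) (dd (fr A m) (fun z => (XX A f i z * XX A f j z).trace)) y := rfl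
    rw [this, dd2_trace hΩ hy ((hX i).mul (hX j)), DM2_mul hΩ hy (hX i) (hX j)]
    simp only [hX1, hX2, hXy]; rfl
  have hT : ∀ i, DM (fr A i) (Gm A f) y = d.T i := by intro i; rw [hdd]; rfl
  have hS : ∀ i j, DM (fr A i) (DM (fr A j) (Gm A f)) y = d.S i j := by intro i j; rw [hdd]; rfl
  have hBy : Gm A F y = d.B := by rw [hdd]; rfl
  have hC : ∀ i, DM (fr A i) (Gm A F) y = d.C i := by intro i; rw [hdd]; rfl
  have hE : ∀ i j, DM (fr A i) (DM (fr A j) (Gm A F)) y = d.E i j := by intro i j; rw [hdd]; rfl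
  have hvy : ∀ i, dd (fr A i) F y = d.v i := by intro i; rw [hdd]; rfl
  have hW : SmM Ω (VV A F) := fun i j => (hF.dd hΩ).mul (hF.dd hΩ)
  have hWy : VV A F y = d.W0 := by ext i j; simp only [VV, PD.W0, Matrix.of_apply, hvy]
  have hBm : ∀ m i, dd (fr A m) (dd (fr A i) F) y = d.B m i := by intro m i; rw [← hBy]; rfl
  have hCm : ∀ m i, dd (fr A m) (dd (fr A m) (dd (fr A i) F)) y = d.C m m i := by
    intro m i; rw [← hC]; rfl
  have hW1 : ∀ m, DM (fr A m) (VV A F) y = d.W1 m := by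
    intro m; ext i j
    have : DM (fr A m) (VV A F) y i j = dd (fr A m) (fun z => dd (fr A i) F z * dd (fr A j) F z) y := rfl
    rw [this, dd_mul hΩ hy (hF.dd hΩ) (hF.dd hΩ)]
    simp only [hBm, hvy]; rfl
  have hW2 : ∀ m, DM (fr A m) (DM (fr A m) (VV A F)) y = d.W2 m := by
    intro m; ext i j
    have : DM (fr A m) (DM (fr A m) (VV A F)) y i j =
      dd (fr A m) (dd (fr A m) (fun z => dd (fr A i) F z * dd (fr A j) F z)) y := rfl
    rw [this, dd2_mul hΩ hy (hF.dd hΩ) (hF.dd hΩ)]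
    simp only [hBm, hvy, hCm]; rfl
  have hY1 : ∀ m, DM (fr A m) (fun z => (Gm A f z)⁻¹ * Gm A F z) y = d.Y1 m := by
    intro m
    rw [DM_mul hΩ hy (hG.inv hd) hGF, DM_inv1 hΩ hy hG hd h1, h1, hT, hC, hBy, PD.Y1]
    simp only [inv_one, Matrix.one_mul, Matrix.neg_mul]
    abel
  have hY2 : ∀ m, DM (fr A m) (DM (fr A m) (fun z => (Gm A f z)⁻¹ * Gm A F z)) y = d.Y2 m := by
    intro m
    rw [DM2_mul hΩ hy (hG.inv hd) hGF, DM2_inv1 hΩ hy hG hd h1, DM_inv1 hΩ hy hG hd h1, h1, hT,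
      hC, hBy, hS, hE, PD.Y2]
    simp only [inv_one, Matrix.one_mul, Matrix.neg_mul]
    abel
  have hYs : SmM Ω (fun z => (Gm A f z)⁻¹ * Gm A F z) := (hG.inv hd).mul hGF
  refine ⟨hvy, ?_, ?_, ?_, ?_, ?_, ?_, ?_⟩
  · rw [JJ, h1, hRy]; simp
  · rw [NN, h1, hBy]; simp
  · rw [PP, h1, hWy]; simp
  · intro m
    unfold PP
    rw [dd_trace hΩ hy ((hG.inv hd).mul hW), DM_mul hΩ hy (hG.inv hd) hW,
      DM_inv1 hΩ hy hG hd h1, h1, hT, hW1, hWy, PD.P1]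
    congr 1
    simp only [inv_one, Matrix.one_mul, Matrix.neg_mul]
    abel
  · intro m
    unfold JJ
    rw [dd2_trace hΩ hy ((hG.inv hd).mul hRs), DM2_mul hΩ hy (hG.inv hd) hRs,
      DM2_inv1 hΩ hy hG hd h1, DM_inv1 hΩ hy hG hd h1, h1, hT, hR1, hR2, hRy, hS, PD.J2]
    congr 1
    simp only [inv_one, Matrix.one_mul, Matrix.neg_mul]
    abel
  · intro m
    unfold NN
    rw [dd2_trace hΩ hy (hYs.mul hYs), DM2_mul hΩ hy hYs hYs, hY1, hY2, h1, hBy, PD.N2]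
    simp
  · intro m
    unfold PP
    rw [dd2_trace hΩ hy ((hG.inv hd).mul hW), DM2_mul hΩ hy (hG.inv hd) hW,
      DM2_inv1 hΩ hy hG hd h1, DM_inv1 hΩ hy hG hd h1, h1, hT, hW1, hW2, hWy, hS, PD.P2]
    congr 1
    simp only [inv_one, Matrix.one_mul, Matrix.neg_mul]
    abel
end mk2

section sums
variable {n : ℕ}
theorem s4_12 (f : Fin n → Fin n → Fin n → Fin n → ℝ) :
    ∑ i, ∑ j, ∑ k, ∑ l, f i j k l = ∑ i, ∑ j, ∑ k, ∑ l, f j i k l := Finset.sum_comm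
theorem s4_23 (f : Fin n → Fin n → Fin n → Fin n → ℝ) :
    ∑ i, ∑ j, ∑ k, ∑ l, f i j k l = ∑ i, ∑ j, ∑ k, ∑ l, f i k j l :=
  Finset.sum_congr rfl fun _ _ => Finset.sum_comm
theorem s4_34 (f : Fin n → Fin n → Fin n → Fin n → ℝ) :
    ∑ i, ∑ j, ∑ k, ∑ l, f i j k l = ∑ i, ∑ j, ∑ k, ∑ l, f i j l k :=
  Finset.sum_congr rfl fun _ _ => Finset.sum_congr rfl fun _ _ => Finset.sum_comm
theorem c4 {f g : Fin n → Fin n → Fin n → Fin n → ℝ} (h : ∀ i j k l, f i j k l = g i j k l) :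
    ∑ i, ∑ j, ∑ k, ∑ l, f i j k l = ∑ i, ∑ j, ∑ k, ∑ l, g i j k l := by
  simp only [h]
theorem s3_12 (f : Fin n → Fin n → Fin n → ℝ) :
    ∑ i, ∑ j, ∑ k, f i j k = ∑ i, ∑ j, ∑ k, f j i k := Finset.sum_comm
theorem s3_23 (f : Fin n → Fin n → Fin n → ℝ) :
    ∑ i, ∑ j, ∑ k, f i j k = ∑ i, ∑ j, ∑ k, f i k j :=
  Finset.sum_congr rfl fun _ _ => Finset.sum_comm
theorem c3 {f g : Fin n → Fin n → Fin n → ℝ} (h : ∀ i j k, f i j k = g i j k) :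
    ∑ i, ∑ j, ∑ k, f i j k = ∑ i, ∑ j, ∑ k, g i j k := by
  simp only [h]
theorem c2 {f g : Fin n → Fin n → ℝ} (h : ∀ i j, f i j = g i j) :
    ∑ i, ∑ j, f i j = ∑ i, ∑ j, g i j := by
  simp only [h]

theorem s4_p (f : Fin n → Fin n → Fin n → Fin n → ℝ) :
    ∑ i, ∑ j, ∑ k, ∑ l, f i j k l =
      ∑ p : Fin n × Fin n × Fin n × Fin n, f p.1 p.2.1 p.2.2.1 p.2.2.2 := by
  simp only [Fintype.sum_prod_type]

theorem gen4 {ι : Type*} [Fintype ι] (s z z' z'' : ι → ℝ) (A X Z V : ℝ)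
    (hs : ∑ p, s p * s p = A) (x1 : ∑ p, s p * z p = X) (x2 : ∑ p, s p * z' p = X)
    (x3 : ∑ p, s p * z'' p = X) (z1 : ∑ p, z p * z p = Z) (z2 : ∑ p, z' p * z' p = Z)
    (z3 : ∑ p, z'' p * z'' p = Z) (v1 : ∑ p, z p * z' p = V) (v2 : ∑ p, z p * z'' p = V)
    (v3 : ∑ p, z' p * z'' p = V) :
    A / 18 + Z / 4 ≤ 2 * A - 6 * X + 3 * Z + 2 * V ∧ V ≤ Z := by
  have h1 : 0 ≤ ∑ p, (z p - z' p) ^ 2 := Finset.sum_nonneg fun _ _ => sq_nonneg _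
  have e1 : ∑ p, (z p - z' p) ^ 2 = Z + Z - 2 * V := by
    conv_rhs => rw [← z1, ← v1]
    conv_rhs => enter [1, 2]; rw [z1, ← z2]
    simp only [Finset.mul_sum, ← Finset.sum_add_distrib, ← Finset.sum_sub_distrib]
    exact Finset.sum_congr rfl fun p _ => by ring
  have h2 : 0 ≤ ∑ p, (s p - 18 / 35 * (z p + z' p + z'' p)) ^ 2 :=
    Finset.sum_nonneg fun _ _ => sq_nonneg _
  have e2 : ∑ p, (s p - 18 / 35 * (z p + z' p + z'' p)) ^ 2 =
      A - 36 / 35 * (3 * X) + (18 / 35) ^ 2 * (3 * Z + 6 * V) := by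
    have : A - 36 / 35 * (3 * X) + (18 / 35) ^ 2 * (3 * Z + 6 * V) =
      ∑ p, s p * s p - 36 / 35 * (∑ p, s p * z p + ∑ p, s p * z' p + ∑ p, s p * z'' p)
      + (18 / 35) ^ 2 * (∑ p, z p * z p + ∑ p, z' p * z' p + ∑ p, z'' p * z'' p +
        2 * (∑ p, z p * z' p + ∑ p, z p * z'' p + ∑ p, z' p * z'' p)) := by
      rw [hs, x1, x2, x3, z1, z2, z3, v1, v2, v3]; ring
    rw [this]
    simp only [Finset.mul_sum, ← Finset.sum_add_distrib, ← Finset.sum_sub_distrib]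
    exact Finset.sum_congr rfl fun p _ => by ring
  have hZ : 0 ≤ Z := z1 ▸ Finset.sum_nonneg fun _ _ => mul_self_nonneg _
  constructor
  · nlinarith
  · linarith

/-- Frobenius pairing -/
def ip (M N : Matrix (Fin n) (Fin n) ℝ) : ℝ := ∑ i, ∑ j, M i j * N i j

theorem tr_mul_eq (M N : Matrix (Fin n) (Fin n) ℝ) : (M * N).trace = ∑ i, ∑ j, M i j * N j i := by
  simp [Matrix.trace, Matrix.mul_apply]

theorem tr_ip (M N : Matrix (Fin n) (Fin n) ℝ) (h : Nᵀ = N) : (M * N).trace = ip M N := by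
  rw [tr_mul_eq, ip]
  refine c2 fun i j => ?_
  conv_rhs => rw [← h]
  rfl

theorem ip_mul_le (M N : Matrix (Fin n) (Fin n) ℝ) : ip (M * N) (M * N) ≤ ip M M * ip N N := by
  have h : ∀ i j, (M * N) i j * (M * N) i j ≤ (∑ k, M i k * M i k) * (∑ k, N k j * N k j) := by
    intro i j
    have := Finset.sum_mul_sq_le_sq_mul_sq Finset.univ (fun k => M i k) (fun k => N k j)
    simp only [Matrix.mul_apply, ← sq] at this ⊢
    exact this
  calc ip (M * N) (M * N) ≤ ∑ i, ∑ j, (∑ k, M i k * M i k) * (∑ k, N k j * N k j) :=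
        Finset.sum_le_sum fun i _ => Finset.sum_le_sum fun j _ => h i j
    _ = ip M M * ip N N := by
        rw [← Finset.sum_mul_sum]
        unfold ip
        congr 1
        exact Finset.sum_comm

theorem ip_self_nonneg (M : Matrix (Fin n) (Fin n) ℝ) : 0 ≤ ip M M :=
  Finset.sum_nonneg fun _ _ => Finset.sum_nonneg fun _ _ => mul_self_nonneg _
end sums

namespace PD
variable {n : ℕ} (d : PD n)

def Z (m i : Fin n) : Matrix (Fin n) (Fin n) ℝ := ∑ j, d.T m i j • d.T j

theorem Z_apply (m i a b : Fin n) : d.Z m i a b = ∑ j, d.T m i j * d.T j a b := by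
  simp [Z, Matrix.sum_apply]
theorem Z1 (m i a b : Fin n) : d.Z m i a b = d.Z i m a b := by
  simp only [Z_apply]; exact Finset.sum_congr rfl fun j _ => by rw [d.T1 m i j]
theorem Z2 (m i a b : Fin n) : d.Z m i a b = d.Z m i b a := by
  simp only [Z_apply]; exact Finset.sum_congr rfl fun j _ => by rw [d.T2 j a b]
theorem Z3 (m i a b : Fin n) : d.Z m i a b = d.Z a b m i := by
  simp only [Z_apply]
  exact Finset.sum_congr rfl fun j _ => by
    rw [d.T1 j a b, d.T2 a j b, d.T2 m i j, d.T1 m j i]; ring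
theorem TT (m i a b : Fin n) : (d.T m * d.T i) a b = d.Z m a i b := by
  rw [Z_apply, Matrix.mul_apply]
  exact Finset.sum_congr rfl fun j _ => by rw [d.T1 i j b]

theorem Tt (m : Fin n) : (d.T m)ᵀ = d.T m := by ext i j; exact d.T2 m j i
theorem St (m i : Fin n) : (d.S m i)ᵀ = d.S m i := by ext a b; exact d.S3 m i b a
theorem Bt : d.Bᵀ = d.B := by ext a b; exact d.B1 b a
theorem Ct (m : Fin n) : (d.C m)ᵀ = d.C m := by ext i j; exact d.C2 m j i
theorem Rt : d.Rᵀ = d.R := by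
  ext i j; exact Matrix.trace_mul_comm (d.T j) (d.T i)
theorem Zt (m i : Fin n) : (d.Z m i)ᵀ = d.Z m i := by ext a b; exact d.Z2 m i b a

def qX : ℝ := ∑ m, ∑ i, ∑ a, ∑ b, d.S m i a b * d.Z m i a b
def qV : ℝ := ∑ m, ∑ i, ∑ a, ∑ b, d.Z m i a b * d.Z m a i b
def qz : ℝ := ∑ m, ∑ i, ∑ a, ∑ b, d.Z m i a b * d.Z m i a b
def qs : ℝ := ∑ m, ∑ i, ∑ a, ∑ b, d.S m i a b * d.S m i a b
def qct : ℝ := ∑ m, ∑ i, ∑ a, d.C m i a * d.T m i a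

theorem sumTT : ∑ m, d.T m * d.T m = d.R := by
  ext i j
  simp only [Matrix.sum_apply, TT, R, Matrix.of_apply, Matrix.trace, Matrix.diag]
  refine Finset.sum_congr rfl fun m _ => ?_
  rw [d.Z1 m i, d.Z2]

theorem sumSS : ∑ m, d.S m m = d.B + d.R := by
  ext i j
  simp only [Matrix.sum_apply, Matrix.add_apply, d.hB, R, Matrix.of_apply, Matrix.trace_sub]
  rw [sub_add_cancel]
  refine Finset.sum_congr rfl fun m _ => ?_
  rw [d.S2 m m i j, d.S1 m i, d.S3 i m, d.S2 i m j m]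
  rfl

theorem X_a : ∑ m, ∑ i, ∑ j, d.T m i j * (d.S m i * d.T j).trace = d.qX := by
  unfold qX
  refine c2 fun m i => ?_
  have : ∑ j, d.T m i j * (d.S m i * d.T j).trace = (d.S m i * d.Z m i).trace := by
    simp only [Z, Matrix.mul_sum, Matrix.trace_sum, Matrix.mul_smul, Matrix.trace_smul, smul_eq_mul]
  rw [this, tr_ip _ _ (d.Zt m i), ip]

theorem V_a : ∑ m, ∑ i, ∑ j, d.T m i j * (d.T m * d.T i * d.T j).trace = d.qV := by
  unfold qV
  refine c2 fun m i => ?_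
  have : ∑ j, d.T m i j * (d.T m * d.T i * d.T j).trace = (d.T m * d.T i * d.Z m i).trace := by
    simp only [Z, Matrix.mul_sum, Matrix.trace_sum, Matrix.mul_smul, Matrix.trace_smul, smul_eq_mul]
  rw [this, tr_ip _ _ (d.Zt m i), ip]
  refine c2 fun a b => ?_
  rw [TT]; ring

theorem X_b : ∑ m, ∑ i, (d.S m i * (d.T m * d.T i)).trace = d.qX := by
  unfold qX
  simp only [tr_mul_eq, TT]
  refine (s4_34 _).trans ((s4_23 _).trans (c4 fun m i a b => ?_))
  rw [d.S3 m a b i, d.S2 m a i b]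

theorem X_c : ∑ m, ∑ i, (d.T m * d.S m i * d.T i).trace = d.qX := by
  rw [← X_b, Finset.sum_comm]
  refine c2 fun m i => ?_
  rw [d.S1 i m, Matrix.trace_mul_comm, ← Matrix.mul_assoc, Matrix.trace_mul_comm]

theorem V_b : ∑ m, ∑ i, (d.T m * d.T i * (d.T m * d.T i)).trace = d.qV := by
  unfold qV
  simp only [tr_mul_eq, TT]
  refine (s4_23 _).trans ((s4_34 _).trans (c4 fun m i a b => ?_))
  rw [d.Z2 m i b a, d.Z2 m a b i]

theorem z_r : d.qz = ip d.R d.R := by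
  have h1 : d.qz = ∑ m, ∑ i, (d.Z m i * d.Z m i).trace := by
    unfold qz
    exact c2 fun m i => by rw [tr_ip _ _ (d.Zt m i), ip]
  have h2 : ∀ m i, (d.Z m i * d.Z m i).trace =
      ∑ j, ∑ k, d.T m i j * d.T m i k * (d.T j * d.T k).trace := by
    intro m i
    simp only [Z, Matrix.mul_sum, Matrix.sum_mul, Matrix.trace_sum, Matrix.mul_smul, Matrix.smul_mul,
      Matrix.trace_smul, smul_eq_mul]
    simp only [Finset.mul_sum]
    rw [Finset.sum_comm]
    exact c2 fun j k => by ring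
  rw [h1]
  simp only [h2]
  rw [s4_23, s4_12, s4_34, s4_23]
  unfold ip
  refine c2 fun j k => ?_
  have : ∀ m i, d.T m i j * d.T m i k * (d.T j * d.T k).trace = (d.T j m i * d.T k i m) * (d.T j * d.T k).trace := by
    intro m i
    rw [d.T2 m i j, d.T1 m j i, d.T2 m i k, d.T1 m k i, d.T2 k i m]
  rw [Finset.sum_comm]
  simp only [this, ← Finset.sum_mul]
  rw [Finset.sum_comm, ← tr_mul_eq]
  rfl

def NB : ℝ := ip d.B d.B
def r2 : ℝ := ip d.R d.R
def bR : ℝ := ip d.B d.R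

theorem U_a : ∑ m, ∑ i, (d.U m m i * d.T i).trace = d.qct + 3 * d.qX - 2 * d.qV := by
  have h1 : d.qct = ∑ m, ∑ l, ∑ k, (d.T m l k * (d.T m * d.T l * d.T k).trace
      + d.T m l k * (d.T l * d.T m * d.T k).trace - d.T m l k * (d.S m l * d.T k).trace
      - d.T m l k * (d.T l * d.S m k).trace - d.T m l k * (d.T m * d.S l k).trace
      + d.T m l k * (d.U m l k).trace) := by
    unfold qct
    refine c3 fun m l k => ?_
    rw [d.hC]
    simp only [Matrix.trace_add, Matrix.trace_sub, Matrix.sub_mul, Matrix.add_mul]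
    ring
  have e2 : ∑ m, ∑ l, ∑ k, d.T m l k * (d.T l * d.T m * d.T k).trace = d.qV := by
    rw [← V_a, s3_12]; exact c3 fun m i j => by rw [d.T1 i m j]
  have e4 : ∑ m, ∑ l, ∑ k, d.T m l k * (d.T l * d.S m k).trace = d.qX := by
    rw [← X_a, s3_23]
    exact c3 fun m i j => by rw [d.T2 m j i, Matrix.trace_mul_comm]
  have e5 : ∑ m, ∑ l, ∑ k, d.T m l k * (d.T m * d.S l k).trace = d.qX := by
    rw [← X_a, s3_12, s3_23]
    exact c3 fun m i j => by rw [d.T1 j m i, d.T2 m j i, Matrix.trace_mul_comm]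
  have e6 : ∑ m, ∑ l, ∑ k, d.T m l k * (d.U m l k).trace = ∑ m, ∑ i, (d.U m m i * d.T i).trace := by
    simp only [tr_mul_eq, Matrix.trace, Matrix.diag, Finset.mul_sum]
    refine (s4_34 _).trans ((s4_23 _).trans ((s4_12 _).trans (c4 fun m i a b => ?_)))
    have hu : d.U i a b m m = d.U m m i a b := by
      rw [d.U3 i a b m m, d.U2 i a m, d.U1 i m a, d.U3 m i a b m, d.U4 m i b a m, d.U3 m i b m a,
        d.U2 m i m]
      rw [d.U3 m m i b a, d.U4 m m b i a, d.U3 m m b a i, d.U4 m m a b i, d.U3 m m a i b]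
    rw [hu, d.T2 i a b]; ring
  simp only [Finset.sum_add_distrib, Finset.sum_sub_distrib] at h1
  rw [V_a, e2, X_a, e4, e5, e6] at h1
  linarith

theorem LJ_eq : ∑ m, d.J2 m = 2 * d.qct - 3 * d.bR + 2 * d.qs - 6 * d.qX + 3 * d.r2 + 2 * d.qV := by
  have hA : ∑ m, ((d.T m * d.T m + d.T m * d.T m - d.S m m) * d.R).trace = d.r2 - d.bR := by
    rw [← Matrix.trace_sum, ← Matrix.sum_mul, Finset.sum_sub_distrib, Finset.sum_add_distrib,
      sumTT, sumSS, tr_ip _ _ d.Rt, r2, bR]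
    simp only [ip, ← Finset.sum_sub_distrib]
    exact c2 fun i j => by simp only [Matrix.sub_apply, Matrix.add_apply]; ring
  have hA' : ∑ m, ((d.T m * d.T m + d.T m * d.T m - d.S m m) * d.R).trace =
      ∑ m, ∑ i, ((d.T m * d.T m + d.T m * d.T m - d.S m m) * d.T i * d.T i).trace := by
    refine Finset.sum_congr rfl fun m _ => ?_
    rw [← sumTT, Matrix.mul_sum, Matrix.trace_sum]
    simp only [Matrix.mul_assoc]
  have hB : ∑ m, (d.T m * d.R1 m).trace = 2 * (d.qX - d.qV) := by
    have : ∑ m, (d.T m * d.R1 m).trace = ∑ m, ∑ i, ∑ j, d.T m i j * (d.X1 m i * d.T j).trace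
        + ∑ m, ∑ i, ∑ j, d.T m i j * (d.X1 m j * d.T i).trace := by
      simp only [← Finset.sum_add_distrib, tr_mul_eq (d.T _) (d.R1 _)]
      refine c3 fun m i j => ?_
      simp only [R1, Matrix.of_apply, Matrix.trace_add]
      rw [Matrix.trace_mul_comm (d.T j)]; ring
    have h2 : ∑ m, ∑ i, ∑ j, d.T m i j * (d.X1 m j * d.T i).trace =
        ∑ m, ∑ i, ∑ j, d.T m i j * (d.X1 m i * d.T j).trace := by
      rw [s3_23]; exact c3 fun m i j => by rw [d.T2 m j i]
    have h3 : ∑ m, ∑ i, ∑ j, d.T m i j * (d.X1 m i * d.T j).trace = d.qX - d.qV := by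
      rw [← X_a, ← V_a]
      simp only [← Finset.sum_sub_distrib]
      exact c3 fun m i j => by simp only [X1, Matrix.sub_mul, Matrix.trace_sub]; ring
    rw [this, h2, h3]; ring
  have hC : ∑ m, ∑ i, (d.X2 m i * d.T i).trace = d.r2 - d.bR - 2 * d.qX
      + (d.qct + 3 * d.qX - 2 * d.qV) := by
    rw [← hA, hA', ← U_a]
    have h1 : 2 * d.qX = ∑ m, ∑ i, (d.T m * d.S m i * d.T i).trace
        + ∑ m, ∑ i, (d.T m * d.S m i * d.T i).trace := by rw [X_c]; ring
    rw [h1]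
    simp only [← Finset.sum_add_distrib, ← Finset.sum_sub_distrib]
    refine c2 fun m i => ?_
    simp only [X2, Matrix.trace_add, Matrix.trace_sub, Matrix.sub_mul, Matrix.add_mul]
    ring
  have hD : ∑ m, ∑ i, (d.X1 m i * d.X1 m i).trace = d.qs - 2 * d.qX + d.qV := by
    have h1 : d.qs = ∑ m, ∑ i, (d.S m i * d.S m i).trace :=
      c2 fun m i => by rw [tr_ip _ _ (d.St m i), ip]
    have h2 : 2 * d.qX = ∑ m, ∑ i, (d.S m i * (d.T m * d.T i)).trace
      + ∑ m, ∑ i, (d.S m i * (d.T m * d.T i)).trace := by rw [X_b]; ring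
    rw [h1, h2, ← V_b]
    simp only [← Finset.sum_add_distrib, ← Finset.sum_sub_distrib]
    refine c2 fun m i => ?_
    simp only [X1, Matrix.mul_sub, Matrix.trace_add, Matrix.trace_sub, Matrix.sub_mul, Matrix.add_mul]
    rw [Matrix.trace_mul_comm (d.T m * d.T i) (d.S m i)]
    ring
  have hE : ∑ m, (d.R2 m).trace = 2 * ∑ m, ∑ i, (d.X2 m i * d.T i).trace
      + 2 * ∑ m, ∑ i, (d.X1 m i * d.X1 m i).trace := by
    simp only [Finset.mul_sum, ← Finset.sum_add_distrib]
    refine c2 fun m i => ?_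
    simp only [R2, Matrix.diag, Matrix.of_apply, Matrix.trace_add]
    rw [Matrix.trace_mul_comm (d.T i)]; ring
  have : ∑ m, d.J2 m = ∑ m, ((d.T m * d.T m + d.T m * d.T m - d.S m m) * d.R).trace
      - 2 * ∑ m, (d.T m * d.R1 m).trace + ∑ m, (d.R2 m).trace := by
    simp only [Finset.mul_sum, ← Finset.sum_add_distrib, ← Finset.sum_sub_distrib]
    refine Finset.sum_congr rfl fun m _ => ?_
    simp only [J2, Matrix.trace_add, Matrix.trace_sub]; ring
  rw [this, hA, hB, hE, hC, hD]; ring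

theorem LJ_ge : 2 * d.qct - 3 * d.bR + d.qs / 18 + d.r2 / 4 ≤ ∑ m, d.J2 m := by
  rw [LJ_eq]
  have hz : d.r2 = d.qz := (z_r d).symm
  rw [hz]
  have x2 : ∑ m, ∑ i, ∑ a, ∑ b, d.S m i a b * d.Z m a i b = d.qX := by
    unfold qX; rw [s4_23]; exact c4 fun m i a b => by rw [d.S2 m a i b]
  have x3 : ∑ m, ∑ i, ∑ a, ∑ b, d.S m i a b * d.Z m b i a = d.qX := by
    unfold qX; rw [s4_34, s4_23]; exact c4 fun m i a b => by rw [d.S3 m a b i, d.S2 m a i b]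
  have z2 : ∑ m, ∑ i, ∑ a, ∑ b, d.Z m a i b * d.Z m a i b = d.qz := by
    unfold qz; rw [s4_23]
  have z3 : ∑ m, ∑ i, ∑ a, ∑ b, d.Z m b i a * d.Z m b i a = d.qz := by
    unfold qz; rw [s4_34, s4_23]
  have v2 : ∑ m, ∑ i, ∑ a, ∑ b, d.Z m i a b * d.Z m b i a = d.qV := by
    unfold qV; rw [s4_34]; exact c4 fun m i a b => by rw [d.Z2 m i b a]
  have v3 : ∑ m, ∑ i, ∑ a, ∑ b, d.Z m a i b * d.Z m b i a = d.qV := by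
    unfold qV
    exact (s4_23 _).trans ((s4_34 _).trans (c4 fun m i a b => by rw [d.Z2 m i b a, d.Z2 m a b i]))
  have s1 : ∑ m, ∑ i, ∑ a, ∑ b, d.S m i a b * d.S m i a b = d.qs := rfl
  have x1 : ∑ m, ∑ i, ∑ a, ∑ b, d.S m i a b * d.Z m i a b = d.qX := rfl
  have z1 : ∑ m, ∑ i, ∑ a, ∑ b, d.Z m i a b * d.Z m i a b = d.qz := rfl
  have v1 : ∑ m, ∑ i, ∑ a, ∑ b, d.Z m i a b * d.Z m a i b = d.qV := rfl
  have := gen4 _ _ _ _ _ _ _ _ ((s4_p _).symm.trans s1) ((s4_p _).symm.trans x1)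
    ((s4_p _).symm.trans x2)
    ((s4_p _).symm.trans x3) ((s4_p _).symm.trans z1) ((s4_p _).symm.trans z2)
    ((s4_p _).symm.trans z3)
    ((s4_p _).symm.trans v1) ((s4_p _).symm.trans v2) ((s4_p _).symm.trans v3)
  linarith [this.1]

end PD

theorem s3_rot {n : ℕ} (f : Fin n → Fin n → Fin n → ℝ) :
    ∑ i, ∑ j, ∑ k, f i j k = ∑ k, ∑ i, ∑ j, f i j k := (s3_23 _).trans (s3_12 _)

theorem gen1 {ι : Type*} [Fintype ι] (a b : ι → ℝ) {k : ℝ} (hk : 0 < k) :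
    - (k * ∑ p, a p * a p + k⁻¹ * ∑ p, b p * b p) ≤ 2 * ∑ p, a p * b p := by
  have h : 0 ≤ k * ∑ p, (a p + k⁻¹ * b p) ^ 2 :=
    mul_nonneg hk.le (Finset.sum_nonneg fun _ _ => sq_nonneg _)
  have e : k * ∑ p, (a p + k⁻¹ * b p) ^ 2 = k * ∑ p, a p * a p + k⁻¹ * ∑ p, b p * b p
      + 2 * ∑ p, a p * b p := by
    simp only [Finset.mul_sum, ← Finset.sum_add_distrib]
    exact Finset.sum_congr rfl fun p _ => by field_simp; ring
  linarith

theorem s3_p {n : ℕ} (f : Fin n → Fin n → Fin n → ℝ) :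
    ∑ i, ∑ j, ∑ k, f i j k = ∑ p : Fin n × Fin n × Fin n, f p.1 p.2.1 p.2.2 := by
  simp only [Fintype.sum_prod_type]
theorem s2_p {n : ℕ} (f : Fin n → Fin n → ℝ) :
    ∑ i, ∑ j, f i j = ∑ p : Fin n × Fin n, f p.1 p.2 := by
  simp only [Fintype.sum_prod_type]
theorem gen1_2 {n : ℕ} (a b : Fin n → Fin n → ℝ) {k : ℝ} (hk : 0 < k) :
    - (k * ∑ i, ∑ j, a i j * a i j + k⁻¹ * ∑ i, ∑ j, b i j * b i j) ≤ 2 * ∑ i, ∑ j, a i j * b i j := by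
  rw [s2_p, s2_p, s2_p]; exact gen1 _ _ hk
theorem gen1_3 {n : ℕ} (a b : Fin n → Fin n → Fin n → ℝ) {k : ℝ} (hk : 0 < k) :
    - (k * ∑ i, ∑ j, ∑ l, a i j l * a i j l + k⁻¹ * ∑ i, ∑ j, ∑ l, b i j l * b i j l) ≤
      2 * ∑ i, ∑ j, ∑ l, a i j l * b i j l := by
  rw [s3_p, s3_p, s3_p]; exact gen1 _ _ hk
theorem gen1_4 {n : ℕ} (a b : Fin n → Fin n → Fin n → Fin n → ℝ) {k : ℝ} (hk : 0 < k) :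
    - (k * ∑ i, ∑ j, ∑ l, ∑ m, a i j l m * a i j l m + k⁻¹ * ∑ i, ∑ j, ∑ l, ∑ m, b i j l m * b i j l m) ≤
      2 * ∑ i, ∑ j, ∑ l, ∑ m, a i j l m * b i j l m := by
  rw [s4_p, s4_p, s4_p]; exact gen1 _ _ hk

namespace PD
variable {n : ℕ} (d : PD n)

def q (m : Fin n) : Matrix (Fin n) (Fin n) ℝ := d.T m * d.B
def q2 : ℝ := ∑ m, ip (d.q m) (d.q m)
def c2' : ℝ := ∑ m, ip (d.C m) (d.C m)
def cq : ℝ := ∑ m, ip (d.C m) (d.q m)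
def qq : ℝ := ∑ m, (d.q m * d.q m).trace
def sb : ℝ := ∑ i, ∑ j, d.B i j * (d.S i j * d.B).trace

theorem qt (m : Fin n) : (d.q m)ᵀ = d.B * d.T m := by
  rw [q, Matrix.transpose_mul, d.Tt, d.Bt]

theorem RBB : (d.R * d.B * d.B).trace = d.q2 := by
  rw [← sumTT, q2]
  simp only [Matrix.sum_mul, Matrix.trace_sum]
  refine Finset.sum_congr rfl fun m _ => ?_
  have : (d.T m * d.T m * d.B * d.B).trace = ((d.q m) * (d.q m)ᵀ).trace := by
    rw [qt, q, Matrix.trace_mul_comm]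
    simp only [Matrix.mul_assoc]
    rw [Matrix.trace_mul_comm]
    simp only [Matrix.mul_assoc]
    rw [Matrix.trace_mul_comm]
    simp only [Matrix.mul_assoc]
  rw [this, tr_mul_eq]
  rfl

theorem cq_a : ∑ m, (d.T m * d.C m * d.B).trace = d.cq := by
  refine Finset.sum_congr rfl fun m _ => ?_
  rw [Matrix.mul_assoc, Matrix.trace_mul_comm, Matrix.mul_assoc, ← qt, tr_mul_eq]
  rfl

theorem cq_b : ∑ m, (d.C m * d.q m).trace = d.cq := by
  refine Finset.sum_congr rfl fun m _ => ?_
  rw [Matrix.trace_mul_comm, tr_ip _ _ (d.Ct m)]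
  exact c2 fun i j => mul_comm _ _

theorem cq_c : ∑ i, ∑ j, d.B i j * (d.T i * d.C j).trace = d.cq := by
  rw [← cq_a]
  have : ∀ m, (d.T m * d.C m * d.B).trace = ∑ a, ∑ c, ∑ b, d.T m a b * d.C m b c * d.B c a := by
    intro m
    rw [tr_mul_eq]
    simp only [Matrix.mul_apply, Finset.sum_mul]
  simp only [this, tr_mul_eq, Finset.mul_sum]
  symm
  refine (s4_12 _).trans ((s4_23 _).trans (c4 fun i j a b => ?_))
  rw [d.T1 a i b, d.C1 a b j, d.C2 b a j, d.C1 b j a, d.C2 j b a, d.B1 j i]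
  rw [d.C2 j a b]
  ring

theorem qq_a : ∑ i, ∑ j, d.B i j * (d.T i * d.T j * d.B).trace = d.qq := by
  have h1 : ∀ i j, d.B i j * (d.T i * d.T j * d.B).trace = 
      ∑ a, ∑ b, (∑ c, d.T i a c * d.T j c b * d.B b a * d.B i j) := by
    intro i j
    rw [tr_mul_eq]
    simp only [Matrix.mul_apply, Finset.sum_mul, Finset.mul_sum]
    refine c3 fun a b c => by ring
  have h2 : d.qq = ∑ m, ∑ a, ∑ b, ∑ c, ∑ e, d.T m a c * d.B c b * (d.T m b e * d.B e a) := by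
    refine Finset.sum_congr rfl fun m _ => ?_
    rw [tr_mul_eq]
    simp only [q, Matrix.mul_apply, Finset.sum_mul_sum]
  simp only [h1]
  rw [h2]
  -- move c to the front on the left
  have h3 : ∑ i, ∑ j, ∑ a, ∑ b, ∑ c, d.T i a c * d.T j c b * d.B b a * d.B i j
     = ∑ c, ∑ i, ∑ j, ∑ a, ∑ b, d.T i a c * d.T j c b * d.B b a * d.B i j := by
    exact (c2 fun i j => s3_rot _).trans (s3_rot fun i j c => ∑ a, ∑ b, d.T i a c * d.T j c b * d.B b a * d.B i j)
  rw [h3]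
  refine Finset.sum_congr rfl fun m _ => ?_
  refine (s4_23 _).trans ((s4_34 _).trans ((s4_23 _).trans (c4 fun a b c e => ?_)))
  rw [d.T2 a c m, d.T1 a m c, d.T1 e m b, d.T2 m e b, d.B1 b c, d.B1 a e]
  ring

theorem sumE : ∑ m, (d.E m m * d.B).trace = d.sb - 2 * d.qq + 2 * d.cq := by
  have h1 : ∑ m, (d.E m m * d.B).trace = ∑ i, ∑ j, d.B i j * (d.E i j).trace := by
    simp only [tr_mul_eq]
    simp only [Matrix.trace, Matrix.diag, Finset.mul_sum]
    rw [← s3_rot fun i j m => d.E m m i j * d.B j i]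
    refine c3 fun i j m => ?_
    rw [d.E2 m m i j, d.E1 m i, d.E3 i m m j, d.E2 i m j m, d.B1 i j]; ring
  have h2 : ∀ i j, (d.E i j).trace = (d.S i j * d.B).trace - (d.T i * d.T j * d.B).trace
      - (d.T j * d.T i * d.B).trace + (d.T i * d.C j).trace + (d.T j * d.C i).trace := by
    intro i j
    have := d.e2 i j
    simp only [Matrix.trace_add, Matrix.trace_sub, Matrix.add_mul, Matrix.sub_mul] at this
    linarith
  have e1 : 2 * d.qq = ∑ i, ∑ j, d.B i j * (d.T i * d.T j * d.B).trace
      + ∑ i, ∑ j, d.B i j * (d.T j * d.T i * d.B).trace := by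
    rw [qq_a, Finset.sum_comm, ← qq_a, two_mul]; congr 1
    exact c2 fun i j => by rw [d.B1 i j]
  have e2 : 2 * d.cq = ∑ i, ∑ j, d.B i j * (d.T i * d.C j).trace
      + ∑ i, ∑ j, d.B i j * (d.T j * d.C i).trace := by
    rw [cq_c, Finset.sum_comm, ← cq_c, two_mul]; congr 1
    exact c2 fun i j => by rw [d.B1 i j]
  rw [h1, e1, e2, sb]
  simp only [← Finset.sum_add_distrib, ← Finset.sum_sub_distrib]
  exact c2 fun i j => by rw [h2]; ring

theorem LN_eq : ∑ m, d.N2 m = 2 * d.c2' - 4 * d.cq + 2 * d.sb + 2 * d.q2 - 2 * d.qq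
    - 2 * (d.B * d.B * d.B).trace := by
  have hA : ∑ m, ((d.T m * d.T m + d.T m * d.T m - d.S m m) * d.B * d.B).trace =
      d.q2 - (d.B * d.B * d.B).trace := by
    rw [← Matrix.trace_sum, ← Matrix.sum_mul, ← Matrix.sum_mul, Finset.sum_sub_distrib,
      Finset.sum_add_distrib, sumTT, sumSS, ← RBB, ← Matrix.trace_sub, ← Matrix.sub_mul, ← Matrix.sub_mul]
    congr 3; abel
  have hY2 : ∑ m, (d.Y2 m * d.B).trace = d.q2 - (d.B * d.B * d.B).trace - 2 * d.cq
      + (d.sb - 2 * d.qq + 2 * d.cq) := by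
    rw [← sumE, ← hA, ← cq_a]
    simp only [Finset.mul_sum, ← Finset.sum_add_distrib, ← Finset.sum_sub_distrib]
    refine Finset.sum_congr rfl fun m _ => ?_
    simp only [Y2, Matrix.trace_add, Matrix.trace_sub, Matrix.add_mul, Matrix.sub_mul]
    ring
  have hY1 : ∑ m, (d.Y1 m * d.Y1 m).trace = d.c2' - 2 * d.cq + d.qq := by
    have h1 : d.c2' = ∑ m, (d.C m * d.C m).trace :=
      Finset.sum_congr rfl fun m _ => (tr_ip _ _ (d.Ct m)).symm
    rw [h1, ← cq_b, qq]
    simp only [Finset.mul_sum, ← Finset.sum_add_distrib, ← Finset.sum_sub_distrib]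
    refine Finset.sum_congr rfl fun m _ => ?_
    have : d.Y1 m = d.C m - d.q m := rfl
    rw [this]
    simp only [Matrix.mul_sub, Matrix.sub_mul, Matrix.trace_sub]
    rw [Matrix.trace_mul_comm (d.q m) (d.C m)]; ring
  have : ∑ m, d.N2 m = 2 * ∑ m, (d.Y2 m * d.B).trace + 2 * ∑ m, (d.Y1 m * d.Y1 m).trace := by
    simp only [Finset.mul_sum, ← Finset.sum_add_distrib]
    refine Finset.sum_congr rfl fun m _ => ?_
    simp only [N2, Matrix.trace_add]
    rw [Matrix.trace_mul_comm d.B]; ring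
  rw [this, hY1, hY2]; ring

def JT : ℝ := ∑ m, ip (d.T m) (d.T m)

theorem JT_eq : d.R.trace = d.JT :=
  Finset.sum_congr rfl fun m _ => tr_ip _ _ (d.Tt m)
theorem JT_nonneg : 0 ≤ d.JT := Finset.sum_nonneg fun _ _ => ip_self_nonneg _
theorem NB_nonneg : 0 ≤ d.NB := ip_self_nonneg _

theorem q2_le : d.q2 ≤ d.JT * d.NB := by
  unfold q2 JT NB
  rw [Finset.sum_mul]
  exact Finset.sum_le_sum fun m _ => ip_mul_le _ _

theorem qq_le : d.qq ≤ d.q2 := by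
  refine Finset.sum_le_sum fun m _ => ?_
  have h1 := gen1_2 (fun i j => d.q m i j) (fun i j => - d.q m j i) one_pos
  have h2 : ∑ i, ∑ j, -d.q m j i * -d.q m j i = ip (d.q m) (d.q m) := by
    rw [Finset.sum_comm]; exact c2 fun i j => by ring
  have h3 : ∑ i, ∑ j, d.q m i j * -d.q m j i = - (d.q m * d.q m).trace := by
    rw [tr_mul_eq, ← Finset.sum_neg_distrib]
    refine Finset.sum_congr rfl fun i _ => ?_
    rw [← Finset.sum_neg_distrib]
    exact Finset.sum_congr rfl fun j _ => by ring
  rw [h2, h3] at h1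
  have h4 : ∑ i, ∑ j, d.q m i j * d.q m i j = ip (d.q m) (d.q m) := rfl
  rw [h4] at h1
  linarith

theorem BBB_le : 2 * (d.B * d.B * d.B).trace ≤ d.NB + d.NB ^ 2 := by
  have h0 : (d.B * d.B * d.B).trace = ip (d.B * d.B) d.B := tr_ip _ _ d.Bt
  have h1 := gen1_2 (fun i j => (d.B * d.B) i j) (fun i j => - d.B i j) one_pos
  have h2 : ∑ i, ∑ j, -d.B i j * -d.B i j = d.NB := c2 fun i j => by ring
  have h3 : ∑ i, ∑ j, (d.B * d.B) i j * -d.B i j = - ip (d.B * d.B) d.B := by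
    rw [ip, ← Finset.sum_neg_distrib]
    refine Finset.sum_congr rfl fun i _ => ?_
    rw [← Finset.sum_neg_distrib]
    exact Finset.sum_congr rfl fun j _ => by ring
  have h4 : ∑ i, ∑ j, (d.B * d.B) i j * (d.B * d.B) i j ≤ d.NB * d.NB := ip_mul_le _ _
  rw [h2, h3] at h1
  rw [h0]
  nlinarith

theorem I3 (hn : n ≤ 5) {μ : ℝ} (hμ : 0 < μ) :
    μ * d.JT ^ 2 / 40 - μ ^ 2 * d.JT - (4 * d.JT + 18 * μ + 1 + (18 / μ + 1) * d.NB) * d.NB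
      ≤ μ * ∑ m, d.J2 m + ∑ m, d.N2 m := by
  have h1 := d.LJ_ge
  have h2 := d.LN_eq
  have hcq : 0 ≤ d.c2' - 4 * d.cq + 4 * d.q2 := by
    have := gen1_3 (fun m i j => d.C m i j) (fun m i j => - d.q m i j) (k := 1 / 2) (by norm_num)
    have e1 : ∑ m, ∑ i, ∑ j, -d.q m i j * -d.q m i j = d.q2 := c3 fun m i j => by ring
    have e2 : ∑ m, ∑ i, ∑ j, d.C m i j * -d.q m i j = - d.cq := by
      unfold cq ip; simp only [← Finset.sum_neg_distrib]; exact c3 fun m i j => by ring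
    have e3 : ∑ m, ∑ i, ∑ j, d.C m i j * d.C m i j = d.c2' := rfl
    rw [e1, e2, e3] at this
    norm_num at this
    linarith
  have hct : - (d.c2' + μ ^ 2 * d.JT) ≤ 2 * μ * d.qct := by
    have := gen1_3 (fun m i j => d.C m i j) (fun m i j => d.T m i j) (k := μ⁻¹) (inv_pos.2 hμ)
    have e2 : ∑ m, ∑ i, ∑ j, d.C m i j * d.T m i j = d.qct := rfl
    have e3 : ∑ m, ∑ i, ∑ j, d.C m i j * d.C m i j = d.c2' := rfl
    have e4 : ∑ m, ∑ i, ∑ j, d.T m i j * d.T m i j = d.JT := rfl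
    rw [e2, e3, e4, inv_inv] at this
    have h5 := mul_le_mul_of_nonneg_left this hμ.le
    have h6 : μ * -(μ⁻¹ * d.c2' + μ * d.JT) = - (d.c2' + μ ^ 2 * d.JT) := by field_simp
    rw [h6] at h5
    linarith
  have hbR : 3 * d.bR ≤ d.r2 / 8 + 18 * d.NB := by
    have := gen1_2 (fun i j => d.B i j) (fun i j => - d.R i j) (k := 12) (by norm_num)
    have e1 : ∑ i, ∑ j, -d.R i j * -d.R i j = d.r2 := c2 fun i j => by ring
    have e2 : ∑ i, ∑ j, d.B i j * -d.R i j = - d.bR := by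
      unfold bR ip; simp only [← Finset.sum_neg_distrib]; exact c2 fun i j => by ring
    have e3 : ∑ i, ∑ j, d.B i j * d.B i j = d.NB := rfl
    rw [e1, e2, e3] at this
    linarith
  have hsb : - (μ / 18 * d.qs + 18 / μ * d.NB ^ 2) ≤ 2 * d.sb := by
    have := gen1_4 (fun i j a b => d.S i j a b) (fun i j a b => d.B i j * d.B a b) (k := μ / 18)
      (by positivity)
    have e1 : ∑ i, ∑ j, ∑ a, ∑ b, (d.B i j * d.B a b) * (d.B i j * d.B a b) = d.NB ^ 2 := by
      have : ∀ i j, ∑ a, ∑ b, (d.B i j * d.B a b) * (d.B i j * d.B a b) = d.B i j * d.B i j * d.NB := by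
        intro i j; unfold NB ip
        simp only [Finset.mul_sum]
        exact c2 fun a b => by ring
      simp only [this, ← Finset.sum_mul]
      rw [sq]; rfl
    have e2 : ∑ i, ∑ j, ∑ a, ∑ b, d.S i j a b * (d.B i j * d.B a b) = d.sb := by
      refine c2 fun i j => ?_
      rw [tr_ip _ _ d.Bt, ip]
      simp only [Finset.mul_sum]
      exact c2 fun a b => by ring
    have e3 : ∑ i, ∑ j, ∑ a, ∑ b, d.S i j a b * d.S i j a b = d.qs := rfl
    rw [e1, e2, e3, inv_div] at this
    exact this
  have hr : d.JT ^ 2 / 5 ≤ d.r2 := by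
    have h3 : (∑ i, d.R i i) ^ 2 ≤ (n : ℝ) * ∑ i, d.R i i ^ 2 := by
      have := sq_sum_le_card_mul_sum_sq (s := (Finset.univ : Finset (Fin n))) (f := fun i => d.R i i)
      simpa using this
    have h4 : ∑ i, d.R i i ^ 2 ≤ d.r2 := by
      refine Finset.sum_le_sum fun i _ => ?_
      rw [sq]
      exact Finset.single_le_sum (f := fun j => d.R i j * d.R i j) (fun j _ => mul_self_nonneg _) (Finset.mem_univ i)
    have h5 : d.JT = ∑ i, d.R i i := d.JT_eq.symm
    rw [h5]
    have h6 : (n : ℝ) ≤ 5 := by exact_mod_cast hn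
    have h7 : 0 ≤ ∑ i, d.R i i ^ 2 := Finset.sum_nonneg fun _ _ => sq_nonneg _
    nlinarith
  have a1 := mul_le_mul_of_nonneg_left h1 hμ.le
  have a2 := d.q2_le
  have a3 := d.qq_le
  have a4 := d.BBB_le
  have a5 := mul_le_mul_of_nonneg_left hbR hμ.le
  have a6 := mul_le_mul_of_nonneg_left hr hμ.le
  have e : (18 / μ + 1) * d.NB * d.NB = 18 / μ * d.NB ^ 2 + d.NB ^ 2 := by ring
  have e' : (4 * d.JT + 18 * μ + 1 + (18 / μ + 1) * d.NB) * d.NB = 4 * (d.JT * d.NB)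
    + 18 * μ * d.NB + d.NB + 18 / μ * d.NB ^ 2 + d.NB ^ 2 := by rw [← sub_eq_zero]; linear_combination e
  rw [e']
  linarith

def M : Matrix (Fin n) (Fin n) ℝ := ∑ i, d.v i • d.T i
def ph : ℝ := ∑ i, d.v i * d.v i
def bvv : ℝ := ∑ i, ∑ j, d.B i j * (d.v i * d.v j)

theorem W0_tr : d.W0.trace = d.ph := rfl

theorem M_tr : d.M.trace = d.ph := by
  unfold M ph
  rw [Matrix.trace_sum]
  exact Finset.sum_congr rfl fun i _ => by rw [Matrix.trace_smul, ← d.hv]; rfl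

theorem Mt : d.Mᵀ = d.M := by
  unfold M
  rw [Matrix.transpose_sum]
  exact Finset.sum_congr rfl fun i _ => by rw [Matrix.transpose_smul, d.Tt]

theorem M_apply (a b : Fin n) : d.M a b = ∑ i, d.v i * d.T i a b := by
  simp [M, Matrix.sum_apply]

theorem LP_eq : ∑ m, d.P2 m = ip d.M d.M - 2 * ip d.M d.B + 2 * d.NB - d.bvv := by
  have W0t : d.W0ᵀ = d.W0 := by ext i j; simp only [W0, Matrix.transpose_apply, Matrix.of_apply]; ring
  have hA : ∑ m, ((d.T m * d.T m + d.T m * d.T m - d.S m m) * d.W0).trace = ip d.M d.M - d.bvv := by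
    rw [← Matrix.trace_sum, ← Matrix.sum_mul, Finset.sum_sub_distrib,
      Finset.sum_add_distrib, sumTT, sumSS, show d.R + d.R - (d.B + d.R) = d.R - d.B by abel,
      Matrix.sub_mul, Matrix.trace_sub, tr_ip _ _ W0t, tr_ip _ _ W0t, ← tr_ip _ _ d.Mt]
    have : (d.M * d.M).trace = ip d.R d.W0 := by
      unfold M
      simp only [Matrix.sum_mul, Matrix.mul_sum, Matrix.trace_sum, Matrix.smul_mul, Matrix.mul_smul,
        Matrix.trace_smul, smul_eq_mul]
      simp only [Finset.mul_sum]
      rw [Finset.sum_comm]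
      refine c2 fun i j => ?_
      simp only [R, W0, Matrix.of_apply]
      rw [Matrix.trace_mul_comm (d.T i)]; ring
    rw [this]; rfl
  have hB : ∑ m, (d.T m * d.W1 m).trace = 2 * ip d.M d.B := by
    have h1 : ip d.M d.B = ∑ m, ∑ i, ∑ j, d.T m i j * (d.B m i * d.v j) := by
      unfold ip
      simp only [M_apply, Finset.sum_mul]
      exact c3 fun m i j => by rw [d.T1 j m i, d.T2 m j i]; ring
    have h2 : ip d.M d.B = ∑ m, ∑ i, ∑ j, d.T m i j * (d.v i * d.B m j) := by
      rw [h1]; exact (s3_23 _).trans (c3 fun m i j => by rw [d.T2 m j i]; ring)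
    rw [two_mul]
    conv_rhs => rw [h1]
    conv_rhs => enter [2]; rw [← h1, h2]
    simp only [← Finset.sum_add_distrib, tr_mul_eq]
    exact c3 fun m i j => by simp only [W1, Matrix.of_apply]; ring
  have hC : ∑ m, (d.W2 m).trace = 2 * ip d.M d.B + 2 * d.NB := by
    have h1 : ∀ i, ∑ m, d.C m m i = (d.T i * d.B).trace := by
      intro i
      have := d.e1 i
      rw [Matrix.trace_sub, sub_eq_zero] at this
      rw [← this]
      exact Finset.sum_congr rfl fun m _ => by rw [d.C2 m m i, d.C1 m i m]; rfl
    have h2 : ∑ m, ∑ i, d.v i * d.C m m i = ip d.M d.B := by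
      rw [Finset.sum_comm]
      simp only [← Finset.mul_sum, h1]
      rw [← tr_ip _ _ d.Bt, M, Matrix.sum_mul, Matrix.trace_sum]
      exact Finset.sum_congr rfl fun i _ => by rw [Matrix.smul_mul, Matrix.trace_smul]; rfl
    rw [← h2, NB, ip]
    simp only [Finset.mul_sum, ← Finset.sum_add_distrib]
    refine c2 fun m i => ?_
    simp only [W2, Matrix.diag, Matrix.of_apply]; ring
  have : ∑ m, d.P2 m = ∑ m, ((d.T m * d.T m + d.T m * d.T m - d.S m m) * d.W0).trace
      - 2 * ∑ m, (d.T m * d.W1 m).trace + ∑ m, (d.W2 m).trace := by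
    simp only [Finset.mul_sum, ← Finset.sum_add_distrib, ← Finset.sum_sub_distrib]
    refine Finset.sum_congr rfl fun m _ => ?_
    simp only [P2, Matrix.trace_add, Matrix.trace_sub]; ring
  rw [this, hA, hB, hC]; ring

theorem vv_sq : ∑ i, ∑ j, (d.v i * d.v j) * (d.v i * d.v j) = d.ph ^ 2 := by
  unfold ph
  rw [sq, Finset.sum_mul_sum]
  exact c2 fun i j => by ring

theorem I2 : d.NB / 2 - d.ph ^ 2 / 2 ≤ ∑ m, d.P2 m := by
  rw [LP_eq]
  have h1 := gen1_2 (fun i j => d.M i j) (fun i j => - d.B i j) one_pos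
  have h2 : ∑ i, ∑ j, -d.B i j * -d.B i j = d.NB := c2 fun i j => by ring
  have h3 : ∑ i, ∑ j, d.M i j * -d.B i j = - ip d.M d.B := by
    unfold ip; simp only [← Finset.sum_neg_distrib]; exact c2 fun i j => by ring
  have h4 : ∑ i, ∑ j, d.M i j * d.M i j = ip d.M d.M := rfl
  rw [h2, h3, h4] at h1
  have k1 := gen1_2 (fun i j => d.B i j) (fun i j => - (d.v i * d.v j)) one_pos
  have k2 : ∑ i, ∑ j, -(d.v i * d.v j) * -(d.v i * d.v j) = d.ph ^ 2 := by
    rw [← vv_sq]; exact c2 fun i j => by ring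
  have k3 : ∑ i, ∑ j, d.B i j * -(d.v i * d.v j) = - d.bvv := by
    unfold bvv; simp only [← Finset.sum_neg_distrib]; exact c2 fun i j => by ring
  have k4 : ∑ i, ∑ j, d.B i j * d.B i j = d.NB := rfl
  rw [k2, k3, k4] at k1
  norm_num at h1 k1
  linarith

end PD

theorem proj_ge {n : ℕ} (hn : n ≤ 5) (X : Matrix (Fin n) (Fin n) ℝ) (v : Fin n → ℝ) {p a : ℝ}
    (hp : ∑ i, v i * v i = p) (hp0 : 0 < p) (ha : ∑ i, ∑ j, X i j * (v i * v j) = a * p) :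
    a ^ 2 + (X.trace - a) ^ 2 / 4 ≤ ip X X := by
  set b := (X.trace - a) / 4 with hb
  set c := (a - b) / p with hc
  have h0 : 0 ≤ ∑ i, ∑ j, (X i j - c * (v i * v j) - b * (1 : Matrix (Fin n) (Fin n) ℝ) i j) ^ 2 :=
    Finset.sum_nonneg fun _ _ => Finset.sum_nonneg fun _ _ => sq_nonneg _
  have e2 : ∑ i, ∑ j, (v i * v j) * (v i * v j) = p ^ 2 := by
    rw [← hp, sq, Finset.sum_mul_sum]; exact c2 fun i j => by ring
  have e3 : ∑ i, ∑ j, X i j * (1 : Matrix (Fin n) (Fin n) ℝ) i j = X.trace := by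
    simp [Matrix.one_apply, Matrix.trace]
  have e4 : ∑ i, ∑ j, (v i * v j) * (1 : Matrix (Fin n) (Fin n) ℝ) i j = p := by
    simp [Matrix.one_apply, ← hp]
  have e5 : ∑ i, ∑ j, (1 : Matrix (Fin n) (Fin n) ℝ) i j * (1 : Matrix (Fin n) (Fin n) ℝ) i j = n := by
    simp [Matrix.one_apply]
  have e : ∑ i, ∑ j, (X i j - c * (v i * v j) - b * (1 : Matrix (Fin n) (Fin n) ℝ) i j) ^ 2
      = ip X X - 2 * c * (a * p) - 2 * b * X.trace + c ^ 2 * p ^ 2 + 2 * c * b * p + b ^ 2 * n := by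
    rw [← ha, ← e2, ← e3, ← e4, ← e5]
    conv_rhs => rw [e4]
    conv_rhs => rw [← e4]
    unfold ip
    simp only [Finset.mul_sum, ← Finset.sum_add_distrib, ← Finset.sum_sub_distrib]
    refine c2 fun i j => by ring
  rw [e] at h0
  have hcp : c * p = a - b := by rw [hc]; field_simp
  have h6 : (n : ℝ) ≤ 5 := by exact_mod_cast hn
  have h7 : ip X X - 2 * c * (a * p) - 2 * b * X.trace + c ^ 2 * p ^ 2 + 2 * c * b * p + b ^ 2 * n
     = ip X X - 2 * (a - b) * a - 2 * b * (4 * b + a) + (a - b) ^ 2 + 2 * (a - b) * b + b ^ 2 * n := by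
    rw [← hcp, hb]; ring
  rw [h7] at h0
  have h8 : X.trace - a = 4 * b := by rw [hb]; ring
  rw [h8]
  nlinarith [mul_le_mul_of_nonneg_left h6 (sq_nonneg b)]

namespace PD
variable {n : ℕ} (d : PD n)

theorem NB_eq : (d.B * d.B).trace = d.NB := tr_ip _ _ d.Bt

theorem P1_sum : ∑ m, d.v m * d.P1 m = 2 * d.bvv - ∑ i, ∑ j, d.M i j * (d.v i * d.v j) := by
  have h : ∀ m, d.v m * d.P1 m = ∑ i, (2 * (d.B m i * (d.v m * d.v i))) - ∑ i, ∑ j, d.v m * d.T m i j * (d.v i * d.v j) := by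
    intro m
    unfold P1
    rw [Matrix.trace_sub, tr_mul_eq, mul_sub]
    congr 1
    · simp only [W1, Matrix.trace, Matrix.diag, Matrix.of_apply, Finset.mul_sum]
      exact Finset.sum_congr rfl fun i _ => by ring
    · simp only [W0, Matrix.of_apply, Finset.mul_sum]
      exact c2 fun i j => by ring
  simp only [h, Finset.sum_sub_distrib, bvv, Finset.mul_sum, M_apply, Finset.sum_mul]
  congr 1
  exact s3_rot _ |>.symm

theorem I1 (hn : n ≤ 5) (hp : 0 < d.ph) {w : ℝ} (hw : ∑ m, d.v m * d.P1 m = w * d.ph) :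
    d.ph ^ 2 / 80 - w ^ 2 ≤ ∑ m, d.P2 m := by
  rw [P1_sum] at hw
  obtain ⟨p, hpp⟩ : ∃ p, d.bvv = p * d.ph := ⟨d.bvv / d.ph, by field_simp⟩
  have hB := proj_ge hn d.B d.v rfl hp hpp
  have hX := proj_ge hn (d.M - d.B) d.v (a := p - w) rfl hp (by
    simp only [Matrix.sub_apply, sub_mul, Finset.sum_sub_distrib]
    have : ∑ i, ∑ j, d.B i j * (d.v i * d.v j) = d.bvv := rfl
    rw [this]
    change _ = p * d.ph - w * d.ph
    linarith)
  have hXe : ip (d.M - d.B) (d.M - d.B) = ip d.M d.M - 2 * ip d.M d.B + d.NB := by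
    unfold NB ip
    simp only [Finset.mul_sum, ← Finset.sum_add_distrib, ← Finset.sum_sub_distrib, Matrix.sub_apply]
    exact c2 fun i j => by ring
  have h0 := d.e0
  rw [hXe, Matrix.trace_sub, M_tr, h0] at hX
  rw [h0] at hB
  rw [LP_eq, hpp]
  change _ ≤ ip d.B d.B at hB
  change p ^ 2 + _ ≤ d.NB at hB
  nlinarith [sq_nonneg (p - w / 2 - 3 * d.ph / 10), sq_nonneg (w - d.ph / 13), sq_nonneg d.ph]

theorem ph_le : d.ph ≤ n * d.JT := by
  unfold ph JT
  rw [Finset.mul_sum]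
  refine Finset.sum_le_sum fun m _ => ?_
  have h3 : (∑ i, d.T m i i) ^ 2 ≤ (n : ℝ) * ∑ i, d.T m i i ^ 2 := by
    have := sq_sum_le_card_mul_sum_sq (s := (Finset.univ : Finset (Fin n))) (f := fun i => d.T m i i)
    simpa using this
  have h4 : ∑ i, d.T m i i ^ 2 ≤ ip (d.T m) (d.T m) := by
    refine Finset.sum_le_sum fun i _ => ?_
    rw [sq]
    exact Finset.single_le_sum (f := fun j => d.T m i j * d.T m i j) (fun j _ => mul_self_nonneg _) (Finset.mem_univ i)
  have h5 : d.v m = ∑ i, d.T m i i := by rw [d.hv]; rfl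
  rw [h5, ← sq]
  exact h3.trans (mul_le_mul_of_nonneg_left h4 (Nat.cast_nonneg n))

theorem cubic_le (w : Fin n → ℝ) :
    (∑ i, ∑ j, ∑ k, d.T i j k * (w i * w j * w k)) ^ 2 ≤ d.JT * (∑ i, w i * w i) ^ 3 := by
  rw [s3_p]
  refine (Finset.sum_mul_sq_le_sq_mul_sq _ _ _).trans (le_of_eq ?_)
  have e1 : d.JT = ∑ p : Fin n × Fin n × Fin n, d.T p.1 p.2.1 p.2.2 ^ 2 := by
    rw [← s3_p fun i j k => d.T i j k ^ 2]
    exact c3 fun i j k => by ring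
  have e2 : (∑ i, w i * w i) ^ 3 = ∑ p : Fin n × Fin n × Fin n, (w p.1 * w p.2.1 * w p.2.2) ^ 2 := by
    rw [← s3_p fun i j k => (w i * w j * w k) ^ 2, pow_succ, sq, Finset.sum_mul_sum, Finset.sum_mul]
    simp only [Finset.sum_mul, Finset.mul_sum]
    exact c3 fun i j k => by ring
  rw [e1, e2]

theorem lin_le (w : Fin n → ℝ) :
    (∑ i, d.v i * w i) ^ 2 ≤ d.ph * (∑ i, w i * w i) := by
  refine (Finset.sum_mul_sq_le_sq_mul_sq _ _ _).trans (le_of_eq ?_)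
  simp only [sq]; rfl

end PD

noncomputable def FF {n : ℕ} (f : (Fin n → ℝ) → ℝ) (y : Fin n → ℝ) : ℝ := Real.log (Gm 1 f y).det

structure Good {n : ℕ} (Ω : Set (Fin n → ℝ)) (f : (Fin n → ℝ) → ℝ) : Prop where
  hn : n ≤ 5
  ho : IsOpen Ω
  hf : Sm Ω f
  hp : ∀ y ∈ Ω, (Gm 1 f y).PosDef
  hL : ∀ y ∈ Ω, LL 1 f (FF f) y = 0
  hc : CalabiComplete n Ω f

section dirs
variable {n : ℕ} {Ω : Set (Fin n → ℝ)} {f u : (Fin n → ℝ) → ℝ} {y : Fin n → ℝ}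
  {A : Matrix (Fin n) (Fin n) ℝ}

theorem dir_exists (hA : A.det ≠ 0) (w : Fin n → ℝ) : ∃ c : Fin n → ℝ, w = ∑ i, c i • fr A i := by
  refine ⟨A⁻¹ *ᵥ w, ?_⟩
  have h : A *ᵥ (A⁻¹ *ᵥ w) = w := by
    rw [Matrix.mulVec_mulVec, Matrix.mul_nonsing_inv _ (isUnit_iff_ne_zero.2 hA), Matrix.one_mulVec]
  conv_lhs => rw [← h]
  ext a
  simp only [Finset.sum_apply, Pi.smul_apply, smul_eq_mul, fr]
  rw [Matrix.mulVec]
  exact Finset.sum_congr rfl fun i _ => mul_comm _ _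

theorem dd1_dir (c : Fin n → ℝ) (z : Fin n → ℝ) :
    dd (∑ i, c i • fr A i) u z = ∑ i, c i * dd (fr A i) u z := dd_dir_sum c _

theorem dd2_dir (hΩ : IsOpen Ω) (hy : y ∈ Ω) (hu : Sm Ω u) (w : Fin n → ℝ) (c : Fin n → ℝ) :
    dd w (dd (∑ i, c i • fr A i) u) y = ∑ i, c i * dd w (dd (fr A i) u) y := by
  have : dd (∑ i, c i • fr A i) u = fun z => ∑ i, c i * dd (fr A i) u z := by
    ext z; exact dd1_dir c z
  rw [this, dd_sum hΩ hy fun i _ => (Sm.const _).mul (hu.dd hΩ)]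
  exact Finset.sum_congr rfl fun i _ => dd_cmul hΩ hy (hu.dd hΩ) _

theorem dd2_dir' (hΩ : IsOpen Ω) (hy : y ∈ Ω) (hu : Sm Ω u) (c c' : Fin n → ℝ) :
    dd (∑ i, c i • fr A i) (dd (∑ i, c' i • fr A i) u) y = ∑ i, ∑ j, c i * c' j * Gm A u y i j := by
  rw [dd1_dir]
  refine Finset.sum_congr rfl fun i _ => ?_
  rw [dd2_dir hΩ hy hu, Finset.mul_sum]
  exact Finset.sum_congr rfl fun j _ => by rw [Gm, Matrix.of_apply]; ring

theorem dd3_dir (hΩ : IsOpen Ω) (hy : y ∈ Ω) (hu : Sm Ω u) (c : Fin n → ℝ) (i j : Fin n) :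
    dd (fr A i) (dd (fr A j) (dd (∑ k, c k • fr A k) u)) y =
      ∑ k, c k * DM (fr A i) (Gm A u) y j k := by
  have : ∀ z ∈ Ω, dd (fr A j) (dd (∑ k, c k • fr A k) u) z = ∑ k, c k * dd (fr A j) (dd (fr A k) u) z :=
    fun z hz => dd2_dir hΩ hz hu _ _
  rw [dd_congr hΩ hy this, dd_sum hΩ hy fun i _ => (Sm.const _).mul ((hu.dd hΩ).dd hΩ)]
  exact Finset.sum_congr rfl fun k _ => dd_cmul hΩ hy ((hu.dd hΩ).dd hΩ) _

theorem dd3_dir' (hΩ : IsOpen Ω) (hy : y ∈ Ω) (hu : Sm Ω u) (c : Fin n → ℝ) :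
    dd (∑ k, c k • fr A k) (dd (∑ k, c k • fr A k) (dd (∑ k, c k • fr A k) u)) y =
      ∑ i, ∑ j, ∑ k, DM (fr A i) (Gm A u) y j k * (c i * c j * c k) := by
  rw [dd1_dir]
  refine Finset.sum_congr rfl fun i _ => ?_
  have hs := hu.dd hΩ (v := ∑ k, c k • fr A k)
  rw [dd2_dir hΩ hy hs, Finset.mul_sum]
  refine Finset.sum_congr rfl fun j _ => ?_
  rw [dd3_dir hΩ hy hu, Finset.mul_sum, Finset.mul_sum]
  exact Finset.sum_congr rfl fun k _ => by ring
end dirs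

noncomputable def psi {n : ℕ} (f : (Fin n → ℝ) → ℝ) (x y : Fin n → ℝ) : ℝ := dd (y - x) f y - f y + f x

section psi
variable {n : ℕ} {Ω : Set (Fin n → ℝ)} {f u : (Fin n → ℝ) → ℝ} {x y e : Fin n → ℝ}

theorem sub_fr (x y : Fin n → ℝ) : y - x = ∑ a, (y a - x a) • fr (1 : Matrix (Fin n) (Fin n) ℝ) a := by
  ext b
  simp [fr, Finset.sum_apply, Matrix.one_apply]

theorem psi_eq (f : (Fin n → ℝ) → ℝ) (x : Fin n → ℝ) : psi f x = fun y =>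
    (∑ a, (y a - x a) * dd (fr (1 : Matrix (Fin n) (Fin n) ℝ) a) f y) - f y + f x := by
  ext y
  rw [psi]
  conv_lhs => rw [sub_fr x y, dd1_dir]

theorem Sm_psi_aux (hΩ : IsOpen Ω) (hf : Sm Ω f) (w : (Fin n → ℝ) → ℝ) (hw : Sm Ω w) (x : Fin n → ℝ) (a : Fin n) :
    Sm Ω (fun y => (y a - x a) * w y) := ((Sm.coord a).sub (Sm.const _)).mul hw

theorem Sm_psi (hΩ : IsOpen Ω) (hf : Sm Ω f) (x : Fin n → ℝ) : Sm Ω (psi f x) := by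
  rw [psi_eq]
  exact ((Sm.sum fun a _ => Sm_psi_aux hΩ hf _ (hf.dd hΩ) x a).sub hf).add (Sm.const _)

theorem dd_psi_aux (hΩ : IsOpen Ω) (hy : y ∈ Ω) {w : (Fin n → ℝ) → ℝ} (hw : Sm Ω w) (a : Fin n) :
    dd e (fun y => (y a - x a) * w y) y = e a * w y + (y a - x a) * dd e w y := by
  rw [dd_mul hΩ hy ((Sm.coord a).sub (Sm.const _)) hw, dd_sub hΩ hy (Sm.coord a) (Sm.const _), dd_const, dd_coord]
  ring

theorem dd_psi (hΩ : IsOpen Ω) (hf : Sm Ω f) (hy : y ∈ Ω) :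
    dd e (psi f x) y = ∑ a, (y a - x a) * dd e (dd (fr 1 a) f) y := by
  have hS : ∀ a : Fin n, Sm Ω (fun y => (y a - x a) * dd (fr 1 a) f y) :=
    fun a => Sm_psi_aux hΩ hf _ (hf.dd hΩ) x a
  rw [psi_eq, dd_add hΩ hy ((Sm.sum fun a _ => hS a).sub hf) (Sm.const _), dd_const,
    dd_sub hΩ hy (Sm.sum fun a _ => hS a) hf, dd_sum hΩ hy fun a _ => hS a]
  simp only [dd_psi_aux hΩ hy (hf.dd hΩ), Finset.sum_add_distrib]
  have : ∑ a, e a * dd (fr (1 : Matrix (Fin n) (Fin n) ℝ) a) f y = dd e f y := by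
    rw [← dd1_dir]; congr 1; have := sub_fr 0 e; simp only [Pi.zero_apply, sub_zero] at this; exact this.symm
  rw [this]; ring

theorem dd_psi' (hΩ : IsOpen Ω) (hf : Sm Ω f) (hy : y ∈ Ω) :
    dd e (psi f x) y = dd e (dd (y - x) f) y := by
  rw [dd_psi hΩ hf hy, sub_fr x y, dd2_dir hΩ hy hf]

theorem dd2_psi (hΩ : IsOpen Ω) (hf : Sm Ω f) (hy : y ∈ Ω) :
    dd e (dd e (psi f x)) y = dd e (dd e f) y + ∑ a, (y a - x a) * dd e (dd e (dd (fr 1 a) f)) y := by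
  have hS : ∀ a : Fin n, Sm Ω (fun y => (y a - x a) * dd e (dd (fr 1 a) f) y) :=
    fun a => Sm_psi_aux hΩ hf _ ((hf.dd hΩ).dd hΩ) x a
  rw [dd_congr hΩ hy fun z hz => dd_psi hΩ hf hz, dd_sum hΩ hy fun a _ => hS a]
  simp only [dd_psi_aux hΩ hy ((hf.dd hΩ).dd hΩ), Finset.sum_add_distrib]
  congr 1
  rw [← dd2_dir hΩ hy hf]
  congr 2; have := sub_fr 0 e; simp only [Pi.zero_apply, sub_zero] at this; exact this.symm

theorem dd2_psi' (hΩ : IsOpen Ω) (hf : Sm Ω f) (hy : y ∈ Ω) :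
    dd e (dd e (psi f x)) y = dd e (dd e f) y + dd e (dd e (dd (y - x) f)) y := by
  rw [dd2_psi hΩ hf hy]
  congr 1
  have : ∀ z ∈ Ω, dd e (dd (y - x) f) z = ∑ a, (y a - x a) * dd e (dd (fr 1 a) f) z := by
    intro z hz
    conv_lhs => rw [sub_fr x y, dd2_dir hΩ hz hf]
  rw [dd_congr hΩ hy this, dd_sum hΩ hy fun i _ => (Sm.const _).mul ((hf.dd hΩ).dd hΩ)]
  exact Finset.sum_congr rfl fun k _ => (dd_cmul hΩ hy ((hf.dd hΩ).dd hΩ) _).symm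
end psi

namespace Good
variable {n : ℕ} {Ω : Set (Fin n → ℝ)} {f : (Fin n → ℝ) → ℝ} {y : Fin n → ℝ}

theorem det0 (h : Good Ω f) : ∀ y ∈ Ω, (Gm 1 f y).det ≠ 0 := fun y hy => (h.hp y hy).det_pos.ne'
theorem smF (h : Good Ω f) : Sm Ω (FF f) := (SmM_Gm h.ho h.hf).det.log h.det0
theorem smG (h : Good Ω f) : SmM Ω (Gm 1 f) := SmM_Gm h.ho h.hf
theorem smJ (h : Good Ω f) : Sm Ω (JJ 1 f) :=
  SmM.trace (((h.smG).inv h.det0).mul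
    (fun i j => ((SmM_XX h.ho h.hf h.det0 i).mul (SmM_XX h.ho h.hf h.det0 j)).trace))
theorem smN (h : Good Ω f) : Sm Ω (NN 1 f (FF f)) :=
  SmM.trace ((((h.smG).inv h.det0).mul (SmM_Gm h.ho h.smF)).mul (((h.smG).inv h.det0).mul (SmM_Gm h.ho h.smF)))
theorem smP (h : Good Ω f) : Sm Ω (PP 1 f (FF f)) :=
  SmM.trace (((h.smG).inv h.det0).mul (fun i j => (h.smF.dd h.ho).mul (h.smF.dd h.ho)))

theorem frame (h : Good Ω f) (hy : y ∈ Ω) : ∃ (A : Matrix (Fin n) (Fin n) ℝ) (d : PD n),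
    A.det ≠ 0 ∧ Gm A f y = 1 ∧ (∀ i, DM (fr A i) (Gm A f) y = d.T i) ∧
    (∀ i, dd (fr A i) (FF f) y = d.v i) ∧
    JJ 1 f y = d.JT ∧ NN 1 f (FF f) y = d.NB ∧ PP 1 f (FF f) y = d.ph ∧
    (∀ m, dd (fr A m) (PP 1 f (FF f)) y = d.P1 m) ∧
    (∀ u, Sm Ω u → LL 1 f u y = ∑ m, dd (fr A m) (dd (fr A m) u) y) ∧
    LL 1 f (JJ 1 f) y = ∑ m, d.J2 m ∧ LL 1 f (NN 1 f (FF f)) y = ∑ m, d.N2 m ∧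
    LL 1 f (PP 1 f (FF f)) y = ∑ m, d.P2 m := by
  obtain ⟨A, hA, hA1⟩ := exists_frame (h.hp y hy)
  have hG1 : Gm A f y = 1 := by rw [Gm_fr h.ho h.hf hy, hA1]
  have hd : ∀ z ∈ Ω, (Gm A f z).det ≠ 0 := by
    intro z hz
    rw [Gm_fr h.ho h.hf hz, Matrix.det_mul, Matrix.det_mul, Matrix.det_transpose]
    exact mul_ne_zero (mul_ne_zero hA (h.det0 z hz)) hA
  have hFv : ∀ k, ∀ z ∈ Ω, dd (fr A k) (FF f) z = (XX A f k z).trace := by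
    intro k z hz
    rw [XX_fr h.ho h.hf hz hA, conj_trace hA, dd_fr, Matrix.trace_sum]
    refine Finset.sum_congr rfl fun a _ => ?_
    rw [Matrix.trace_smul, smul_eq_mul]
    congr 1
    exact dd_logdet h.ho hz h.smG (h.det0 z hz)
  have hLL : ∀ z ∈ Ω, LL A f (FF f) z = 0 := fun z hz => by
    rw [LL_fr h.ho h.hf h.smF hz hA, h.hL z hz]
  have sp := mkPD_spec h.ho hy h.hf h.smF hd hG1 hFv hLL _ rfl
  set d := mkPD h.ho hy h.hf h.smF hd hG1 hFv hLL with hdd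
  obtain ⟨s1, s2, s3, s4, s5, s6, s7, s8⟩ := sp
  have hJ : ∀ z ∈ Ω, JJ 1 f z = JJ A f z := fun z hz => (JJ_fr h.ho h.hf hz hA).symm
  have hN : ∀ z ∈ Ω, NN 1 f (FF f) z = NN A f (FF f) z := fun z hz => (NN_fr h.ho h.hf h.smF hz hA).symm
  have hP : ∀ z ∈ Ω, PP 1 f (FF f) z = PP A f (FF f) z := fun z hz => (PP_fr h.ho h.hf hz hA).symm
  have hLs : ∀ u, Sm Ω u → LL 1 f u y = ∑ m, dd (fr A m) (dd (fr A m) u) y := by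
    intro u hu
    rw [← LL_fr h.ho h.hf hu hy hA, LL, hG1, inv_one, Matrix.one_mul]
    rfl
  refine ⟨A, d, hA, hG1, fun i => rfl, s1, ?_, ?_, ?_, ?_, hLs, ?_, ?_, ?_⟩
  · rw [hJ y hy, s2, PD.JT_eq]
  · rw [hN y hy, s3, PD.NB_eq]
  · rw [hP y hy, s4, PD.W0_tr]
  · intro m; rw [dd_congr h.ho hy hP, s5]
  · rw [hLs _ h.smJ]; exact Finset.sum_congr rfl fun m _ => by rw [dd2_congr h.ho hy hJ, s6]
  · rw [hLs _ h.smN]; exact Finset.sum_congr rfl fun m _ => by rw [dd2_congr h.ho hy hN, s7]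
  · rw [hLs _ h.smP]; exact Finset.sum_congr rfl fun m _ => by rw [dd2_congr h.ho hy hP, s8]

theorem J_nonneg (h : Good Ω f) (hy : y ∈ Ω) : 0 ≤ JJ 1 f y := by
  obtain ⟨A, d, _, _, _, _, hJ, _⟩ := h.frame hy
  rw [hJ]; exact d.JT_nonneg
theorem N_nonneg (h : Good Ω f) (hy : y ∈ Ω) : 0 ≤ NN 1 f (FF f) y := by
  obtain ⟨A, d, _, _, _, _, _, hN, _⟩ := h.frame hy
  rw [hN]; exact d.NB_nonneg
theorem P_nonneg (h : Good Ω f) (hy : y ∈ Ω) : 0 ≤ PP 1 f (FF f) y := by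
  obtain ⟨A, d, _, _, _, _, _, _, hP, _⟩ := h.frame hy
  rw [hP]; exact Finset.sum_nonneg fun i _ => mul_self_nonneg _
theorem P_le (h : Good Ω f) (hy : y ∈ Ω) : PP 1 f (FF f) y ≤ 5 * JJ 1 f y := by
  obtain ⟨A, d, _, _, _, _, hJ, _, hP, _⟩ := h.frame hy
  rw [hP, hJ]
  have : (n : ℝ) ≤ 5 := by exact_mod_cast h.hn
  exact d.ph_le.trans (mul_le_mul_of_nonneg_right this d.JT_nonneg)

theorem ineq2 (h : Good Ω f) (hy : y ∈ Ω) :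
    NN 1 f (FF f) y / 2 - PP 1 f (FF f) y ^ 2 / 2 ≤ LL 1 f (PP 1 f (FF f)) y := by
  obtain ⟨A, d, _, _, _, _, hJ, hN, hP, _, _, _, _, hLP⟩ := h.frame hy
  rw [hN, hP, hLP]; exact d.I2

theorem ineq3 (h : Good Ω f) (hy : y ∈ Ω) {μ : ℝ} (hμ : 0 < μ) :
    μ * JJ 1 f y ^ 2 / 40 - μ ^ 2 * JJ 1 f y - (4 * JJ 1 f y + 18 * μ + 1 + (18 / μ + 1) * NN 1 f (FF f) y)
      * NN 1 f (FF f) y ≤ μ * LL 1 f (JJ 1 f) y + LL 1 f (NN 1 f (FF f)) y := by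
  obtain ⟨A, d, _, _, _, _, hJ, hN, hP, _, _, hLJ, hLN, _⟩ := h.frame hy
  rw [hN, hJ, hLJ, hLN]; exact d.I3 h.hn hμ

theorem sum_one (c c' : Fin n → ℝ) : ∑ i, ∑ j, c i * c' j * (1 : Matrix (Fin n) (Fin n) ℝ) i j = ∑ i, c i * c' i := by
  simp [Matrix.one_apply]

/-- speed squared is positive -/
theorem q_nonneg (h : Good Ω f) (hy : y ∈ Ω) (w : Fin n → ℝ) : 0 ≤ dd w (dd w f) y := by
  obtain ⟨A, d, hA, h1, _⟩ := h.frame hy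
  obtain ⟨c, rfl⟩ := dir_exists hA w
  rw [dd2_dir' h.ho hy h.hf, h1, sum_one]
  exact Finset.sum_nonneg fun i _ => mul_self_nonneg _

theorem q_pos (h : Good Ω f) (hy : y ∈ Ω) {w : Fin n → ℝ} (hw : w ≠ 0) : 0 < dd w (dd w f) y := by
  refine lt_of_le_of_ne (h.q_nonneg hy w) fun h0 => hw ?_
  obtain ⟨A, d, hA, h1, _⟩ := h.frame hy
  obtain ⟨c, rfl⟩ := dir_exists hA w
  rw [dd2_dir' h.ho hy h.hf, h1, sum_one, eq_comm, Finset.sum_eq_zero_iff_of_nonneg (fun i _ => mul_self_nonneg _)] at h0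
  exact Finset.sum_eq_zero fun i hi => by rw [mul_self_eq_zero.1 (h0 i hi), zero_smul]

theorem cubic (h : Good Ω f) (hy : y ∈ Ω) (w : Fin n → ℝ) :
    (dd w (dd w (dd w f)) y) ^ 2 ≤ JJ 1 f y * (dd w (dd w f) y) ^ 3 := by
  obtain ⟨A, d, hA, h1, hT, _, hJ, _⟩ := h.frame hy
  obtain ⟨c, rfl⟩ := dir_exists hA w
  rw [dd2_dir' h.ho hy h.hf, h1, sum_one, dd3_dir' h.ho hy h.hf, hJ]
  simp only [hT]
  exact d.cubic_le c

theorem lin (h : Good Ω f) (hy : y ∈ Ω) (w : Fin n → ℝ) :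
    (dd w (FF f) y) ^ 2 ≤ PP 1 f (FF f) y * dd w (dd w f) y := by
  obtain ⟨A, d, hA, h1, _, hv, _, _, hP, _⟩ := h.frame hy
  obtain ⟨c, rfl⟩ := dir_exists hA w
  rw [dd2_dir' h.ho hy h.hf, h1, sum_one, dd1_dir, hP]
  simp only [hv]
  rw [Finset.sum_congr rfl fun i _ => mul_comm (c i) (d.v i)]
  exact d.lin_le c
theorem Lpsi (h : Good Ω f) (hy : y ∈ Ω) (x : Fin n → ℝ) :
    LL 1 f (psi f x) y = n + dd (y - x) (FF f) y := by
  obtain ⟨A, d, hA, h1, hT, hv, hJ, hN, hP, _, hLs, _⟩ := h.frame hy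
  rw [hLs _ (Sm_psi h.ho h.hf x)]
  obtain ⟨c, hc⟩ := dir_exists hA (y - x)
  simp only [dd2_psi' h.ho h.hf hy, Finset.sum_add_distrib]
  congr 1
  · have : ∀ m, dd (fr A m) (dd (fr A m) f) y = Gm A f y m m := fun m => rfl
    simp [this, h1]
  · rw [hc, dd1_dir]
    simp only [dd3_dir h.ho hy h.hf, hT, hv, d.hv]
    rw [Finset.sum_comm]
    refine Finset.sum_congr rfl fun i _ => ?_
    rw [Matrix.trace, Finset.mul_sum]
    exact Finset.sum_congr rfl fun m _ => by rw [d.T2 m m i, d.T1 m i m]; rfl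

/-- consequences at an interior maximum of `u - a log(1+ψ)` -/
theorem at_max (h : Good Ω f) (hy : y ∈ Ω) {x : Fin n → ℝ} {u : (Fin n → ℝ) → ℝ} (hu : Sm Ω u) {a : ℝ} (ha : 0 ≤ a)
    (hpsi : 0 ≤ psi f x y)
    (hmax : IsLocalMax (fun z => u z - a * Real.log (1 + psi f x z)) y) :
    (∀ w, dd w u y = a / (1 + psi f x y) * dd w (dd (y - x) f) y) ∧
    LL 1 f u y ≤ a / (1 + psi f x y) * (n + dd (y - x) (FF f) y) := by
  -- restrict to the open set where 1 + ψ > 0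
  have hs := Sm_psi h.ho h.hf x
  set Ω' := Ω ∩ {z | 0 < 1 + psi f x z}
  have hΩ' : IsOpen Ω' := by
    have hc : ContinuousOn (fun z => 1 + psi f x z) Ω := (continuousOn_const.add (ContDiffOn.continuousOn hs))
    exact hc.isOpen_inter_preimage h.ho isOpen_Ioi
  have hy' : y ∈ Ω' := ⟨hy, by simp only [Set.mem_ofPred_eq]; linarith⟩
  have hs' : Sm Ω' (psi f x) := hs.mono inter_subset_left
  have hu' : Sm Ω' u := hu.mono inter_subset_left
  have h1s : Sm Ω' (fun z => 1 + psi f x z) := (Sm.const _).add hs'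
  have hne : ∀ z ∈ Ω', 1 + psi f x z ≠ 0 := fun z hz => (ne_of_gt hz.2)
  have hth : Sm Ω' (fun z => Real.log (1 + psi f x z)) := h1s.log hne
  have hth1 : ∀ v, ∀ z ∈ Ω', dd v (fun z => Real.log (1 + psi f x z)) z = (1 + psi f x z)⁻¹ * dd v (psi f x) z := by
    intro v z hz
    rw [dd_log hΩ' hz h1s (hne z hz), dd_add hΩ' hz (Sm.const _) hs', dd_const]
    ring
  have key := fun v => dd_max (v := v) hΩ' (hu'.sub ((Sm.const a).mul hth)) hy' hmax
  have hD1 : ∀ v, ∀ z ∈ Ω', dd v (fun z => u z - a * Real.log (1 + psi f x z)) z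
      = dd v u z - a * ((1 + psi f x z)⁻¹ * dd v (psi f x) z) := by
    intro v z hz
    rw [dd_sub hΩ' hz hu' ((Sm.const a).mul hth), dd_cmul hΩ' hz hth, hth1 v z hz]
  refine ⟨fun w => ?_, ?_⟩
  · have := (key w).1
    rw [hD1 w y hy', dd_psi' h.ho h.hf hy] at this
    rw [div_eq_mul_inv]; linarith
  · obtain ⟨A, d, hA, h1, hT, hv, hJ, hN, hP, _, hLs, _⟩ := h.frame hy
    rw [← h.Lpsi hy, hLs _ hu, hLs _ hs, Finset.mul_sum]
    refine Finset.sum_le_sum fun m _ => ?_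
    have k2 := (key (fr A m)).2
    have hps1 : Sm Ω' (dd (fr A m) (psi f x)) := hs'.dd hΩ'
    rw [dd_congr hΩ' hy' (hD1 (fr A m)), dd_sub hΩ' hy' (hu'.dd hΩ') ((Sm.const a).mul ((h1s.inv hne).mul hps1)),
      dd_cmul hΩ' hy' ((h1s.inv hne).mul hps1), dd_mul hΩ' hy' (h1s.inv hne) hps1] at k2
    have hinv : dd (fr A m) (fun z => (1 + psi f x z)⁻¹) y = - ((1 + psi f x y)⁻¹) ^ 2 * dd (fr A m) (psi f x) y := by
      have e1 : dd (fr A m) (fun z => (1 + psi f x z) * (1 + psi f x z)⁻¹) y = 0 := by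
        rw [dd_congr hΩ' hy' (w := fun _ => (1:ℝ)) fun z hz => mul_inv_cancel₀ (hne z hz), dd_const]
      rw [dd_mul hΩ' hy' h1s (h1s.inv hne), dd_add hΩ' hy' (Sm.const _) hs', dd_const] at e1
      have h0 := hne y hy'
      field_simp at e1 ⊢
      linarith
    rw [hinv] at k2
    rw [div_eq_mul_inv]
    nlinarith [mul_nonneg ha (sq_nonneg ((1 + psi f x y)⁻¹ * dd (fr A m) (psi f x) y))]

theorem ineq1 (h : Good Ω f) (hy : y ∈ Ω) {x : Fin n → ℝ} (hp : 0 < PP 1 f (FF f) y) {b : ℝ}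
    (hc : ∀ w, dd w (PP 1 f (FF f)) y = b * dd w (dd (y - x) f) y) :
    PP 1 f (FF f) y ^ 2 / 80 - (b * dd (y - x) (FF f) y / PP 1 f (FF f) y) ^ 2 ≤ LL 1 f (PP 1 f (FF f)) y := by
  obtain ⟨A, d, hA, h1, hT, hv, hJ, hN, hP, hP1, hLs, _, _, hLP⟩ := h.frame hy
  obtain ⟨c, hcc⟩ := dir_exists hA (y - x)
  have h2 : ∀ m, d.P1 m = b * c m := by
    intro m
    rw [← hP1, hc, hcc, dd2_dir h.ho hy h.hf]
    congr 1
    have : ∀ i, dd (fr A m) (dd (fr A i) f) y = Gm A f y m i := fun m => rfl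
    simp [this, h1, Matrix.one_apply]
  rw [hP] at hp
  rw [hP, hLP]
  refine d.I1 h.hn hp ?_
  rw [div_mul_cancel₀ _ hp.ne', hcc, dd1_dir, Finset.mul_sum]
  exact Finset.sum_congr rfl fun m _ => by rw [h2, hv]; ring
end Good

section ray1d

theorem ray1 {q q' P : ℝ → ℝ} (hq : ∀ t ∈ Icc (0:ℝ) 1, 0 < q t)
    (hd : ∀ t ∈ Icc (0:ℝ) 1, HasDerivAt q (q' t) t)
    (hq' : ∀ t ∈ Icc (0:ℝ) 1, q' t ^ 2 ≤ 2 * q t ^ 3)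
    (hP : ∀ t ∈ Icc (0:ℝ) 1, HasDerivAt P (t * q t) t) (hP0 : P 0 = 0) :
    √(q 1) ≤ 1 / 2 + 2 * P 1 ∧ ∀ t ∈ Icc (0:ℝ) 1, √(q t) ≤ (1 / 2 + 2 * P 1) * Real.exp (1 / 2 + 3 * P 1) := by
  set s : ℝ → ℝ := fun t => √(q t) with hs
  have hs0 : ∀ t ∈ Icc (0:ℝ) 1, 0 < s t := fun t ht => Real.sqrt_pos.2 (hq t ht)
  have hs2 : ∀ t ∈ Icc (0:ℝ) 1, s t ^ 2 = q t := fun t ht => Real.sq_sqrt (hq t ht).le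
  have hsd : ∀ t ∈ Icc (0:ℝ) 1, HasDerivAt s (q' t / (2 * s t)) t := fun t ht =>
    (hd t ht).sqrt (hq t ht).ne'
  have hsb : ∀ t ∈ Icc (0:ℝ) 1, |q' t / (2 * s t)| ≤ s t ^ 2 := by
    intro t ht
    have h0 := hs0 t ht
    have h1 : |q' t| ≤ 2 * s t ^ 3 := by
      refine abs_le_of_sq_le_sq ?_ (by positivity)
      have := hq' t ht
      rw [← hs2 t ht] at this
      nlinarith [pow_pos h0 6]
    rw [abs_div, abs_of_pos (by positivity : 0 < 2 * s t), div_le_iff₀ (by positivity)]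
    nlinarith
  have hint : interior (Icc (0:ℝ) 1) ⊆ Icc 0 1 := interior_subset
  -- P is nonneg and monotone
  have hPm : MonotoneOn P (Icc (0:ℝ) 1) := by
    refine monotoneOn_of_hasDerivWithinAt_nonneg (f' := fun t => t * q t) (convex_Icc 0 1)
      (fun t ht => (hP t ht).continuousAt.continuousWithinAt)
      (fun t ht => (hP t (hint ht)).hasDerivWithinAt) (fun t ht => ?_)
    exact mul_nonneg (hint ht).1 (hq t (hint ht)).le
  have m0 : (0:ℝ) ∈ Icc (0:ℝ) 1 := by simp
  have m1 : (1:ℝ) ∈ Icc (0:ℝ) 1 := by simp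
  have hPn : ∀ t ∈ Icc (0:ℝ) 1, 0 ≤ P t := fun t ht => hP0 ▸ hPm m0 ht ht.1
  have c1 : s 1 ≤ 1 / 2 + 2 * P 1 := by
    have hm : MonotoneOn (fun t => t ^ 2 / 2 + 2 * P t - t ^ 2 * s t) (Icc (0:ℝ) 1) := by
      have hdd : ∀ t ∈ Icc (0:ℝ) 1, HasDerivAt (fun t => t ^ 2 / 2 + 2 * P t - t ^ 2 * s t)
          (t + 2 * (t * q t) - (2 * t * s t + t ^ 2 * (q' t / (2 * s t)))) t := by
        intro t ht
        have hp : HasDerivAt (fun t : ℝ => t ^ 2) (2 * t) t := by simpa using hasDerivAt_pow 2 t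
        have := ((hp.div_const 2).add ((hP t ht).const_mul 2)).sub (hp.mul (hsd t ht))
        refine this.congr_deriv ?_
        ring
      refine monotoneOn_of_hasDerivWithinAt_nonneg (convex_Icc 0 1)
        (fun t ht => (hdd t ht).continuousAt.continuousWithinAt)
        (fun t ht => (hdd t (hint ht)).hasDerivWithinAt) (fun t ht => ?_)
      have ht' := hint ht
      have h1 := (abs_le.1 (hsb t ht')).2
      rw [← hs2 t ht']
      have h2 : t ^ 2 * (q' t / (2 * s t)) ≤ t * s t ^ 2 := by
        calc _ ≤ t ^ 2 * s t ^ 2 := mul_le_mul_of_nonneg_left h1 (sq_nonneg t)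
          _ ≤ t * s t ^ 2 := mul_le_mul_of_nonneg_right (by nlinarith [ht'.1, ht'.2]) (sq_nonneg _)
      nlinarith [mul_nonneg ht'.1 (sq_nonneg (s t - 1))]
    have := hm m0 m1 zero_le_one
    simp only [hP0] at this
    norm_num at this
    linarith
  refine ⟨c1, fun t ht => ?_⟩
  have hk : MonotoneOn (fun t => Real.log (s t) + t * s t + P t) (Icc (0:ℝ) 1) := by
    have hdd : ∀ t ∈ Icc (0:ℝ) 1, HasDerivAt (fun t => Real.log (s t) + t * s t + P t)
        ((q' t / (2 * s t)) / s t + (1 * s t + t * (q' t / (2 * s t))) + t * q t) t := by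
      intro t ht
      exact (((hsd t ht).log (hs0 t ht).ne').add ((hasDerivAt_id t).mul (hsd t ht))).add (hP t ht)
    refine monotoneOn_of_hasDerivWithinAt_nonneg (convex_Icc 0 1)
      (fun t ht => (hdd t ht).continuousAt.continuousWithinAt)
      (fun t ht => (hdd t (hint ht)).hasDerivWithinAt) (fun t ht => ?_)
    have ht' := hint ht
    have h0 := hs0 t ht'
    have h1 := (abs_le.1 (hsb t ht')).1
    rw [← hs2 t ht']
    have h2 : - s t ≤ (q' t / (2 * s t)) / s t := by
      rw [le_div_iff₀ h0]; nlinarith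
    have h3 : - (t * s t ^ 2) ≤ t * (q' t / (2 * s t)) := by
      have := mul_le_mul_of_nonneg_left h1 ht'.1
      linarith
    linarith
  have h1 := hk ht m1 ht.2
  simp only [one_mul] at h1
  have h0 := hs0 t ht
  have h01 := hs0 1 m1
  have h2 : Real.log (s t) ≤ Real.log (s 1) + (1 / 2 + 3 * P 1) := by
    have := mul_nonneg ht.1 h0.le
    have := hPn t ht
    linarith
  have h3 : s t ≤ s 1 * Real.exp (1 / 2 + 3 * P 1) := by
    have := Real.exp_le_exp.2 h2
    rwa [Real.exp_add, Real.exp_log h0, Real.exp_log h01] at this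
  exact h3.trans (mul_le_mul_of_nonneg_right c1 (Real.exp_pos _).le)
end ray1d

noncomputable def CC (ρ : ℝ) : ℝ := (1 / 2 + 2 * ρ) * Real.exp (1 / 2 + 3 * ρ)

theorem CC_mono {a b : ℝ} (h0 : 0 ≤ a) (h : a ≤ b) : CC a ≤ CC b := by
  unfold CC
  gcongr
  linarith

def Seg {n : ℕ} (Ω : Set (Fin n → ℝ)) (x y : Fin n → ℝ) : Prop := ∀ t ∈ Icc (0:ℝ) 1, x + t • (y - x) ∈ Ω

def WW {n : ℕ} (Ω : Set (Fin n → ℝ)) (f : (Fin n → ℝ) → ℝ) (x : Fin n → ℝ) (ρ : ℝ) : Set (Fin n → ℝ) :=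
  {y | Seg Ω x y ∧ psi f x y ≤ ρ}

theorem Seg.right {n : ℕ} {Ω : Set (Fin n → ℝ)} {x y : Fin n → ℝ} (h : Seg Ω x y) : y ∈ Ω := by
  simpa using h 1 (by simp)

theorem Seg.sub {n : ℕ} {Ω : Set (Fin n → ℝ)} {x y : Fin n → ℝ} (h : Seg Ω x y) {t : ℝ} (ht : t ∈ Icc (0:ℝ) 1) :
    Seg Ω x (x + t • (y - x)) := by
  intro r hr
  have := h (r * t) ⟨mul_nonneg hr.1 ht.1, mul_le_one₀ hr.2 ht.1 ht.2⟩
  rwa [add_sub_cancel_left, smul_smul]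

theorem dd2_smul {n : ℕ} {f : (Fin n → ℝ) → ℝ} (c : ℝ) (w y : Fin n → ℝ) :
    dd (c • w) (dd (c • w) f) y = c ^ 2 * dd w (dd w f) y := by
  have : dd (c • w) f = fun z => c * dd w f z := by ext z; exact dd_smul c
  rw [this, dd_smul]
  unfold dd
  rw [show (fun z => c * (fderiv ℝ f z) w) = c • (fun z => (fderiv ℝ f z) w) from rfl, fderiv_const_smul_field]
  simp; ring

namespace Good
variable {n : ℕ} {Ω : Set (Fin n → ℝ)} {f : (Fin n → ℝ) → ℝ} {x y : Fin n → ℝ}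

theorem P_deriv (h : Good Ω f) {v : Fin n → ℝ} {t : ℝ} (ht : x + t • v ∈ Ω) :
    HasDerivAt (fun r : ℝ => psi f x (x + r • v)) (t * dd v (dd v f) (x + t • v)) t := by
  have h1 := dd_line h.ho (Sm_psi h.ho h.hf x) ht
  rw [dd_psi' h.ho h.hf ht, add_sub_cancel_left] at h1
  have : dd v (dd (t • v) f) (x + t • v) = t * dd v (dd v f) (x + t • v) := by
    have : dd (t • v) f = fun z => t * dd v f z := by ext z; exact dd_smul t
    rw [this, dd_cmul h.ho ht (h.hf.dd h.ho)]
  rwa [this] at h1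

theorem psi_self : psi f x x = 0 := by simp [psi, dd]

theorem psi_mono (h : Good Ω f) (hs : Seg Ω x y) :
    MonotoneOn (fun r : ℝ => psi f x (x + r • (y - x))) (Icc (0:ℝ) 1) := by
  refine monotoneOn_of_hasDerivWithinAt_nonneg (convex_Icc 0 1)
    (fun t ht => (h.P_deriv (hs t ht)).continuousAt.continuousWithinAt)
    (fun t ht => (h.P_deriv (hs t (interior_subset ht))).hasDerivWithinAt) (fun t ht => ?_)
  exact mul_nonneg (interior_subset ht).1 (h.q_nonneg (hs t (interior_subset ht)) _)

theorem psi_nonneg (h : Good Ω f) (hs : Seg Ω x y) : 0 ≤ psi f x y := by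
  have := h.psi_mono hs (by simp : (0:ℝ) ∈ Icc (0:ℝ) 1) (by simp : (1:ℝ) ∈ Icc (0:ℝ) 1) zero_le_one
  simpa [psi_self] using this

theorem psi_le (h : Good Ω f) (hs : Seg Ω x y) {t : ℝ} (ht : t ∈ Icc (0:ℝ) 1) :
    psi f x (x + t • (y - x)) ≤ psi f x y := by
  have := h.psi_mono hs ht (by simp : (1:ℝ) ∈ Icc (0:ℝ) 1) ht.2
  simpa using this

theorem W_star (h : Good Ω f) {ρ : ℝ} (hy : y ∈ WW Ω f x ρ) {t : ℝ} (ht : t ∈ Icc (0:ℝ) 1) :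
    x + t • (y - x) ∈ WW Ω f x ρ := ⟨hy.1.sub ht, (h.psi_le hy.1 ht).trans hy.2⟩

theorem seg_speed (h : Good Ω f) (hs : Seg Ω x y) (hJ : ∀ t ∈ Icc (0:ℝ) 1, JJ 1 f (x + t • (y - x)) ≤ 2) :
    √(dd (y - x) (dd (y - x) f) y) ≤ 1 / 2 + 2 * psi f x y ∧
    ∀ t ∈ Icc (0:ℝ) 1, √(dd (y - x) (dd (y - x) f) (x + t • (y - x))) ≤ CC (psi f x y) := by
  have hp := h.psi_nonneg hs
  by_cases hv : y - x = 0
  · have : ∀ z, dd (y - x) (dd (y - x) f) z = 0 := by intro z; rw [hv]; simp [dd]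
    simp only [this, Real.sqrt_zero]
    refine ⟨by linarith, fun _ _ => ?_⟩
    unfold CC; positivity
  have key := ray1 (q := fun t => dd (y - x) (dd (y - x) f) (x + t • (y - x)))
    (q' := fun t => dd (y - x) (dd (y - x) (dd (y - x) f)) (x + t • (y - x)))
    (P := fun t => psi f x (x + t • (y - x)))
    (fun t ht => h.q_pos (hs t ht) hv)
    (fun t ht => dd_line h.ho ((h.hf.dd h.ho).dd h.ho) (hs t ht))
    (fun t ht => (h.cubic (hs t ht) _).trans
      (mul_le_mul_of_nonneg_right (hJ t ht) (pow_nonneg (h.q_nonneg (hs t ht) _) 3)))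
    (fun t ht => h.P_deriv (hs t ht)) (by simp [psi_self])
  simpa [CC] using key

theorem quad_eq (h : Good Ω f) (hy : y ∈ Ω) (w : Fin n → ℝ) :
    (Hess n f y).mulVec w ⬝ᵥ w = dd w (dd w f) y := by
  have hw : w = ∑ i, w i • fr (1 : Matrix (Fin n) (Fin n) ℝ) i := by
    have := sub_fr 0 w; simpa using this
  conv_rhs => rw [hw, dd2_dir' h.ho hy h.hf]
  rw [Hess_eq]
  simp only [Matrix.mulVec, dotProduct, Finset.sum_mul]
  exact c2 fun i j => by ring

theorem not_exit (h : Good Ω f) {v : Fin n → ℝ} (hs : ∀ t ∈ Ico (0:ℝ) 1, x + t • v ∈ Ω) {C : ℝ}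
    (hC : ∀ t ∈ Ico (0:ℝ) 1, √(dd v (dd v f) (x + t • v)) ≤ C) : x + v ∈ Ω := by
  by_contra hv
  have hcd : ContDiff ℝ 1 (fun t : ℝ => x + t • v) := by fun_prop
  have hder : ∀ t : ℝ, deriv (fun t : ℝ => x + t • v) t = v := by
    intro t
    have : HasDerivAt (fun t : ℝ => x + t • v) v t := by
      simpa using ((hasDerivAt_id t).smul_const v).const_add x
    exact this.deriv
  have key := h.hc (fun t => x + t • v) hcd.contDiffOn hs (by
    intro K hK hKc
    have hmem : Kᶜ ∈ 𝓝 (x + (1:ℝ) • v) := hKc.isClosed.isOpen_compl.mem_nhds (by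
      rw [one_smul]; exact fun hh => hv (hK hh))
    have := hcd.continuous.continuousAt.preimage_mem_nhds hmem
    rw [Metric.mem_nhds_iff] at this
    obtain ⟨ε, hε, hb⟩ := this
    refine ⟨1 - ε, by linarith, fun t h1 h2 => ?_⟩
    exact hb (by rw [Metric.mem_ball, Real.dist_eq, abs_lt]; constructor <;> linarith))
  have hlt : ∫⁻ t in Set.Ioo (0 : ℝ) 1,
      ENNReal.ofReal (Real.sqrt ((Hess n f (x + t • v)).mulVec (deriv (fun t : ℝ => x + t • v) t) ⬝ᵥ
        deriv (fun t : ℝ => x + t • v) t)) ≤ ∫⁻ t in Set.Ioo (0 : ℝ) 1, ENNReal.ofReal C := by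
    refine MeasureTheory.setLIntegral_mono' measurableSet_Ioo fun t ht => ENNReal.ofReal_le_ofReal ?_
    rw [hder, h.quad_eq (hs t ⟨ht.1.le, ht.2⟩)]
    exact hC t ⟨ht.1.le, ht.2⟩
  rw [key] at hlt
  simp at hlt

theorem ray_in (h : Good Ω f) (hx : x ∈ Ω) {v : Fin n → ℝ}
    (hv : ∀ T ∈ Ioc (0:ℝ) 1, (∀ r ∈ Ico (0:ℝ) T, x + r • v ∈ Ω) →
      ∃ C, ∀ r ∈ Ico (0:ℝ) T, √(dd v (dd v f) (x + r • v)) ≤ C) :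
    ∀ t ∈ Icc (0:ℝ) 1, x + t • v ∈ Ω := by
  by_contra hcon
  push Not at hcon
  obtain ⟨t1, ht1, ht1'⟩ := hcon
  have hcont : Continuous (fun t : ℝ => x + t • v) := by fun_prop
  have hclosed : IsCompact (Icc (0:ℝ) 1 ∩ (fun t : ℝ => x + t • v) ⁻¹' Ωᶜ) :=
    isCompact_Icc.inter_right (h.ho.isClosed_compl.preimage hcont)
  obtain ⟨T, ⟨hT, hTn⟩, hmin⟩ := hclosed.exists_isLeast ⟨t1, ht1, ht1'⟩
  have hT0 : 0 < T := by
    rcases hT.1.eq_or_lt with h0 | h0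
    · exfalso; apply hTn; rw [← h0]; simpa using hx
    · exact h0
  have hr : ∀ r ∈ Ico (0:ℝ) T, x + r • v ∈ Ω := by
    intro r hr
    by_contra hn
    exact absurd (hmin ⟨⟨hr.1, hr.2.le.trans hT.2⟩, hn⟩) (not_le.2 hr.2)
  obtain ⟨C, hC⟩ := hv T ⟨hT0, hT.2⟩ hr
  apply hTn
  have hm : ∀ t ∈ Ico (0:ℝ) 1, t * T ∈ Ico (0:ℝ) T := fun t ht =>
    ⟨mul_nonneg ht.1 hT0.le, by nlinarith [ht.2]⟩
  refine h.not_exit (v := T • v) (C := T * C) (fun t ht => ?_) (fun t ht => ?_)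
  · rw [smul_smul]; exact hr _ (hm t ht)
  · rw [smul_smul, dd2_smul, Real.sqrt_mul (sq_nonneg T), Real.sqrt_sq hT0.le]
    exact mul_le_mul_of_nonneg_left (hC _ (hm t ht)) hT0.le

theorem psi_cont (h : Good Ω f) (x : Fin n → ℝ) {y : Fin n → ℝ} (hy : y ∈ Ω) : ContinuousAt (psi f x) y :=
  ((Sm_psi h.ho h.hf x).da h.ho hy).continuousAt

theorem W_closed (h : Good Ω f) (hx : x ∈ Ω) {ρ : ℝ}
    (hJ : ∀ y ∈ WW Ω f x ρ, JJ 1 f y ≤ 2) : IsClosed (WW Ω f x ρ) := by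
  rw [← isSeqClosed_iff_isClosed]
  intro Y y hY hlim
  have hlimr : ∀ r : ℝ, Tendsto (fun k => x + r • (Y k - x)) atTop (𝓝 (x + r • (y - x))) := fun r =>
    tendsto_const_nhds.add ((hlim.sub tendsto_const_nhds).const_smul r)
  have hpl : ∀ r ∈ Icc (0:ℝ) 1, x + r • (y - x) ∈ Ω → psi f x (x + r • (y - x)) ≤ ρ := by
    intro r hr hm
    have : Tendsto (fun k => psi f x (x + r • (Y k - x))) atTop (𝓝 (psi f x (x + r • (y - x)))) :=
      Tendsto.comp (h.psi_cont x hm) (hlimr r)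
    exact le_of_tendsto this (Eventually.of_forall fun k => (h.W_star (hY k) hr).2)
  have hseg : Seg Ω x y := by
    refine h.ray_in hx fun T hT hr => ?_
    refine ⟨2 / T * CC ρ, fun r hrr => ?_⟩
    set T' := max r (T / 2) with hT'
    have hT'm : T' ∈ Ico (0:ℝ) T := ⟨le_max_of_le_left hrr.1, max_lt hrr.2 (by linarith [hT.1])⟩
    have hT'0 : 0 < T' := lt_max_of_lt_right (by linarith [hT.1])
    have hsg : Seg Ω x (x + T' • (y - x)) := by
      intro a ha
      rw [add_sub_cancel_left, smul_smul]
      exact hr _ ⟨mul_nonneg ha.1 hT'0.le, by nlinarith [ha.2, hT'm.2, ha.1]⟩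
    have hpp := hpl T' ⟨hT'm.1, hT'm.2.le.trans hT.2⟩ (hr _ hT'm)
    have hW : x + T' • (y - x) ∈ WW Ω f x ρ := ⟨hsg, hpp⟩
    have hsp := (h.seg_speed hsg fun t ht => hJ _ (h.W_star hW ht)).2 (r / T')
      ⟨div_nonneg hrr.1 hT'0.le, (div_le_one hT'0).2 (le_max_left _ _)⟩
    rw [add_sub_cancel_left, smul_smul, div_mul_cancel₀ _ hT'0.ne', dd2_smul, Real.sqrt_mul (sq_nonneg T'),
      Real.sqrt_sq hT'0.le] at hsp
    have hsp2 := hsp.trans (CC_mono (h.psi_nonneg hsg) hpp)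
    have hle : T / 2 ≤ T' := le_max_right _ _
    have hs0 := Real.sqrt_nonneg (dd (y - x) (dd (y - x) f) (x + r • (y - x)))
    have h3 : T / 2 * √(dd (y - x) (dd (y - x) f) (x + r • (y - x))) ≤ CC ρ :=
      (mul_le_mul_of_nonneg_right hle hs0).trans hsp2
    have hT0 := hT.1
    calc _ = 2 / T * (T / 2 * √(dd (y - x) (dd (y - x) f) (x + r • (y - x)))) := by field_simp
      _ ≤ _ := mul_le_mul_of_nonneg_left h3 (by positivity)
  refine ⟨hseg, ?_⟩
  have := hpl 1 (by simp) (hseg 1 (by simp))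
  simpa using this

theorem q_cont (h : Good Ω f) : ContinuousOn (fun p : (Fin n → ℝ) × (Fin n → ℝ) => dd p.2 (dd p.2 f) p.1) (Ω ×ˢ univ) := by
  have : ∀ p ∈ Ω ×ˢ (univ : Set (Fin n → ℝ)), dd p.2 (dd p.2 f) p.1 = ∑ i, ∑ j, p.2 i * p.2 j * Gm 1 f p.1 i j := by
    intro p hp
    have hw : p.2 = ∑ i, p.2 i • fr (1 : Matrix (Fin n) (Fin n) ℝ) i := by
      have := sub_fr 0 p.2; simpa using this
    conv_lhs => rw [hw, dd2_dir' h.ho hp.1 h.hf]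
  refine ContinuousOn.congr ?_ this
  refine continuousOn_finsetSum _ fun i _ => continuousOn_finsetSum _ fun j _ => ?_
  refine ContinuousOn.mul (by fun_prop) ?_
  exact (ContDiffOn.continuousOn (h.smG i j)).comp continuousOn_fst fun p hp => hp.1

theorem q_lower (h : Good Ω f) {K : Set (Fin n → ℝ)} (hK : IsCompact K) (hKΩ : K ⊆ Ω) :
    ∃ c > 0, ∀ y ∈ K, ∀ w : Fin n → ℝ, c * ‖w‖ ≤ √(dd w (dd w f) y) := by
  have hcomp : IsCompact (K ×ˢ Metric.sphere (0 : Fin n → ℝ) 1) := hK.prod (isCompact_sphere _ _)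
  have hcont : ContinuousOn (fun p : (Fin n → ℝ) × (Fin n → ℝ) => dd p.2 (dd p.2 f) p.1)
    (K ×ˢ Metric.sphere (0 : Fin n → ℝ) 1) := h.q_cont.mono (prod_mono hKΩ (subset_univ _))
  have hunit : ∀ {c : ℝ}, 0 < c → (∀ y ∈ K, ∀ w : Fin n → ℝ, ‖w‖ = 1 → c ≤ dd w (dd w f) y) →
      ∀ y ∈ K, ∀ w : Fin n → ℝ, √c * ‖w‖ ≤ √(dd w (dd w f) y) := by
    intro c hc hh y hy w
    rcases eq_or_ne w 0 with rfl | hw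
    · simp
    have hwn : 0 < ‖w‖ := norm_pos_iff.2 hw
    have h1 := hh y hy (‖w‖⁻¹ • w) (by rw [norm_smul, norm_inv, norm_norm, inv_mul_cancel₀ hwn.ne'])
    rw [dd2_smul] at h1
    have h2 : c * ‖w‖ ^ 2 ≤ dd w (dd w f) y := by
      have := mul_le_mul_of_nonneg_right h1 (sq_nonneg ‖w‖)
      field_simp at this
      linarith
    calc √c * ‖w‖ = √(c * ‖w‖ ^ 2) := by rw [Real.sqrt_mul hc.le, Real.sqrt_sq hwn.le]
      _ ≤ _ := Real.sqrt_le_sqrt h2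
  rcases (K ×ˢ Metric.sphere (0 : Fin n → ℝ) 1).eq_empty_or_nonempty with he | hne
  · refine ⟨√1, by simp, hunit one_pos fun y hy w hw => ?_⟩
    have : (y, w) ∈ K ×ˢ Metric.sphere (0 : Fin n → ℝ) 1 := ⟨hy, by simpa using hw⟩
    rw [he] at this; exact absurd this (by simp)
  · obtain ⟨p, hp, hmin⟩ := hcomp.exists_isMinOn hne hcont
    have hpos : 0 < dd p.2 (dd p.2 f) p.1 := h.q_pos (hKΩ hp.1) (by
      intro h0
      have := hp.2
      rw [h0] at this; simp at this)
    refine ⟨√(dd p.2 (dd p.2 f) p.1), Real.sqrt_pos.2 hpos, hunit hpos fun y hy w hw => ?_⟩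
    exact hmin (show (y, w) ∈ K ×ˢ Metric.sphere (0 : Fin n → ℝ) 1 from ⟨hy, by simpa using hw⟩)

theorem W_compact (h : Good Ω f) (hx : x ∈ Ω) {ρ : ℝ}
    (hJ : ∀ y ∈ WW Ω f x ρ, JJ 1 f y ≤ 2) : IsCompact (WW Ω f x ρ) := by
  refine Metric.isCompact_of_isClosed_isBounded (h.W_closed hx hJ) ?_
  obtain ⟨c, hc, hq⟩ := h.q_lower (isCompact_singleton (x := x)) (by simpa using hx)
  rw [Metric.isBounded_iff_subset_closedBall x]
  refine ⟨CC ρ / c, fun y hy => ?_⟩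
  have hsp := (h.seg_speed hy.1 fun t ht => hJ _ (h.W_star hy ht)).2 0 (by simp)
  rw [zero_smul, add_zero] at hsp
  have h1 := (hq x rfl (y - x)).trans (hsp.trans (CC_mono (h.psi_nonneg hy.1) hy.2))
  rw [Metric.mem_closedBall, dist_eq_norm, le_div_iff₀ hc]
  linarith

theorem W_nhds (h : Good Ω f) {ρ : ℝ} (hy : y ∈ WW Ω f x ρ) (hlt : psi f x y < ρ) : WW Ω f x ρ ∈ 𝓝 y := by
  have hK : IsCompact ((fun t : ℝ => x + t • (y - x)) '' Icc (0:ℝ) 1) :=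
    isCompact_Icc.image (by fun_prop)
  obtain ⟨ε, hε, hsub⟩ := hK.exists_thickening_subset_open h.ho (by
    rintro _ ⟨t, ht, rfl⟩; exact hy.1 t ht)
  have h1 : ∀ᶠ z in 𝓝 y, psi f x z < ρ := (h.psi_cont x hy.1.right).eventually_lt_const hlt
  filter_upwards [h1, Metric.ball_mem_nhds y hε] with z hz hzb
  refine ⟨fun t ht => hsub ?_, hz.le⟩
  rw [Metric.mem_thickening_iff]
  refine ⟨_, ⟨t, ht, rfl⟩, ?_⟩
  simp only
  rw [dist_eq_norm, show x + t • (z - x) - (x + t • (y - x)) = t • (z - y) by module, norm_smul,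
    Real.norm_of_nonneg ht.1]
  rw [Metric.mem_ball, dist_eq_norm] at hzb
  exact lt_of_le_of_lt (mul_le_of_le_one_left (norm_nonneg _) ht.2) hzb

theorem W_self (hx : x ∈ Ω) {ρ : ℝ} (hρ : 0 ≤ ρ) : x ∈ WW Ω f x ρ :=
  ⟨fun t _ => by simpa using hx, by rwa [psi_self]⟩

theorem max_lemma (h : Good Ω f) (hx : x ∈ Ω) {ρ : ℝ} (hρ : 0 < ρ)
    (hJ : ∀ y ∈ WW Ω f x ρ, JJ 1 f y ≤ 2) {u : (Fin n → ℝ) → ℝ} (hu : Sm Ω u) {M a : ℝ} (hM : 0 ≤ M)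
    (hux : 0 ≤ u x) (hub : ∀ y ∈ WW Ω f x ρ, u y ≤ M) (ha : a * Real.log (1 + ρ) = M + 1) :
    ∃ y ∈ WW Ω f x ρ, ∃ b, u x ≤ u y ∧ (∀ w, dd w u y = b * dd w (dd (y - x) f) y) ∧
      (b * dd (y - x) (FF f) y) ^ 2 ≤ 4 * a ^ 2 * PP 1 f (FF f) y ∧ LL 1 f u y ≤ 13 * a ∧
      ∀ z ∈ WW Ω f x ρ, u z ≤ u y + a * Real.log (1 + psi f x z) := by
  have hlog : 0 < Real.log (1 + ρ) := Real.log_pos (by linarith)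
  have ha0 : 0 ≤ a := by
    by_contra hneg
    push Not at hneg
    nlinarith
  have hcont : ContinuousOn (fun z => u z - a * Real.log (1 + psi f x z)) (WW Ω f x ρ) := by
    intro z hz
    have h1 : ContinuousAt u z := (hu.da h.ho hz.1.right).continuousAt
    have h2 : ContinuousAt (fun z => Real.log (1 + psi f x z)) z :=
      (continuousAt_const.add (h.psi_cont x hz.1.right)).log (by
        have := h.psi_nonneg hz.1
        intro h0
        change 1 + psi f x z = 0 at h0
        linarith)
    exact (h1.sub (continuousAt_const.mul h2)).continuousWithinAt
  obtain ⟨y, hy, hmax⟩ := (h.W_compact hx hJ).exists_isMaxOn ⟨x, W_self hx hρ.le⟩ hcont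
  have hp := h.psi_nonneg hy.1
  have hyΩ := hy.1.right
  have hmx := hmax (W_self hx hρ.le)
  simp only [Set.mem_ofPred_eq, psi_self, add_zero, Real.log_one, mul_zero, sub_zero] at hmx
  have hlp : 0 ≤ Real.log (1 + psi f x y) := Real.log_nonneg (by linarith)
  have hlt : psi f x y < ρ := by
    rcases hy.2.eq_or_lt with h0 | h0
    · exfalso
      rw [h0, ha] at hmx
      linarith [hub y hy]
    · exact h0
  obtain ⟨g1, g2⟩ := h.at_max hyΩ hu ha0 hp (hmax.isLocalMax (h.W_nhds hy hlt))
  have hs := (h.seg_speed hy.1 fun t ht => hJ _ (h.W_star hy ht)).1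
  have hPn := h.P_nonneg hyΩ
  have hq := h.q_nonneg hyΩ (y - x)
  have hlin := h.lin hyΩ (y - x)
  set s := √(dd (y - x) (dd (y - x) f) y) with hsdef
  have hs0 : 0 ≤ s := Real.sqrt_nonneg _
  have hs2 : s ^ 2 = dd (y - x) (dd (y - x) f) y := Real.sq_sqrt hq
  set p := psi f x y with hpdef
  have h1p : 0 < 1 + p := by linarith
  have hom : (b : ℝ) → b = a / (1 + p) → (b * dd (y - x) (FF f) y) ^ 2 ≤ 4 * a ^ 2 * PP 1 f (FF f) y := by
    rintro b rfl
    have h1 : s ^ 2 ≤ 4 * (1 + p) ^ 2 := by nlinarith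
    calc (a / (1 + p) * dd (y - x) (FF f) y) ^ 2 = (a / (1 + p)) ^ 2 * (dd (y - x) (FF f) y) ^ 2 := by ring
      _ ≤ (a / (1 + p)) ^ 2 * (PP 1 f (FF f) y * (4 * (1 + p) ^ 2)) := by
          refine mul_le_mul_of_nonneg_left (hlin.trans ?_) (sq_nonneg _)
          rw [← hs2]
          exact mul_le_mul_of_nonneg_left h1 hPn
      _ = _ := by field_simp
  have hom' := hom _ rfl
  refine ⟨y, hy, a / (1 + p), by nlinarith, g1, hom', ?_, fun z hz => ?_⟩
  · have hP10 : PP 1 f (FF f) y ≤ 10 := (h.P_le hyΩ).trans (by linarith [hJ y hy])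
    have hb : a / (1 + p) * dd (y - x) (FF f) y ≤ 8 * a := by
      refine abs_le_of_sq_le_sq' ?_ (by positivity) |>.2
      nlinarith [mul_le_mul_of_nonneg_left hP10 (sq_nonneg a), sq_nonneg a]
    have hn5 : (n : ℝ) ≤ 5 := by exact_mod_cast h.hn
    have hn0 : (0 : ℝ) ≤ n := Nat.cast_nonneg n
    have hba : a / (1 + p) ≤ a := div_le_self ha0 (by linarith)
    have : a / (1 + p) * n ≤ a * 5 := mul_le_mul hba hn5 hn0 ha0
    rw [mul_add] at g2
    linarith
  · have := hmax hz
    simp only [Set.mem_ofPred_eq] at this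
    nlinarith
end Good

noncomputable def Nf {n : ℕ} (f : (Fin n → ℝ) → ℝ) (y : Fin n → ℝ) : ℝ := JJ 1 f y + √(NN 1 f (FF f) y)

noncomputable def rho0 : ℝ := Real.exp (11 * 10 ^ 26) - 1
noncomputable def rho1 : ℝ := Real.exp (10 ^ 16) - 1

theorem rho1_pos : 0 < rho1 := by
  have : 1 < Real.exp (10 ^ 16) := Real.one_lt_exp_iff.2 (by norm_num)
  unfold rho1; linarith
theorem rho_le : rho1 ≤ rho0 := by
  have : Real.exp (10 ^ 16) ≤ Real.exp (11 * 10 ^ 26) := Real.exp_le_exp.2 (by norm_num)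
  unfold rho1 rho0; linarith
theorem log_rho1 : Real.log (1 + rho1) = 10 ^ 16 := by
  rw [rho1, add_sub_cancel, Real.log_exp]
theorem log_rho0 : Real.log (1 + rho0) = 11 * 10 ^ 26 := by
  rw [rho0, add_sub_cancel, Real.log_exp]

namespace Good
variable {n : ℕ} {Ω : Set (Fin n → ℝ)} {f : (Fin n → ℝ) → ℝ} {x y : Fin n → ℝ}

theorem LL_add (h : Good Ω f) (hy : y ∈ Ω) {u w : (Fin n → ℝ) → ℝ} (hu : Sm Ω u) (hw : Sm Ω w) (c : ℝ) :
    LL 1 f (fun z => u z + c * w z) y = LL 1 f u y + c * LL 1 f w y := by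
  have hcw : Sm Ω (fun z => c * w z) := (Sm.const c).mul hw
  have : Gm 1 (fun z => u z + c * w z) y = Gm 1 u y + c • Gm 1 w y := by
    ext i j
    simp only [Gm, Matrix.of_apply, Matrix.add_apply, Matrix.smul_apply, smul_eq_mul]
    rw [dd_congr h.ho hy (w := fun z => dd (fr 1 j) u z + c * dd (fr 1 j) w z) fun z hz => by
        rw [dd_add h.ho hz hu hcw, dd_cmul h.ho hz hw],
      dd_add h.ho hy (hu.dd h.ho) ((Sm.const c).mul (hw.dd h.ho)), dd_cmul h.ho hy (hw.dd h.ho)]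
  rw [LL, this, Matrix.mul_add, Matrix.trace_add, Matrix.mul_smul, Matrix.trace_smul]
  rfl

theorem Nf_nonneg (h : Good Ω f) (hy : y ∈ Ω) : 0 ≤ Nf f y :=
  add_nonneg (h.J_nonneg hy) (Real.sqrt_nonneg _)

theorem J_le (y : Fin n → ℝ) : JJ 1 f y ≤ Nf f y := by
  unfold Nf; linarith [Real.sqrt_nonneg (NN 1 f (FF f) y)]

theorem local_lemma (h : Good Ω f) (hx : x ∈ Ω) (hN : Nf f x = 1) : ∃ y ∈ WW Ω f x rho0, 2 < Nf f y := by
  by_contra hcon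
  push Not at hcon
  have hJ : ∀ y ∈ WW Ω f x rho0, JJ 1 f y ≤ 2 := fun y hy => (J_le y).trans (hcon y hy)
  have hNN : ∀ y ∈ WW Ω f x rho0, NN 1 f (FF f) y ≤ 4 := by
    intro y hy
    have h1 : √(NN 1 f (FF f) y) ≤ 2 := by
      have := hcon y hy
      have := h.J_nonneg hy.1.right
      unfold Nf at *; linarith
    rw [Real.sqrt_le_left (by norm_num)] at h1
    linarith
  have hr1 := rho1_pos
  have hr0 : 0 < rho0 := hr1.trans_le rho_le
  have hPb : ∀ y ∈ WW Ω f x rho0, PP 1 f (FF f) y ≤ 10 := fun y hy => by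
    have := h.P_le hy.1.right
    have := hJ y hy
    linarith
  have hsub : WW Ω f x rho1 ⊆ WW Ω f x rho0 := fun y hy => ⟨hy.1, hy.2.trans rho_le⟩
  -- stage 1
  have st1 : ∀ z ∈ WW Ω f x rho1, PP 1 f (FF f) z ≤ 1 / 10 ^ 9 := by
    obtain ⟨y, hy, b, -, hb, hbF, hL, hz⟩ := h.max_lemma hx hr0 hJ h.smP (M := 10) (a := 1 / 10 ^ 26) (by norm_num)
      (h.P_nonneg hx) hPb (by rw [log_rho0]; norm_num)
    have hPy : PP 1 f (FF f) y ≤ 5 / 10 ^ 10 := by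
      by_contra hgt
      push Not at hgt
      have hpos : 0 < PP 1 f (FF f) y := lt_trans (by norm_num) hgt
      have h1 := h.ineq1 hy.1.right hpos hb
      rw [div_pow] at h1
      have h2 : (b * dd (y - x) (FF f) y) ^ 2 / PP 1 f (FF f) y ^ 2 ≤ 1 / 10 ^ 40 := by
        rw [div_le_iff₀ (by positivity)]
        refine hbF.trans ?_
        nlinarith
      have h3 : (5 / 10 ^ 10 : ℝ) ^ 2 ≤ PP 1 f (FF f) y ^ 2 := pow_le_pow_left₀ (by norm_num) hgt.le 2
      norm_num at h1 h2 h3 hL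
      linarith
    intro z hzm
    have h1 := hz z (hsub hzm)
    have h2 : Real.log (1 + psi f x z) ≤ 10 ^ 16 := by
      rw [← log_rho1]
      exact Real.log_le_log (by linarith [h.psi_nonneg hzm.1]) (by linarith [hzm.2])
    norm_num at h1 h2 hPy ⊢
    linarith
  -- stage 2
  have hu1 : Sm Ω (fun z => (1 / 640) * JJ 1 f z) := (Sm.const _).mul h.smJ
  have hu2 : Sm Ω (fun z => NN 1 f (FF f) z + (1 / 640) * JJ 1 f z) := h.smN.add hu1
  have hu3 : Sm Ω (fun z => (NN 1 f (FF f) z + (1 / 640) * JJ 1 f z) + 100000 * PP 1 f (FF f) z) :=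
    hu2.add ((Sm.const _).mul h.smP)
  have hQx : (1:ℝ) / 1280 ≤ NN 1 f (FF f) x + (1 / 640) * JJ 1 f x := by
    have h1 := h.J_nonneg hx
    have h2 := h.N_nonneg hx
    have h3 := Real.sq_sqrt h2
    unfold Nf at hN
    rcases le_total (1 / 2) (JJ 1 f x) with h4 | h4
    · linarith
    · have : 1 / 2 ≤ √(NN 1 f (FF f) x) := by linarith
      nlinarith
  have hPx := h.P_nonneg hx
  obtain ⟨y, hy, b, hxy, -, -, hL, -⟩ := h.max_lemma hx hr1 (fun y hy => hJ y (hsub hy)) hu3 (M := 10 ^ 7 - 1)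
    (a := 1 / 10 ^ 9) (by norm_num) (by linarith) (fun y hy => by
      have := hJ y (hsub hy)
      have := hNN y (hsub hy)
      have := hPb y (hsub hy)
      linarith) (by rw [log_rho1]; norm_num)
  have hyΩ := hy.1.right
  rw [h.LL_add hyΩ hu2 h.smP, h.LL_add hyΩ h.smN h.smJ] at hL
  have i2 := h.ineq2 hyΩ
  have i3 := h.ineq3 hyΩ (μ := 1 / 640) (by norm_num)
  have p1 := st1 y hy
  have p0 := h.P_nonneg hyΩ
  have j0 := h.J_nonneg hyΩ
  have n0 := h.N_nonneg hyΩ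
  have j1 := hJ y (hsub hy)
  have n1 := hNN y (hsub hy)
  set P := PP 1 f (FF f) y
  set J := JJ 1 f y
  set N := NN 1 f (FF f) y
  have p2 : P ^ 2 ≤ (1 / 10 ^ 9) ^ 2 := pow_le_pow_left₀ p0 p1 2
  have hc : (4 * J + 18 * (1 / 640) + 1 + (18 / (1 / 640) + 1) * N) * N ≤ 46100 * N :=
    mul_le_mul_of_nonneg_right (by norm_num; linarith) n0
  have hm : (1:ℝ) / 2560 ≤ N + (1 / 640) * J := by
    norm_num at p1
    linarith
  have hlow : (1 / 640) * J ^ 2 / 40 - (1 / 640) ^ 2 * J + 8 * N - 1 / 10 ^ 12 ≤ 13 / 10 ^ 9 := by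
    norm_num at p2 hL i2 i3 hc ⊢
    linarith
  rcases le_total (1 / 8) J with h8 | h8
  · have : J * (1 / 8) ≤ J ^ 2 := by nlinarith
    norm_num at hlow this
    linarith
  · norm_num at hlow hm h8
    nlinarith [sq_nonneg J]

theorem Nf_cont (h : Good Ω f) (hy : y ∈ Ω) : ContinuousAt (Nf f) y :=
  (h.smJ.da h.ho hy).continuousAt.add (h.smN.da h.ho hy).continuousAt.sqrt

theorem step (h : Good Ω f) (hx : x ∈ Ω) (hN : Nf f x = 1) : ∃ y, Seg Ω x y ∧ Nf f y = 2 ∧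
    ∀ t ∈ Icc (0:ℝ) 1, √(dd (y - x) (dd (y - x) f) (x + t • (y - x))) ≤ CC rho0 := by
  obtain ⟨y, hy, hy2⟩ := h.local_lemma hx hN
  have hcont : ContinuousOn (fun t : ℝ => Nf f (x + t • (y - x))) (Icc 0 1) := fun t ht => by
    refine ContinuousAt.continuousWithinAt (ContinuousAt.comp (f := fun t : ℝ => x + t • (y - x)) (h.Nf_cont (hy.1 t ht)) ?_)
    fun_prop
  have hS : IsCompact (Icc (0:ℝ) 1 ∩ (fun t : ℝ => Nf f (x + t • (y - x))) ⁻¹' Ici 2) :=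
    isCompact_Icc.of_isClosed_subset (hcont.preimage_isClosed_of_isClosed isClosed_Icc isClosed_Ici) inter_subset_left
  obtain ⟨t1, ⟨ht1, ht2⟩, hmin⟩ := hS.exists_isLeast ⟨1, by simp, by
    simp only [mem_preimage, one_smul, add_sub_cancel, mem_Ici]; exact hy2.le⟩
  simp only [mem_preimage, mem_Ici] at ht2
  have hlt : ∀ t ∈ Icc (0:ℝ) 1, t < t1 → Nf f (x + t • (y - x)) < 2 := by
    intro t ht htt
    by_contra hge
    push Not at hge
    exact absurd (hmin ⟨ht, hge⟩) (not_le.2 htt)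
  have heq : Nf f (x + t1 • (y - x)) = 2 := by
    refine le_antisymm ?_ ht2
    by_contra hgt
    push Not at hgt
    have h0 : Nf f (x + (0:ℝ) • (y - x)) = 1 := by simpa using hN
    obtain ⟨t, ht, hte⟩ := intermediate_value_Icc ht1.1 (hcont.mono (Icc_subset_Icc_right ht1.2))
      (show (2:ℝ) ∈ Icc _ _ from ⟨by rw [h0]; norm_num, hgt.le⟩)
    simp only at hte
    have ht' : t ∈ Icc (0:ℝ) 1 := ⟨ht.1, ht.2.trans ht1.2⟩
    have h3 := hmin (show t ∈ _ from ⟨ht', hte.ge⟩)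
    have : t = t1 := le_antisymm ht.2 h3
    rw [this] at hte
    linarith
  have hw := h.W_star hy ht1
  refine ⟨_, hw.1, heq, fun t ht => ?_⟩
  refine ((h.seg_speed hw.1 fun s hs => ?_).2 t ht).trans (CC_mono (h.psi_nonneg hw.1) hw.2)
  refine (J_le _).trans ?_
  rw [show x + s • (x + t1 • (y - x) - x) = x + (s * t1) • (y - x) by module]
  have hst : s * t1 ≤ t1 := mul_le_of_le_one_left ht1.1 hs.2
  rcases hst.eq_or_lt with h4 | h4
  · rw [h4]; exact heq.le
  · exact (hlt _ ⟨mul_nonneg hs.1 ht1.1, hst.trans ht1.2⟩ h4).le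
end Good

namespace Good
variable {n : ℕ} {Ω : Set (Fin n → ℝ)} {f : (Fin n → ℝ) → ℝ} {x y : Fin n → ℝ} {c : ℝ}

theorem sc_Gm (h : Good Ω f) (hy : y ∈ Ω) (c : ℝ) : Gm 1 (fun z => c * f z) y = c • Gm 1 f y := by
  ext i j
  simp only [Gm, Matrix.of_apply, Matrix.smul_apply, smul_eq_mul]
  rw [dd_congr h.ho hy (w := fun z => c * dd (fr 1 j) f z) fun z hz => dd_cmul h.ho hz h.hf c,
    dd_cmul h.ho hy (h.hf.dd h.ho)]

theorem sc_q (h : Good Ω f) (hy : y ∈ Ω) (c : ℝ) (w : Fin n → ℝ) :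
    dd w (dd w (fun z => c * f z)) y = c * dd w (dd w f) y := by
  rw [dd_congr h.ho hy (w := fun z => c * dd w f z) fun z hz => dd_cmul h.ho hz h.hf c,
    dd_cmul h.ho hy (h.hf.dd h.ho)]

theorem sc_inv {G : Matrix (Fin n) (Fin n) ℝ} (hc : 0 < c) (hG : G.det ≠ 0) : (c • G)⁻¹ = c⁻¹ • G⁻¹ := by
  have := Matrix.inv_smul' (A := G) (Units.mk0 c hc.ne') (isUnit_iff_ne_zero.2 hG)
  simpa [Units.smul_def] using this

theorem sc_XX (h : Good Ω f) (hy : y ∈ Ω) (hc : 0 < c) (i : Fin n) :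
    XX 1 (fun z => c * f z) i y = XX 1 f i y := by
  have : DM (fr 1 i) (Gm 1 (fun z => c * f z)) y = c • DM (fr 1 i) (Gm 1 f) y := by
    rw [DM_congr h.ho hy fun z hz => h.sc_Gm hz c]
    ext k l
    simp only [DM, Matrix.of_apply, Matrix.smul_apply, smul_eq_mul]
    exact dd_cmul h.ho hy (h.smG k l) c
  rw [XX, XX, this, h.sc_Gm hy, sc_inv hc (h.det0 y hy), Matrix.smul_mul, Matrix.mul_smul, smul_smul,
    inv_mul_cancel₀ hc.ne', one_smul]

theorem sc_JJ (h : Good Ω f) (hy : y ∈ Ω) (hc : 0 < c) :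
    JJ 1 (fun z => c * f z) y = c⁻¹ * JJ 1 f y := by
  have : RR 1 (fun z => c * f z) y = RR 1 f y := by
    ext i j
    simp only [RR, Matrix.of_apply, h.sc_XX hy hc]
  rw [JJ, JJ, this, h.sc_Gm hy, sc_inv hc (h.det0 y hy), Matrix.smul_mul, Matrix.trace_smul]
  rfl

theorem sc_FF (h : Good Ω f) (hy : y ∈ Ω) (hc : 0 < c) :
    FF (fun z => c * f z) y = n * Real.log c + FF f y := by
  rw [FF, h.sc_Gm hy, Matrix.det_smul, Real.log_mul (by positivity) (h.det0 y hy), Real.log_pow, Fintype.card_fin]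
  rfl

theorem sc_GF (h : Good Ω f) (hy : y ∈ Ω) (hc : 0 < c) :
    Gm 1 (FF (fun z => c * f z)) y = Gm 1 (FF f) y := by
  ext i j
  simp only [Gm, Matrix.of_apply]
  refine dd_congr h.ho hy fun z hz => ?_
  rw [dd_congr h.ho hz (w := fun z => n * Real.log c + FF f z) fun z hz => h.sc_FF hz hc,
    dd_add h.ho hz (Sm.const _) h.smF, dd_const, zero_add]

theorem sc_NN (h : Good Ω f) (hy : y ∈ Ω) (hc : 0 < c) :
    NN 1 (fun z => c * f z) (FF (fun z => c * f z)) y = (c⁻¹) ^ 2 * NN 1 f (FF f) y := by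
  rw [NN, NN, h.sc_GF hy hc, h.sc_Gm hy, sc_inv hc (h.det0 y hy)]
  simp only [Matrix.smul_mul, Matrix.mul_smul, smul_smul, Matrix.trace_smul, smul_eq_mul]
  ring

theorem sc_Nf (h : Good Ω f) (hy : y ∈ Ω) (hc : 0 < c) : Nf (fun z => c * f z) y = c⁻¹ * Nf f y := by
  rw [Nf, Nf, h.sc_JJ hy hc, h.sc_NN hy hc, Real.sqrt_mul (sq_nonneg _), Real.sqrt_sq (by positivity)]
  ring

theorem scale (h : Good Ω f) (hc : 0 < c) : Good Ω (fun z => c * f z) where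
  hn := h.hn
  ho := h.ho
  hf := (Sm.const c).mul h.hf
  hp := fun y hy => by rw [h.sc_Gm hy]; exact (h.hp y hy).smul hc
  hL := fun y hy => by
    rw [LL, h.sc_GF hy hc, h.sc_Gm hy, sc_inv hc (h.det0 y hy), Matrix.smul_mul, Matrix.trace_smul]
    have := h.hL y hy
    rw [LL] at this
    rw [this, smul_zero]
  hc := by
    intro γ h1 h2 h3
    have h4 := h.hc γ h1 h2 h3
    have : ∀ t ∈ Ioo (0:ℝ) 1, ENNReal.ofReal (√((Hess n (fun z => c * f z) (γ t)).mulVec (deriv γ t) ⬝ᵥ deriv γ t))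
        = ENNReal.ofReal (√c) * ENNReal.ofReal (√((Hess n f (γ t)).mulVec (deriv γ t) ⬝ᵥ deriv γ t)) := by
      intro t ht
      rw [Hess_eq, Hess_eq, h.sc_Gm (h2 t ⟨ht.1.le, ht.2⟩), Matrix.smul_mulVec, smul_dotProduct, smul_eq_mul,
        Real.sqrt_mul hc.le, ENNReal.ofReal_mul (Real.sqrt_nonneg _)]
    rw [MeasureTheory.setLIntegral_congr_fun measurableSet_Ioo this, MeasureTheory.lintegral_const_mul' _ _ ENNReal.ofReal_ne_top, h4]
    exact ENNReal.mul_top (by simpa using hc)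

theorem step' (h : Good Ω f) (hx : x ∈ Ω) (hN : 0 < Nf f x) : ∃ y, Seg Ω x y ∧ Nf f y = 2 * Nf f x ∧
    ∀ t ∈ Icc (0:ℝ) 1, √(dd (y - x) (dd (y - x) f) (x + t • (y - x))) ≤ CC rho0 / √(Nf f x) := by
  obtain ⟨y, hs, hy, hsp⟩ := (h.scale hN).step hx (by rw [h.sc_Nf hx hN, inv_mul_cancel₀ hN.ne'])
  refine ⟨y, hs, ?_, fun t ht => ?_⟩
  · rw [h.sc_Nf hs.right hN] at hy
    field_simp at hy
    linarith
  · have := hsp t ht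
    rw [h.sc_q (hs t ht), Real.sqrt_mul hN.le] at this
    rw [le_div_iff₀ (Real.sqrt_pos.2 hN)]
    linarith
end Good

section curve
variable {n : ℕ} {x : ℕ → Fin n → ℝ}

noncomputable def pg (x : ℕ → Fin n → ℝ) (m : ℕ) (s : ℝ) : Fin n → ℝ :=
  x 0 + ∑ k ∈ Finset.range m, Real.smoothTransition (s - k) • (x (k + 1) - x k)

noncomputable def gam (x : ℕ → Fin n → ℝ) (s : ℝ) : Fin n → ℝ := pg x (⌊s⌋₊ + 1) s

theorem pg_form {k : ℕ} {s : ℝ} (hs : (k : ℝ) ≤ s) :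
    pg x (k + 1) s = x k + Real.smoothTransition (s - k) • (x (k + 1) - x k) := by
  rw [pg, Finset.sum_range_succ, ← add_assoc]
  congr 1
  rw [Finset.sum_congr rfl (g := fun j => x (j + 1) - x j), Finset.sum_range_sub]
  · abel
  · intro j hj
    have : (j : ℝ) + 1 ≤ k := by exact_mod_cast Finset.mem_range.1 hj
    rw [Real.smoothTransition.one_of_one_le (by linarith), one_smul]

theorem gam_eq {m : ℕ} {s : ℝ} (h0 : 0 < m) (hs : s < m) : gam x s = pg x m s := by
  rw [gam, pg, pg]
  congr 1
  have hm : ⌊s⌋₊ + 1 ≤ m := Nat.succ_le_of_lt ((Nat.floor_lt' h0.ne').2 hs)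
  refine Finset.sum_subset (Finset.range_mono hm) fun j _ hj => ?_
  have h1 : ⌊s⌋₊ + 1 ≤ j := by simpa using hj
  have h2 : ((⌊s⌋₊ : ℝ)) + 1 ≤ j := by exact_mod_cast h1
  rw [Real.smoothTransition.zero_of_nonpos (by linarith [Nat.lt_floor_add_one s]), zero_smul]

theorem pg_smooth (m : ℕ) : ContDiff ℝ 1 (pg x m) := by
  have hS : ContDiff ℝ 1 Real.smoothTransition := Real.smoothTransition.contDiff (n := 1)
  refine contDiff_const.add (ContDiff.sum fun k _ => ?_)
  exact (hS.comp (contDiff_id.sub contDiff_const)).smul contDiff_const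

theorem S_diff (s : ℝ) : DifferentiableAt ℝ Real.smoothTransition s :=
  (Real.smoothTransition.contDiffAt (n := 1)).differentiableAt (by simp)

theorem S_deriv_zero {s : ℝ} (hs : 1 ≤ s) : deriv Real.smoothTransition s = 0 := by
  refine IsLocalMax.deriv_eq_zero ?_
  refine Filter.Eventually.of_forall fun t => ?_
  rw [Real.smoothTransition.one_of_one_le hs]
  exact Real.smoothTransition.le_one t

theorem pg_deriv {k : ℕ} {s : ℝ} (hs : (k : ℝ) ≤ s) :
    HasDerivAt (pg x (k + 1)) (deriv Real.smoothTransition (s - k) • (x (k + 1) - x k)) s := by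
  have h1 : HasDerivAt (pg x (k + 1))
      (∑ j ∈ Finset.range (k + 1), deriv Real.smoothTransition (s - j) • (x (j + 1) - x j)) s := by
    refine HasDerivAt.const_add _ (HasDerivAt.fun_sum fun j _ => ?_)
    have := (S_diff (s - j)).hasDerivAt.scomp s ((hasDerivAt_id s).sub_const (j : ℝ))
    rw [one_smul] at this
    exact this.smul_const _
  rw [Finset.sum_range_succ, Finset.sum_eq_zero, zero_add] at h1
  · exact h1
  · intro j hj
    have : (j : ℝ) + 1 ≤ k := by exact_mod_cast Finset.mem_range.1 hj
    rw [S_deriv_zero (by linarith), zero_smul]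

theorem S_bound : ∃ B > 0, ∀ s ∈ Icc (0:ℝ) 1, |deriv Real.smoothTransition s| ≤ B := by
  have hc : Continuous (deriv Real.smoothTransition) :=
    (Real.smoothTransition.contDiff (n := 1)).continuous_deriv (by simp)
  obtain ⟨B, hB⟩ := isCompact_Icc.exists_bound_of_continuousOn (s := Icc (0:ℝ) 1) hc.continuousOn
  refine ⟨max B 1, by positivity, fun s hs => (hB s hs).trans (le_max_left _ _)⟩
end curve

namespace Good
variable {n : ℕ} {Ω : Set (Fin n → ℝ)} {f : (Fin n → ℝ) → ℝ} {x y : Fin n → ℝ} {c : ℝ}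

theorem curve (h : Good Ω f) {x : ℕ → Fin n → ℝ} {C l : ℝ} (hC : 0 ≤ C) (hl : 0 < l) (hs : ∀ k, Seg Ω (x k) (x (k + 1)))
    (hsp : ∀ k, ∀ t ∈ Icc (0:ℝ) 1, √(dd (x (k + 1) - x k) (dd (x (k + 1) - x k) f) (x k + t • (x (k + 1) - x k)))
      ≤ C * Real.exp (- (l * k))) :
    ∃ (γ : ℝ → Fin n → ℝ) (D : ℝ), 0 < D ∧ (∀ t ∈ Ico (0:ℝ) 1, ContDiffAt ℝ 1 γ t) ∧ (∀ t ∈ Ico (0:ℝ) 1, γ t ∈ Ω) ∧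
      (∀ t ∈ Ico (0:ℝ) 1, √(dd (deriv γ t) (dd (deriv γ t) f) (γ t)) ≤ D) ∧
      (∀ k : ℕ, γ (1 - Real.exp (- (l * k))) = x k) := by
  obtain ⟨B, hB, hSB⟩ := S_bound
  set σ : ℝ → ℝ := fun t => - Real.log (1 - t) / l with hσ
  have hσ0 : ∀ t ∈ Ico (0:ℝ) 1, 0 ≤ σ t := fun t ht =>
    div_nonneg (neg_nonneg.2 (Real.log_nonpos (by linarith [ht.2]) (by linarith [ht.1]))) hl.le
  have hσd : ∀ t < (1:ℝ), HasDerivAt σ (1 / ((1 - t) * l)) t := by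
    intro t ht
    have h1 : HasDerivAt (fun t : ℝ => 1 - t) (-1) t := by simpa using (hasDerivAt_id t).const_sub 1
    have h2 := ((h1.log (by linarith)).neg).div_const l
    refine h2.congr_deriv ?_
    have : 1 - t ≠ 0 := by linarith
    field_simp
  have hσc : ∀ t < (1:ℝ), ContDiffAt ℝ 1 σ t := by
    intro t ht
    have h1 : ContDiffAt ℝ 1 (fun t : ℝ => 1 - t) t := by fun_prop
    exact ((h1.log (by linarith)).neg).div_const l
  have hfl : ∀ t ∈ Ico (0:ℝ) 1, (⌊σ t⌋₊ : ℝ) ≤ σ t ∧ σ t < ⌊σ t⌋₊ + 1 := fun t ht =>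
    ⟨Nat.floor_le (hσ0 t ht), Nat.lt_floor_add_one _⟩
  have hev : ∀ t ∈ Ico (0:ℝ) 1, (fun r => gam x (σ r)) =ᶠ[𝓝 t] fun r => pg x (⌊σ t⌋₊ + 1) (σ r) := by
    intro t ht
    have : ∀ᶠ r in 𝓝 t, σ r < (⌊σ t⌋₊ + 1 : ℕ) :=
      (hσd t ht.2).continuousAt.eventually_lt_const (by push_cast; exact (hfl t ht).2)
    filter_upwards [this] with r hr
    exact gam_eq (Nat.succ_pos _) hr
  have hmem : ∀ t ∈ Ico (0:ℝ) 1, σ t - ⌊σ t⌋₊ ∈ Icc (0:ℝ) 1 := fun t ht =>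
    ⟨by linarith [hfl t ht], by linarith [hfl t ht]⟩
  have hSm : ∀ s, Real.smoothTransition s ∈ Icc (0:ℝ) 1 := fun s =>
    ⟨Real.smoothTransition.nonneg s, Real.smoothTransition.le_one s⟩
  have hval : ∀ t ∈ Ico (0:ℝ) 1, gam x (σ t) = x ⌊σ t⌋₊ +
      Real.smoothTransition (σ t - ⌊σ t⌋₊) • (x (⌊σ t⌋₊ + 1) - x ⌊σ t⌋₊) := fun t ht => by
    rw [gam, pg_form (hfl t ht).1]
  refine ⟨fun t => gam x (σ t), B * C * Real.exp l / l + 1, by positivity, fun t ht => ?_, fun t ht => ?_, fun t ht => ?_, fun k => ?_⟩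
  · exact ContDiffAt.congr_of_eventuallyEq ((pg_smooth _).contDiffAt.comp t (hσc t ht.2)) (hev t ht)
  · simp only
    rw [hval t ht]
    exact hs _ _ (hSm _)
  · have hd : deriv (fun t => gam x (σ t)) t = (1 / ((1 - t) * l) *
        deriv Real.smoothTransition (σ t - ⌊σ t⌋₊)) • (x (⌊σ t⌋₊ + 1) - x ⌊σ t⌋₊) := by
      rw [(hev t ht).deriv_eq, ← smul_smul]
      exact ((pg_deriv (hfl t ht).1).scomp t (hσd t ht.2)).deriv
    simp only [hd, hval t ht]
    rw [dd2_smul, Real.sqrt_mul (sq_nonneg _), Real.sqrt_sq_eq_abs]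
    have h1 := hsp ⌊σ t⌋₊ _ (hSm (σ t - ⌊σ t⌋₊))
    have h2 := hSB _ (hmem t ht)
    have ht1 : 0 < 1 - t := by linarith [ht.2]
    have h3 : Real.exp (- (l * ⌊σ t⌋₊)) ≤ (1 - t) * Real.exp l := by
      have : - (l * ⌊σ t⌋₊) ≤ Real.log (1 - t) + l := by
        have h4 : l * σ t ≤ l * (⌊σ t⌋₊ + 1) := mul_le_mul_of_nonneg_left (hfl t ht).2.le hl.le
        have h5 : l * σ t = - Real.log (1 - t) := by rw [hσ]; field_simp
        linarith
      have := Real.exp_le_exp.2 this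
      rwa [Real.exp_add, Real.exp_log ht1] at this
    rw [abs_mul, abs_of_pos (by positivity : 0 < 1 / ((1 - t) * l))]
    have h5 : 1 / ((1 - t) * l) * |deriv Real.smoothTransition (σ t - ⌊σ t⌋₊)| * √(dd (x (⌊σ t⌋₊ + 1) - x ⌊σ t⌋₊)
        (dd (x (⌊σ t⌋₊ + 1) - x ⌊σ t⌋₊) f) (x ⌊σ t⌋₊ +
      Real.smoothTransition (σ t - ⌊σ t⌋₊) • (x (⌊σ t⌋₊ + 1) - x ⌊σ t⌋₊))) ≤ 1 / ((1 - t) * l) * B * (C * ((1 - t) * Real.exp l)) := by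
      gcongr
      exact h1.trans (mul_le_mul_of_nonneg_left h3 hC)
    have h6 : 1 / ((1 - t) * l) * B * (C * ((1 - t) * Real.exp l)) = B * C * Real.exp l / l := by field_simp
    linarith
  · simp only
    have : σ (1 - Real.exp (- (l * k))) = k := by
      rw [hσ]; simp only [sub_sub_cancel, Real.log_exp]; field_simp
    rw [this, gam, Nat.floor_natCast, pg_form le_rfl]
    simp

theorem no_chain (h : Good Ω f) {x : ℕ → Fin n → ℝ} {C l : ℝ} (hC : 0 ≤ C) (hl : 0 < l) (hs : ∀ k, Seg Ω (x k) (x (k + 1)))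
    (hsp : ∀ k, ∀ t ∈ Icc (0:ℝ) 1, √(dd (x (k + 1) - x k) (dd (x (k + 1) - x k) f) (x k + t • (x (k + 1) - x k)))
      ≤ C * Real.exp (- (l * k))) (hN : Tendsto (fun k => Nf f (x k)) atTop atTop) : False := by
  obtain ⟨γ, D, hD, h1, h2, h3, h4⟩ := h.curve hC hl hs hsp
  have hnc : ¬ ∀ K : Set (Fin n → ℝ), K ⊆ Ω → IsCompact K →
      ∃ t₀, t₀ < 1 ∧ ∀ t, t₀ < t → t < 1 → γ t ∉ K := by
    intro hK
    have key := h.hc γ (fun t ht => (h1 t ht).contDiffWithinAt) h2 hK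
    have hlt : ∫⁻ t in Set.Ioo (0 : ℝ) 1,
        ENNReal.ofReal (Real.sqrt ((Hess n f (γ t)).mulVec (deriv γ t) ⬝ᵥ deriv γ t))
          ≤ ∫⁻ t in Set.Ioo (0 : ℝ) 1, ENNReal.ofReal D := by
      refine MeasureTheory.setLIntegral_mono' measurableSet_Ioo fun t ht => ENNReal.ofReal_le_ofReal ?_
      rw [h.quad_eq (h2 t ⟨ht.1.le, ht.2⟩)]
      exact h3 t ⟨ht.1.le, ht.2⟩
    rw [key] at hlt
    simp at hlt
  push Not at hnc
  obtain ⟨K, hKΩ, hK, hret⟩ := hnc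
  obtain ⟨δ, hδ, hsub⟩ := hK.exists_cthickening_subset_open h.ho hKΩ
  have hK' : IsCompact (Metric.cthickening δ K) := hK.cthickening
  obtain ⟨c, hc, hlow⟩ := h.q_lower hK' hsub
  obtain ⟨B, hB⟩ := hK'.exists_bound_of_continuousOn (f := Nf f) fun z hz => (h.Nf_cont (hsub hz)).continuousWithinAt
  set M := D / c + 1 with hM
  have hM0 : 0 < M := by positivity
  obtain ⟨t, ht1, ht2, htK⟩ := hret (max 0 (1 - δ / M)) (max_lt one_pos (by have := div_pos hδ hM0; linarith))
  have ht0 : 0 < t := (le_max_left _ _).trans_lt ht1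
  have htδ : M * (1 - t) ≤ δ := by
    have : 1 - δ / M < t := (le_max_right _ _).trans_lt ht1
    have h5 : 1 - t ≤ δ / M := by linarith
    rw [le_div_iff₀ hM0] at h5
    linarith
  have hmemK : ∀ z, ‖z - γ t‖ ≤ δ → z ∈ Metric.cthickening δ K := fun z hz =>
    Metric.mem_cthickening_of_dist_le z (γ t) δ K htK (by rwa [dist_eq_norm])
  have hstay : ∀ s, t ≤ s → s < 1 → γ s ∈ Metric.cthickening δ K := by
    intro s hts hs1
    have hm : ∀ r ∈ Icc t s, r ∈ Ico (0:ℝ) 1 := fun r hr => ⟨ht0.le.trans hr.1, hr.2.trans_lt hs1⟩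
    have hda : ∀ r ∈ Icc t s, HasDerivAt γ (deriv γ r) r := fun r hr =>
      ((h1 r (hm r hr)).differentiableAt (by simp)).hasDerivAt
    have := image_norm_le_of_norm_deriv_right_lt_deriv_boundary (f := fun r => γ r - γ t) (f' := deriv γ) (a := t) (b := s)
      (B := fun r => M * (r - t)) (B' := fun _ => M)
      (fun r hr => ((hda r hr).continuousAt.sub continuousAt_const).continuousWithinAt)
      (fun r hr => ((hda r ⟨hr.1, hr.2.le⟩).sub_const _).hasDerivWithinAt) (by simp)
      (fun r => by simpa using ((hasDerivAt_id r).sub_const t).const_mul M)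
      (fun r hr he => by
        have hr' : r ∈ Icc t s := ⟨hr.1, hr.2.le⟩
        have hin := hmemK (γ r) (by
          rw [he]
          refine le_trans ?_ htδ
          exact mul_le_mul_of_nonneg_left (by linarith [(hm r hr').2]) hM0.le)
        have h5 := (hlow _ hin (deriv γ r)).trans (h3 r (hm r hr'))
        have h6 : ‖deriv γ r‖ ≤ D / c := by rw [le_div_iff₀ hc]; linarith
        rw [hM]; linarith)
      (show s ∈ Icc t s from ⟨hts, le_rfl⟩)
    refine hmemK _ (this.trans (le_trans ?_ htδ))
    exact mul_le_mul_of_nonneg_left (by linarith) hM0.le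
  have hlim : Tendsto (fun k : ℕ => 1 - Real.exp (- (l * k))) atTop (𝓝 (1 - 0)) := by
    refine tendsto_const_nhds.sub (Real.tendsto_exp_neg_atTop_nhds_zero.comp ?_)
    exact tendsto_natCast_atTop_atTop.const_mul_atTop hl
  rw [sub_zero] at hlim
  obtain ⟨k, hk1, hk2⟩ := ((hlim.eventually (lt_mem_nhds ht2)).and (hN.eventually_gt_atTop B)).exists
  have := hB _ (hstay _ hk1.le (by have := Real.exp_pos (- (l * k)); linarith))
  rw [h4] at this
  exact absurd ((le_abs_self _).trans this) (not_le.2 hk2)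

theorem CC0 : 0 ≤ CC rho0 := by
  have := rho1_pos.le.trans rho_le
  unfold CC
  positivity

theorem Nf_zero (h : Good Ω f) (hy : y ∈ Ω) : Nf f y = 0 := by
  by_contra hne
  have hpos : 0 < Nf f y := lt_of_le_of_ne (h.Nf_nonneg hy) (Ne.symm hne)
  have hstep : ∀ p : {z : Fin n → ℝ // z ∈ Ω ∧ 0 < Nf f z}, ∃ q : {z : Fin n → ℝ // z ∈ Ω ∧ 0 < Nf f z},
      Seg Ω p.1 q.1 ∧ Nf f q.1 = 2 * Nf f p.1 ∧
      ∀ t ∈ Icc (0:ℝ) 1, √(dd (q.1 - p.1) (dd (q.1 - p.1) f) (p.1 + t • (q.1 - p.1))) ≤ CC rho0 / √(Nf f p.1) := by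
    rintro ⟨z, hz, hz0⟩
    obtain ⟨w, a1, a2, a3⟩ := h.step' hz hz0
    exact ⟨⟨w, a1.right, by rw [a2]; linarith⟩, a1, a2, a3⟩
  choose F hF1 hF2 hF3 using hstep
  set p : ℕ → {z : Fin n → ℝ // z ∈ Ω ∧ 0 < Nf f z} := fun k => F^[k] ⟨y, hy, hpos⟩ with hp
  have hp1 : ∀ k, p (k + 1) = F (p k) := fun k => Function.iterate_succ_apply' _ _ _
  have hNk : ∀ k : ℕ, Nf f (p k).1 = Nf f y * 2 ^ k := by
    intro k
    induction k with
    | zero => simp [hp]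
    | succ k ih => rw [hp1, hF2, ih, pow_succ]; ring
  refine h.no_chain (x := fun k => (p k).1) (C := CC rho0 / √(Nf f y)) (l := Real.log 2 / 2)
    (div_nonneg CC0 (Real.sqrt_nonneg _)) (by have := Real.log_pos one_lt_two; linarith) (fun k => ?_) (fun k t ht => ?_) ?_
  · simp only [hp1]; exact hF1 _
  · simp only [hp1]
    refine (hF3 _ t ht).trans (le_of_eq ?_)
    rw [hNk, Real.sqrt_mul hpos.le, ← div_div, div_eq_mul_inv _ (√(2 ^ k))]
    congr 1
    rw [Real.exp_neg]
    congr 1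
    rw [Real.sqrt_eq_iff_eq_sq (by positivity) (Real.exp_pos _).le, ← Real.exp_nat_mul]
    rw [show ((2:ℕ):ℝ) * (Real.log 2 / 2 * k) = k * Real.log 2 by push_cast; ring, Real.exp_nat_mul, Real.exp_log two_pos]
  · simp only [hNk]
    exact (tendsto_pow_atTop_atTop_of_one_lt one_lt_two).const_mul_atTop hpos
end Good

namespace Good
variable {n : ℕ} {Ω : Set (Fin n → ℝ)} {f : (Fin n → ℝ) → ℝ} {x y : Fin n → ℝ}

theorem third (h : Good Ω f) (hy : y ∈ Ω) (w : Fin n → ℝ) : dd w (dd w (dd w f)) y = 0 := by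
  have h1 := h.cubic hy w
  have h2 : JJ 1 f y = 0 := le_antisymm ((J_le y).trans (h.Nf_zero hy).le) (h.J_nonneg hy)
  rw [h2, zero_mul] at h1
  exact pow_eq_zero_iff (two_ne_zero) |>.1 (le_antisymm h1 (sq_nonneg _))

theorem all_in (h : Good Ω f) (hx : x ∈ Ω) (v : Fin n → ℝ) : ∀ t ∈ Icc (0:ℝ) 1, x + t • v ∈ Ω := by
  refine h.ray_in hx fun T hT hr => ⟨√(dd v (dd v f) x), fun r hrT => le_of_eq ?_⟩
  congr 1
  have hm : ∀ s ∈ Icc (0:ℝ) r, x + s • v ∈ Ω := fun s hs => hr s ⟨hs.1, hs.2.trans_lt hrT.2⟩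
  have hd : ∀ s ∈ Icc (0:ℝ) r, HasDerivAt (fun s : ℝ => dd v (dd v f) (x + s • v)) 0 s := fun s hs => by
    have := dd_line (v := v) h.ho ((h.hf.dd h.ho).dd h.ho) (hm s hs) (u := dd v (dd v f))
    rwa [h.third (hm s hs) v] at this
  have := constant_of_has_deriv_right_zero (fun s hs => (hd s hs).continuousAt.continuousWithinAt)
    (fun s hs => (hd s ⟨hs.1, hs.2.le⟩).hasDerivWithinAt) r ⟨hrT.1, le_rfl⟩
  simpa using this

theorem taylor (h : Good Ω f) (hx : x ∈ Ω) (v : Fin n → ℝ) :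
    f (x + v) = f x + dd v f x + dd v (dd v f) x / 2 := by
  have hin := h.all_in hx v
  have h3 : ∀ t ∈ Icc (0:ℝ) 1, dd v (dd v f) (x + t • v) = dd v (dd v f) x := by
    have hd : ∀ s ∈ Icc (0:ℝ) 1, HasDerivAt (fun s : ℝ => dd v (dd v f) (x + s • v)) 0 s := fun s hs => by
      have := dd_line (v := v) h.ho ((h.hf.dd h.ho).dd h.ho) (hin s hs) (u := dd v (dd v f))
      rwa [h.third (hin s hs) v] at this
    intro t ht
    have := constant_of_has_deriv_right_zero (fun s hs => (hd s hs).continuousAt.continuousWithinAt)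
      (fun s hs => (hd s ⟨hs.1, hs.2.le⟩).hasDerivWithinAt) t ht
    simpa using this
  set q := dd v (dd v f) x
  have h2 : ∀ t ∈ Icc (0:ℝ) 1, dd v f (x + t • v) - t * q = dd v f x := by
    have hd : ∀ s ∈ Icc (0:ℝ) 1, HasDerivAt (fun s : ℝ => dd v f (x + s • v) - s * q) 0 s := fun s hs => by
      have := (dd_line (v := v) h.ho (h.hf.dd h.ho) (hin s hs) (u := dd v f)).sub ((hasDerivAt_id s).mul_const q)
      refine this.congr_deriv ?_
      rw [h3 s hs]; ring
    intro t ht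
    have := constant_of_has_deriv_right_zero (fun s hs => (hd s hs).continuousAt.continuousWithinAt)
      (fun s hs => (hd s ⟨hs.1, hs.2.le⟩).hasDerivWithinAt) t ht
    simpa using this
  have hd : ∀ s ∈ Icc (0:ℝ) 1, HasDerivAt (fun s : ℝ => f (x + s • v) - s * dd v f x - s ^ 2 * (q / 2)) 0 s := fun s hs => by
    have := ((dd_line (v := v) h.ho h.hf (hin s hs)).sub ((hasDerivAt_id s).mul_const (dd v f x))).sub
      ((hasDerivAt_pow 2 s).mul_const (q / 2))
    refine this.congr_deriv ?_
    rw [← h2 s hs]; push_cast; ring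
  have := constant_of_has_deriv_right_zero (fun s hs => (hd s hs).continuousAt.continuousWithinAt)
    (fun s hs => (hd s ⟨hs.1, hs.2.le⟩).hasDerivWithinAt) 1 (by simp)
  simp at this
  linarith

theorem quadratic (h : Good Ω f) : IsQuadraticOn n Ω f := by
  rcases Ω.eq_empty_or_nonempty with he | ⟨x, hx⟩
  · subst he
    exact ⟨1, Matrix.isSymm_one, Matrix.PosDef.one, 0, 0, fun x hx => absurd hx (notMem_empty x)⟩
  have hsym : (Hess n f x)ᵀ = Hess n f x := by rw [Hess_eq]; exact Gm_symm h.ho h.hf hx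
  have hfr : ∀ v : Fin n → ℝ, dd v f x = (fun i => dd (fr 1 i) f x) ⬝ᵥ v := by
    intro v
    have hw : v = ∑ i, v i • fr (1 : Matrix (Fin n) (Fin n) ℝ) i := by
      have := sub_fr 0 v; simpa using this
    conv_lhs => rw [hw, dd1_dir]
    exact Finset.sum_congr rfl fun i _ => mul_comm _ _
  refine ⟨Hess n f x, hsym, by rw [Hess_eq]; exact h.hp x hx, (fun i => dd (fr 1 i) f x) - Hess n f x *ᵥ x,
    f x - (fun i => dd (fr 1 i) f x) ⬝ᵥ x + (1 / 2) * (Hess n f x *ᵥ x ⬝ᵥ x), fun y _ => ?_⟩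
  have h1 := h.taylor hx (y - x)
  rw [add_sub_cancel, hfr, ← h.quad_eq hx] at h1
  rw [h1]
  have h2 : Hess n f x *ᵥ y ⬝ᵥ x = Hess n f x *ᵥ x ⬝ᵥ y := by
    rw [dotProduct_comm, Matrix.dotProduct_mulVec, ← Matrix.mulVec_transpose, hsym]
  simp only [Matrix.mulVec_sub, sub_dotProduct, dotProduct_sub, h2]
  ring
end Good

theorem affine_kahler_scalar_flat_complete_implies_quadratic
    (n : ℕ) (hn2 : 2 ≤ n) (hn5 : n ≤ 5) (Ω : Set (Fin n → ℝ)) (hΩ : IsOpen Ω)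
    (f : (Fin n → ℝ) → ℝ) (hf : ContDiffOn ℝ (⊤ : ℕ∞) f Ω)
    (hpos : ∀ x ∈ Ω, (Hess n f x).PosDef)
    (hscal : ∀ x ∈ Ω,
      -(1 / 2 : ℝ) * ∑ i, ∑ j, (Hess n f x)⁻¹ i j *
        pder n i (pder n j (fun y => Real.log (Hess n f y).det)) x = 0)
    (hcomplete : CalabiComplete n Ω f) :
    IsQuadraticOn n Ω f := by
  have hp : ∀ y ∈ Ω, (Gm 1 f y).PosDef := fun y hy => by rw [← Hess_eq]; exact hpos y hy
  have hFs : Sm Ω (FF f) := (SmM_Gm hΩ hf).det.log fun y hy => (hp y hy).det_pos.ne'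
  refine Good.quadratic ⟨hn5, hΩ, hf, hp, fun y hy => ?_, hcomplete⟩
  have h1 := hscal y hy
  have h2 : ∀ i j, pder n i (pder n j (fun y => Real.log (Hess n f y).det)) y = Gm 1 (FF f) y j i := by
    intro i j
    have : (Gm 1 (FF f) y)ᵀ = Gm 1 (FF f) y := Gm_symm hΩ hFs hy
    rw [← this, Matrix.transpose_apply, ← Hess_eq, Hess_eq (f := f)]
    rfl
  simp only [h2] at h1
  rw [Hess_eq] at h1
  rw [LL, Matrix.trace]
  simp only [Matrix.diag_apply, Matrix.mul_apply]
  linarith
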